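/- arXiv:1405.0912 — 5 statements merged into one kernel-verified Lean document; each statement's English description precedes it below -/
import Mathlib

section
/- Let Γ be a subgroup of Diff^ω_+([0,1]) and suppose there exists N ≥ 1 such that every nontrivial element of Γ has at most N fixed points in the open interval (0,1). Then Γ is metabelian, i.e. its commutator subgroup is abelian. -/
/-- An element of the group of order-isomorphisms of `[0,1]` (equivalently, an
orientation-preserving homeomorphism of `[0,1]`, automatically fixing `0` and `1`)
is an orientation-preserving real-analytic diffeomorphism of `[0,1]` if both it and
its inverse extend to functions that are real-analytic on a neighborhood of `[0,1]`
with nowhere-vanishing derivative on `[0,1]`. -/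
def IsAnalyticDiffeo (σ : ↥(Set.Icc (0:ℝ) 1) ≃o ↥(Set.Icc (0:ℝ) 1)) : Prop :=
  ∃ F G : ℝ → ℝ,
    AnalyticOnNhd ℝ F (Set.Icc 0 1) ∧ AnalyticOnNhd ℝ G (Set.Icc 0 1) ∧
    (∀ x ∈ Set.Icc (0:ℝ) 1, deriv F x ≠ 0) ∧ (∀ x ∈ Set.Icc (0:ℝ) 1, deriv G x ≠ 0) ∧
    (∀ x : ↥(Set.Icc (0:ℝ) 1), (σ x : ℝ) = F x) ∧
    (∀ x : ↥(Set.Icc (0:ℝ) 1), (σ.symm x : ℝ) = G x)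

/-- The set of fixed points of `f` lying in the open interval `(0,1)`. -/
def interiorFixedPoints (f : ↥(Set.Icc (0:ℝ) 1) ≃o ↥(Set.Icc (0:ℝ) 1)) :
    Set ↥(Set.Icc (0:ℝ) 1) :=
  {x | f x = x ∧ 0 < (x : ℝ) ∧ (x : ℝ) < 1}

namespace MetaB
open Set Filter Topology

abbrev I := ↥(Set.Icc (0:ℝ) 1)
abbrev G := I ≃o I

/-- The extension of `σ` to the real line. -/
noncomputable def E (σ : G) (x : ℝ) : ℝ := σ (projIcc 0 1 zero_le_one x)

lemma E_mul (σ τ : G) (x : ℝ) : E (σ * τ) x = E σ (E τ x) := by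
  simp [E, RelIso.mul_apply]

lemma E_mem (σ : G) (x : ℝ) : E σ x ∈ Icc (0:ℝ) 1 := (σ _).2

lemma E_coe (σ : G) (x : I) : E σ x = σ x := by simp [E]

lemma E_one {x : ℝ} (hx : x ∈ Icc (0:ℝ) 1) : E 1 x = x := by
  simp [E, projIcc_of_mem _ hx]

lemma E_lt (σ : G) {x y : ℝ} (hx : x ∈ Icc (0:ℝ) 1) (hy : y ∈ Icc (0:ℝ) 1) (h : x < y) :
    E σ x < E σ y := by
  rw [E, E, projIcc_of_mem _ hx, projIcc_of_mem _ hy]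
  have : σ ⟨x, hx⟩ < σ ⟨y, hy⟩ := σ.lt_iff_lt.2 h
  exact this

lemma E_le (σ : G) {x y : ℝ} (hx : x ∈ Icc (0:ℝ) 1) (hy : y ∈ Icc (0:ℝ) 1) (h : x ≤ y) :
    E σ x ≤ E σ y := by
  rcases h.eq_or_lt with h | h
  · rw [h]
  · exact (E_lt σ hx hy h).le

lemma E_inv (σ : G) {x : ℝ} (hx : x ∈ Icc (0:ℝ) 1) : E σ⁻¹ (E σ x) = x := by
  rw [← E_mul, inv_mul_cancel, E_one hx]

lemma E_inv' (σ : G) {x : ℝ} (hx : x ∈ Icc (0:ℝ) 1) : E σ (E σ⁻¹ x) = x := by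
  rw [← E_mul, mul_inv_cancel, E_one hx]

lemma zmem : (0:ℝ) ∈ Icc (0:ℝ) 1 := by simp

lemma E_zero (σ : G) : E σ 0 = 0 := by
  apply le_antisymm _ (E_mem σ 0).1
  have := E_le σ zmem (E_mem σ⁻¹ 0) (E_mem σ⁻¹ 0).1
  rwa [E_inv' σ zmem] at this

lemma E_pos (σ : G) {x : ℝ} (hx : x ∈ Icc (0:ℝ) 1) (h : 0 < x) : 0 < E σ x := by
  have := E_lt σ zmem hx h
  rwa [E_zero] at this

lemma E_cont (σ : G) : Continuous (E σ) :=
  continuous_subtype_val.comp (σ.continuous.comp continuous_projIcc)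

lemma ev_Ioo {δ : ℝ} (h : 0 < δ) : ∀ᶠ x in 𝓝[>] (0:ℝ), x ∈ Ioo 0 δ := Ioo_mem_nhdsGT h

lemma E_tendsto (σ : G) : Tendsto (E σ) (𝓝[>] 0) (𝓝[>] 0) := by
  apply tendsto_nhdsWithin_of_tendsto_nhds_of_eventually_within
  · have := (E_cont σ).tendsto 0
    rw [E_zero] at this
    exact this.mono_left nhdsWithin_le_nhds
  · filter_upwards [ev_Ioo one_pos] with x hx
    exact E_pos σ ⟨hx.1.le, hx.2.le⟩ hx.1

/-- `σ(x) = x + c x^(k+1) + o(x^(k+1))` at `0`. -/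
def Lead (k : ℕ) (c : ℝ) (σ : G) : Prop :=
  Tendsto (fun x => (E σ x - x) / x ^ (k+1)) (𝓝[>] 0) (𝓝 c)

lemma id_tendsto : Tendsto (fun x : ℝ => x) (𝓝[>] 0) (𝓝 0) :=
  tendsto_id.mono_left nhdsWithin_le_nhds

lemma Lead.lower {k l : ℕ} {c : ℝ} {σ : G} (h : Lead l c σ) (hkl : k < l) : Lead k 0 σ := by
  have h1 : Tendsto (fun x : ℝ => x ^ (l - k)) (𝓝[>] 0) (𝓝 0) := by
    have := id_tendsto.pow (l - k)
    rwa [zero_pow (by omega)] at this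
  have h2 := Tendsto.mul h h1
  rw [mul_zero] at h2
  refine h2.congr' ?_
  filter_upwards [self_mem_nhdsWithin] with x hx
  have hx : 0 < x := hx
  have : x ^ (l+1) = x ^ (k+1) * x ^ (l-k) := by rw [← pow_add]; congr 1; omega
  rw [this]
  field_simp

lemma Lead.ratio {k : ℕ} {c : ℝ} {σ : G} (hk : 1 ≤ k) (h : Lead k c σ) :
    Tendsto (fun x => E σ x / x) (𝓝[>] 0) (𝓝 1) := by
  have h1 : Lead 0 0 σ := h.lower hk
  have h2 := Tendsto.add h1 (tendsto_const_nhds (x := (1:ℝ)))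
  rw [zero_add (1:ℝ)] at h2
  refine h2.congr' ?_
  filter_upwards [self_mem_nhdsWithin] with x hx
  have hx : 0 < x := hx
  field_simp
  ring

lemma Lead.one (k : ℕ) : Lead k 0 1 := by
  refine tendsto_const_nhds.congr' ?_
  filter_upwards [ev_Ioo one_pos] with x hx
  rw [E_one ⟨hx.1.le, hx.2.le⟩]; simp

/-- Change of variables `y = τ x`. -/
lemma Lead.comp {k : ℕ} {c : ℝ} {σ τ : G} (h : Lead k c σ)
    (hr : Tendsto (fun x => E τ x / x) (𝓝[>] 0) (𝓝 1)) :
    Tendsto (fun x => (E σ (E τ x) - E τ x) / x ^ (k+1)) (𝓝[>] 0) (𝓝 c) := by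
  have h2 := Tendsto.mul (Tendsto.comp h (E_tendsto τ)) (hr.pow (k+1))
  rw [one_pow, mul_one] at h2
  refine h2.congr' ?_
  filter_upwards [ev_Ioo one_pos] with x hx
  have hx0 := hx.1
  have := E_pos τ ⟨hx.1.le, hx.2.le⟩ hx.1
  simp only [Function.comp]
  rw [div_pow]
  field_simp

lemma Lead.mul {k : ℕ} {c d : ℝ} {σ τ : G} (hk : 1 ≤ k) (h : Lead k c σ) (h' : Lead k d τ) :
    Lead k (c + d) (σ * τ) := by
  refine (Tendsto.add (h.comp (h'.ratio hk)) h').congr fun x => ?_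
  rw [E_mul]; ring

lemma ratio_inv {τ : G} (hr : Tendsto (fun x => E τ x / x) (𝓝[>] 0) (𝓝 1)) :
    Tendsto (fun x => E τ⁻¹ x / x) (𝓝[>] 0) (𝓝 1) := by
  have h2 := (Tendsto.comp hr (E_tendsto τ⁻¹)).inv₀ one_ne_zero
  rw [inv_one] at h2
  refine h2.congr' ?_
  filter_upwards [ev_Ioo one_pos] with x hx
  simp only [Function.comp]
  rw [E_inv' τ ⟨hx.1.le, hx.2.le⟩, inv_div]

lemma Lead.inv {k : ℕ} {c : ℝ} {σ : G} (hk : 1 ≤ k) (h : Lead k c σ) : Lead k (-c) σ⁻¹ := by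
  refine (h.comp (ratio_inv (h.ratio hk))).neg.congr' ?_
  filter_upwards [ev_Ioo one_pos] with x hx
  rw [E_inv' σ ⟨hx.1.le, hx.2.le⟩]; ring

lemma Lead.pow {k : ℕ} {c : ℝ} {σ : G} (hk : 1 ≤ k) (h : Lead k c σ) (m : ℕ) :
    Lead k (m * c) (σ ^ m) := by
  induction m with
  | zero => simpa using Lead.one k
  | succ m ih =>
    have := ih.mul hk h
    rw [pow_succ]
    convert this using 1
    push_cast; ring

/-- Tangent to the identity, with an analytic extension. -/
def TI (σ : G) : Prop :=
  ∃ F : ℝ → ℝ, AnalyticAt ℝ F 0 ∧ deriv F 0 = 1 ∧ ∀ x ∈ Icc (0:ℝ) 1, E σ x = F x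

lemma TI.ratio {σ : G} (h : TI σ) : Tendsto (fun x => E σ x / x) (𝓝[>] 0) (𝓝 1) := by
  obtain ⟨F, hF, hd, he⟩ := h
  have h1 := hF.differentiableAt.hasDerivAt
  rw [hd, hasDerivAt_iff_tendsto_slope] at h1
  have h2 := h1.mono_left (nhdsWithin_mono 0 (fun x (hx : x ∈ Ioi (0:ℝ)) => (ne_of_gt hx : x ≠ 0)))
  refine h2.congr' ?_
  have h0 : F 0 = 0 := by rw [← he 0 zmem, E_zero]
  filter_upwards [ev_Ioo one_pos] with x hx
  rw [slope_def_field, he x ⟨hx.1.le, hx.2.le⟩, h0]; simp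

/-- Conjugation by elements tangent to the identity preserves the leading coefficient. -/
lemma Lead.conj {k : ℕ} {c : ℝ} {σ τ : G} (h : Lead k c σ) (hτ : TI τ) (hτ' : TI τ⁻¹) :
    Lead k c (τ⁻¹ * σ * τ) := by
  have h1 := h.comp hτ.ratio
  obtain ⟨F, hF, hd, he⟩ := hτ'
  have hs := hF.hasStrictDerivAt
  rw [hd] at hs
  have hs2 := hs.isLittleO
  have ht : Tendsto (fun x => (E σ (E τ x), E τ x)) (𝓝[>] 0) (𝓝 (0, 0)) := by
    rw [nhds_prod_eq]
    exact (((E_tendsto σ).comp (E_tendsto τ)).mono_right nhdsWithin_le_nhds).prodMk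
      ((E_tendsto τ).mono_right nhdsWithin_le_nhds)
  have hs3 := hs2.comp_tendsto ht
  have hO : (fun x => E σ (E τ x) - E τ x) =O[𝓝[>] 0] fun x : ℝ => x ^ (k+1) := by
    refine Asymptotics.isBigO_of_div_tendsto_nhds ?_ c h1
    filter_upwards [self_mem_nhdsWithin] with x hx hx'
    exact absurd hx' (pow_ne_zero _ (ne_of_gt hx))
  have hs4 := (hs3.trans_isBigO hO).tendsto_div_nhds_zero
  refine (zero_add c ▸ hs4.add h1).congr' ?_
  filter_upwards [ev_Ioo one_pos] with x hx
  simp only [Function.comp]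
  rw [E_mul, E_mul, he _ (E_mem _ _)]
  have : F (E τ x) = x := by rw [← he _ (E_mem _ _), E_inv τ ⟨hx.1.le, hx.2.le⟩]
  rw [this]
  simp
  ring

lemma TI.lead {σ : G} (h : TI σ) (hfin : (interiorFixedPoints σ).Finite) :
    ∃ k c, 1 ≤ k ∧ c ≠ 0 ∧ Lead k c σ := by
  obtain ⟨F, hF, hd, he⟩ := h
  have h0 : F 0 = 0 := by rw [← he 0 zmem, E_zero]
  have hA : AnalyticAt ℝ (fun x => F x - x) 0 := hF.sub analyticAt_id
  by_cases hz : ∀ᶠ x in 𝓝 (0:ℝ), F x - x = 0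
  · exfalso
    obtain ⟨ε, hε, hb⟩ := Metric.eventually_nhds_iff.1 hz
    have hinf : (Ioo (0:ℝ) (min ε 1)).Infinite := Ioo_infinite (lt_min hε one_pos)
    apply hinf
    apply (hfin.image (fun x : I => (x:ℝ))).subset
    intro x hx
    have hx1 : x < 1 := hx.2.trans_le (min_le_right _ _)
    have hx2 : x < ε := hx.2.trans_le (min_le_left _ _)
    refine ⟨⟨x, hx.1.le, hx1.le⟩, ⟨?_, hx.1, hx1⟩, rfl⟩
    apply Subtype.ext
    rw [← E_coe]
    change E σ x = x
    rw [he x ⟨hx.1.le, hx1.le⟩]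
    have := @hb x (by rw [Real.dist_eq, sub_zero, abs_of_pos hx.1]; exact hx2)
    linarith
  · obtain ⟨n, g, hg, hg0, hn⟩ := (hA.exists_eventuallyEq_pow_smul_nonzero_iff).2 hz
    simp only [sub_zero, smul_eq_mul] at hn
    have hn0 : n ≠ 0 := by
      rintro rfl
      have := hn.self_of_nhds
      simp [h0] at this
      exact hg0 this.symm
    have hn1 : n ≠ 1 := by
      rintro rfl
      have h1 : HasDerivAt (fun x => F x - x) (deriv F 0 - 1) 0 :=
        hF.differentiableAt.hasDerivAt.sub (hasDerivAt_id 0)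
      have h2 : HasDerivAt (fun x => x ^ 1 * g x) ((1:ℝ) * g 0 + 0 * deriv g 0) 0 := by
        have := (hasDerivAt_id (0:ℝ)).mul hg.differentiableAt.hasDerivAt
        simp only [pow_one]
        exact this
      have h3 := h1.unique (h2.congr_of_eventuallyEq hn)
      rw [hd] at h3
      apply hg0
      linarith
    obtain ⟨k, rfl⟩ : ∃ k, n = k + 1 := ⟨n - 1, by omega⟩
    refine ⟨k, g 0, by omega, hg0, ?_⟩
    refine (hg.continuousAt.tendsto.mono_left nhdsWithin_le_nhds).congr' ?_
    filter_upwards [ev_Ioo one_pos, nhdsWithin_le_nhds hn] with x hx hx'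
    rw [he x ⟨hx.1.le, hx.2.le⟩, hx']
    have := hx.1
    field_simp

lemma sign_ev {F : ℝ → ℝ} (hF : AnalyticAt ℝ F 0) :
    (∀ᶠ x in 𝓝[>] (0:ℝ), 0 ≤ F x) ∨ (∀ᶠ x in 𝓝[>] (0:ℝ), F x ≤ 0) := by
  by_cases hz : ∀ᶠ x in 𝓝 (0:ℝ), F x = 0
  · left
    filter_upwards [nhdsWithin_le_nhds hz] with x hx using hx.ge
  · obtain ⟨n, g, hg, hg0, hn⟩ := (hF.exists_eventuallyEq_pow_smul_nonzero_iff).2 hz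
    simp only [sub_zero, smul_eq_mul] at hn
    rcases lt_or_gt_of_ne hg0 with h | h
    · right
      filter_upwards [self_mem_nhdsWithin, nhdsWithin_le_nhds hn,
        nhdsWithin_le_nhds (hg.continuousAt.eventually_lt continuousAt_const h)] with x hx h1 h2
      rw [h1]
      exact mul_nonpos_of_nonneg_of_nonpos (pow_nonneg (le_of_lt hx) _) h2.le
    · left
      filter_upwards [self_mem_nhdsWithin, nhdsWithin_le_nhds hn,
        nhdsWithin_le_nhds (continuousAt_const.eventually_lt hg.continuousAt h)] with x hx h1 h2
      rw [h1]
      exact mul_nonneg (pow_nonneg (le_of_lt hx) _) h2.le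

lemma Lead.ev_neg {k : ℕ} {c : ℝ} {σ : G} (h : Lead k c σ) (hc : c < 0) :
    ∀ᶠ x in 𝓝[>] (0:ℝ), E σ x - x < 0 := by
  filter_upwards [h.eventually_lt_const hc, self_mem_nhdsWithin] with x hx hx0
  have hp : 0 < x ^ (k+1) := pow_pos hx0 _
  by_contra hcon
  exact absurd hx (not_lt.2 (div_nonneg (not_lt.1 hcon) hp.le))

lemma Lead.ev_pos {k : ℕ} {c : ℝ} {σ : G} (h : Lead k c σ) (hc : 0 < c) :
    ∀ᶠ x in 𝓝[>] (0:ℝ), 0 < E σ x - x := by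
  filter_upwards [h.eventually_const_lt hc, self_mem_nhdsWithin] with x hx hx0
  have hp : 0 < x ^ (k+1) := pow_pos hx0 _
  by_contra hcon
  exact absurd hx (not_lt.2 (div_nonpos_of_nonpos_of_nonneg (not_lt.1 hcon) hp.le))

lemma exists_delta {k : ℕ} {c : ℝ} {f : G} (hT : TI f) (h : Lead k c f) (hc : c < 0) :
    ∃ δ, 0 < δ ∧ δ ≤ 1 ∧ (∀ x ∈ Ioc 0 δ, E f x < x) ∧ ConcaveOn ℝ (Icc 0 δ) (E f) := by
  obtain ⟨F, hF, hd, he⟩ := hT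
  have h0 : F 0 = 0 := by rw [← he 0 zmem, E_zero]
  have hsg := sign_ev hF.deriv.deriv
  have hev := (h.ev_neg hc).and (nhdsWithin_le_nhds (s := Ioi 0) hF.eventually_analyticAt)
  have key : ∀ P : ℝ → Prop, (∀ᶠ x in 𝓝[>] (0:ℝ), P x) →
      ∃ δ, 0 < δ ∧ δ ≤ 1 ∧ ∀ x ∈ Ioc 0 δ, P x ∧ E f x - x < 0 ∧ AnalyticAt ℝ F x := by
    intro P hP
    obtain ⟨u, hu, hsub⟩ := (mem_nhdsGT_iff_exists_Ioc_subset).1 (hP.and hev)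
    refine ⟨min u 1, lt_min hu one_pos, min_le_right _ _, fun x hx => ?_⟩
    exact hsub ⟨hx.1, hx.2.trans (min_le_left _ _)⟩
  rcases hsg with hs | hs
  · exfalso
    obtain ⟨δ, hδ, hδ1, hP⟩ := key _ hs
    have hAn : ∀ x ∈ Icc 0 δ, AnalyticAt ℝ F x := by
      intro x hx
      rcases hx.1.eq_or_lt with h | h
      · rw [← h]; exact hF
      · exact (hP x ⟨h, hx.2⟩).2.2
    have hcv : ConvexOn ℝ (Icc 0 δ) F := by
      apply convexOn_of_deriv2_nonneg (convex_Icc _ _)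
      · exact fun x hx => (hAn x hx).continuousAt.continuousWithinAt
      · exact fun x hx => (hAn x (interior_subset hx)).differentiableAt.differentiableWithinAt
      · exact fun x hx => (hAn x (interior_subset hx)).deriv.differentiableAt.differentiableWithinAt
      · intro x hx
        rw [interior_Icc] at hx
        exact (hP x ⟨hx.1, hx.2.le⟩).1
    have h1 := hcv.le_slope_of_hasDerivAt (x := 0) (y := δ) ⟨le_rfl, hδ.le⟩ ⟨hδ.le, le_rfl⟩ hδ
      hF.differentiableAt.hasDerivAt
    rw [hd, slope_def_field, h0, sub_zero, sub_zero, le_div_iff₀ hδ, ← he δ ⟨hδ.le, hδ1⟩] at h1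
    have := (hP δ ⟨hδ, le_rfl⟩).2.1
    linarith
  · obtain ⟨δ, hδ, hδ1, hP⟩ := key _ hs
    have hAn : ∀ x ∈ Icc 0 δ, AnalyticAt ℝ F x := by
      intro x hx
      rcases hx.1.eq_or_lt with h | h
      · rw [← h]; exact hF
      · exact (hP x ⟨h, hx.2⟩).2.2
    have hcv : ConcaveOn ℝ (Icc 0 δ) F := by
      apply concaveOn_of_deriv2_nonpos (convex_Icc _ _)
      · exact fun x hx => (hAn x hx).continuousAt.continuousWithinAt
      · exact fun x hx => (hAn x (interior_subset hx)).differentiableAt.differentiableWithinAt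
      · exact fun x hx => (hAn x (interior_subset hx)).deriv.differentiableAt.differentiableWithinAt
      · intro x hx
        rw [interior_Icc] at hx
        exact (hP x ⟨hx.1, hx.2.le⟩).1
    refine ⟨δ, hδ, hδ1, fun x hx => by linarith [(hP x hx).2.1], hcv.congr ?_⟩
    intro x hx
    exact (he x ⟨hx.1, hx.2.trans hδ1⟩).symm

lemma concave_ratio {δ : ℝ} {φ : ℝ → ℝ} (hc : ConcaveOn ℝ (Icc 0 δ) φ)
    (hm : MonotoneOn φ (Icc 0 δ)) {z y w : ℝ} (hz : z ∈ Icc 0 δ) (hy : y ∈ Icc 0 δ)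
    (hw : w ∈ Icc 0 δ) (hyw : y < w) (hzw : z ≤ w) :
    |z - y| * (φ w - φ y) ≤ |φ z - φ y| * (w - y) := by
  rcases lt_trichotomy z y with h | h | h
  · have h1 := hc.slope_anti_adjacent hz hw h hyw
    have h2 := hm hz hy h.le
    rw [div_le_div_iff₀ (by linarith) (by linarith)] at h1
    rw [abs_of_neg (by linarith), abs_of_nonpos (by linarith)]
    linarith
  · simp [h]
  · have h2 := hm hy hz h.le
    rw [abs_of_pos (by linarith), abs_of_nonneg (by linarith)]
    rcases hzw.eq_or_lt with h3 | h3
    · rw [h3]; linarith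
    · have h1 := hc.slope_anti_adjacent hy hw h h3
      rw [div_le_div_iff₀ (by linarith) (by linarith)] at h1
      linarith

section
variable {δ : ℝ} {f : G}

lemma iter_mem (hδ1 : δ ≤ 1) (hlt : ∀ x ∈ Ioc 0 δ, E f x < x)
    {x : ℝ} (hx : x ∈ Icc 0 δ) (n : ℕ) : E (f ^ n) x ∈ Icc 0 δ := by
  induction n with
  | zero => rw [pow_zero, E_one ⟨hx.1, hx.2.trans hδ1⟩]; exact hx
  | succ n ih =>
    rw [pow_succ', E_mul]
    refine ⟨(E_mem _ _).1, ?_⟩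
    rcases ih.1.eq_or_lt with h | h
    · rw [← h, E_zero]; exact ih.1.trans ih.2
    · exact (hlt _ ⟨h, ih.2⟩).le.trans ih.2

lemma iter_ratio (hδ1 : δ ≤ 1) (hlt : ∀ x ∈ Ioc 0 δ, E f x < x)
    (hc : ConcaveOn ℝ (Icc 0 δ) (E f)) {z y w : ℝ} (hz : z ∈ Icc 0 δ) (hy : y ∈ Icc 0 δ)
    (hw : w ∈ Icc 0 δ) (hyw : y < w) (hzw : z ≤ w) (n : ℕ) :
    |z - y| * (E (f ^ n) w - E (f ^ n) y) ≤ |E (f ^ n) z - E (f ^ n) y| * (w - y) := by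
  have hI : ∀ {t}, t ∈ Icc 0 δ → t ∈ Icc (0:ℝ) 1 := fun ht => ⟨ht.1, ht.2.trans hδ1⟩
  induction n with
  | zero => rw [pow_zero, E_one (hI hz), E_one (hI hy), E_one (hI hw)]
  | succ n ih =>
    have hB := E_lt (f ^ n) (hI hy) (hI hw) hyw
    have hm : MonotoneOn (E f) (Icc 0 δ) := fun a ha b hb h => E_le f (hI ha) (hI hb) h
    have h2 := concave_ratio hc hm (iter_mem hδ1 hlt hz n) (iter_mem hδ1 hlt hy n)
      (iter_mem hδ1 hlt hw n) hB (E_le (f ^ n) (hI hz) (hI hw) hzw)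
    simp only [pow_succ' f n, E_mul]
    have hB' := E_lt f (E_mem (f ^ n) y) (E_mem (f ^ n) w) hB
    set A := |z - y|
    set A1 := |E (f ^ n) z - E (f ^ n) y|
    set A2 := |E f (E (f ^ n) z) - E f (E (f ^ n) y)|
    set B1 := E (f ^ n) w - E (f ^ n) y
    set B2 := E f (E (f ^ n) w) - E f (E (f ^ n) y)
    have hB1 : 0 < B1 := sub_pos.2 hB
    have hB2 : 0 < B2 := sub_pos.2 hB'
    have hB0 : 0 < w - y := sub_pos.2 hyw
    refine le_of_mul_le_mul_right ?_ hB1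
    have e1 := mul_le_mul_of_nonneg_right ih hB2.le
    have e2 := mul_le_mul_of_nonneg_right h2 hB0.le
    linarith

lemma iter_tendsto (hδ1 : δ ≤ 1) (hlt : ∀ x ∈ Ioc 0 δ, E f x < x)
    {x : ℝ} (hx : x ∈ Ioc 0 δ) : Tendsto (fun n : ℕ => E (f ^ n) x) atTop (𝓝[>] 0) := by
  have hpos : ∀ n : ℕ, 0 < E (f ^ n) x := fun n => E_pos _ ⟨hx.1.le, hx.2.trans hδ1⟩ hx.1
  have hmem := iter_mem hδ1 hlt ⟨hx.1.le, hx.2⟩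
  have hanti : Antitone fun n : ℕ => E (f ^ n) x := by
    apply antitone_nat_of_succ_le
    intro n
    rw [pow_succ', E_mul]
    exact (hlt _ ⟨hpos n, (hmem n).2⟩).le
  have hbd : BddBelow (range fun n : ℕ => E (f ^ n) x) :=
    ⟨0, by rintro _ ⟨n, rfl⟩; exact (hpos n).le⟩
  have hlim := tendsto_atTop_ciInf hanti hbd
  set L := ⨅ n : ℕ, E (f ^ n) x
  have hL : L ∈ Icc 0 δ := isClosed_Icc.mem_of_tendsto hlim (Eventually.of_forall hmem)
  have h1 := ((E_cont f).tendsto L).comp hlim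
  have h2 := hlim.comp (tendsto_add_atTop_nat 1)
  have h3 : E f L = L := by
    refine tendsto_nhds_unique h1 (h2.congr fun n => ?_)
    simp only [Function.comp]
    rw [pow_succ', E_mul]
  have hL0 : L = 0 := by
    rcases hL.1.eq_or_lt with h | h
    · exact h.symm
    · exact absurd h3 (hlt L ⟨h, hL.2⟩).ne
  rw [hL0] at hlim
  exact tendsto_nhdsWithin_of_tendsto_nhds_of_eventually_within _ hlim (Eventually.of_forall hpos)

lemma conj_tendsto {k : ℕ} {c : ℝ} (hk : 1 ≤ k) (hf : Lead k c f) (hc0 : c < 0)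
    (hδ1 : δ ≤ 1) (hlt : ∀ x ∈ Ioc 0 δ, E f x < x)
    (hc : ConcaveOn ℝ (Icc 0 δ) (E f)) {q : G} (hq : Lead k 0 q) {x : ℝ} (hx0 : 0 < x)
    (hxδ : x < E f δ) :
    Tendsto (fun n : ℕ => E ((f ^ n)⁻¹ * q * f ^ n) x) atTop (𝓝 x) := by
  have hx1 : x ∈ Icc (0:ℝ) 1 := ⟨hx0.le, hxδ.le.trans (E_mem f δ).2⟩
  have hδ0 : 0 < δ := by
    by_contra hcon
    have : E f δ = 0 := by
      rw [E, projIcc_of_le_left _ (not_lt.1 hcon)]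
      have := E_zero f
      rwa [E, projIcc_left] at this
    linarith
  have hδm : δ ∈ Icc (0:ℝ) 1 := ⟨hδ0.le, hδ1⟩
  have hxd : x < δ := hxδ.trans (hlt δ ⟨hδ0, le_rfl⟩)
  set w := E f⁻¹ x with hw
  have hwm1 : w ∈ Icc (0:ℝ) 1 := E_mem _ _
  have hwδ : w ≤ δ := by
    have := E_lt f⁻¹ hx1 (E_mem f δ) hxδ
    rw [E_inv f hδm] at this
    exact this.le
  have hxw : x < w := by
    have := E_lt f⁻¹ (E_mem f x) hx1 (hlt x ⟨hx0, hxd.le⟩)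
    rwa [E_inv f hx1] at this
  have hy := iter_tendsto hδ1 hlt (x := x) ⟨hx0, hxd.le⟩
  have hr : Tendsto (fun y => (E q y - y) / (E f⁻¹ y - y)) (𝓝[>] 0) (𝓝 0) := by
    have := Tendsto.div hq (hf.inv hk) (by linarith : -c ≠ 0)
    rw [zero_div] at this
    refine this.congr' ?_
    filter_upwards [self_mem_nhdsWithin] with y hy
    have hy : 0 < y := hy
    simp only [Pi.div_apply]
    rw [div_div_div_cancel_right₀ (pow_pos hy _).ne']
  have hry := (hr.comp hy).abs
  rw [abs_zero] at hry
  have hfin := hry.mul_const (w - x)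
  rw [zero_mul] at hfin
  rw [tendsto_iff_dist_tendsto_zero]
  refine squeeze_zero' (Eventually.of_forall fun _ => dist_nonneg) ?_ hfin
  filter_upwards [hry.eventually_lt_const one_pos] with n hn
  simp only [Function.comp] at hn ⊢
  set y := E (f ^ n) x with hyd
  have e1 : E (f ^ n) w = E f⁻¹ y := by
    rw [hw, hyd, ← E_mul, ← E_mul]
    congr 1
    exact ((Commute.refl f).pow_left n).inv_right.eq
  have hzd : E ((f ^ n)⁻¹ * q * f ^ n) x = E (f ^ n)⁻¹ (E q y) := by rw [E_mul, E_mul]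
  rw [hzd]
  set z := E (f ^ n)⁻¹ (E q y) with hz
  have e2 : E (f ^ n) z = E q y := by rw [hz, E_inv' _ (E_mem _ _)]
  have hpos : 0 < E f⁻¹ y - y := by
    rw [← e1, sub_pos]; exact E_lt _ hx1 hwm1 hxw
  rw [abs_div, abs_of_pos hpos] at hn ⊢
  have hle : E q y ≤ E f⁻¹ y := by
    rw [div_lt_one hpos] at hn
    linarith [le_abs_self (E q y - y)]
  have hzw : z ≤ w := by
    have := E_le (f ^ n)⁻¹ (E_mem q y) (E_mem f⁻¹ y) hle
    rwa [← e1, E_inv _ hwm1] at this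
  have := iter_ratio hδ1 hlt hc (z := z) (y := x) (w := w)
    ⟨(E_mem _ _).1, hzw.trans hwδ⟩ ⟨hx0.le, hxd.le⟩ ⟨hwm1.1, hwδ⟩ hxw hzw n
  rw [e1, e2, ← hyd] at this
  rw [Real.dist_eq, div_mul_eq_mul_div, le_div_iff₀ hpos]
  exact this
end

lemma alternate (Γ : Subgroup G) {f g : G} (hf : f ∈ Γ) (hg : g ∈ Γ) {k l : ℕ} {b η : ℝ}
    (hk : 1 ≤ k) (hl : 1 ≤ l) (hη : 0 < η)
    (hgk : Lead k 0 g) (hgl : Lead l b g) (hb : b ≠ 0)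
    (hT : ∀ n : ℕ, TI (f ^ n) ∧ TI (f ^ n)⁻¹)
    (hconv : ∀ q, Lead k 0 q → ∀ x ∈ Ioo 0 η,
      Tendsto (fun n : ℕ => E ((f ^ n)⁻¹ * q * f ^ n) x) atTop (𝓝 x)) (n : ℕ) :
    ∃ w ∈ Γ, ∃ (B : ℝ) (x : ℕ → ℝ), Lead l B w ∧ 0 < (-1) ^ n * B ∧
      (∀ i ≤ n, x i ∈ Ioo 0 η) ∧ (∀ j ≤ n, ∀ i < j, x j < x i) ∧
      ∀ i ≤ n, 0 < (-1) ^ i * (E w (x i) - x i) := by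
  -- powers of `g` with leading coefficient of prescribed sign
  have hsgn : ∀ (s : ℝ), s = 1 ∨ s = -1 → ∀ B : ℝ, ∃ q ∈ Γ, ∃ d, Lead k 0 q ∧ Lead l d q ∧
      0 < s * (B + d) := by
    intro s hs B
    obtain ⟨M, hM⟩ := exists_nat_gt (|B| / |b|)
    rw [div_lt_iff₀ (abs_pos.2 hb)] at hM
    have hgkM := hgk.pow hk M
    rw [mul_zero] at hgkM
    have hglM := hgl.pow hl M
    have h3 : |(M:ℝ) * b| = M * |b| := by rw [abs_mul, abs_of_nonneg (Nat.cast_nonneg M)]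
    rw [← h3] at hM
    have hB1 := le_abs_self B
    have hB2 := neg_abs_le B
    by_cases hsb : 0 < s * (M * b)
    · refine ⟨g ^ M, Γ.pow_mem hg M, _, hgkM, hglM, ?_⟩
      rcases hs with rfl | rfl
      · rw [abs_of_pos (a := (M:ℝ) * b) (by linarith)] at hM; linarith
      · rw [abs_of_neg (a := (M:ℝ) * b) (by linarith)] at hM; linarith
    · refine ⟨(g ^ M)⁻¹, Γ.inv_mem (Γ.pow_mem hg M), _, by simpa using hgkM.inv hk,
        hglM.inv hl, ?_⟩
      rcases hs with rfl | rfl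
      · rw [abs_of_nonpos (a := (M:ℝ) * b) (by linarith)] at hM; linarith
      · rw [abs_of_nonneg (a := (M:ℝ) * b) (by linarith)] at hM; linarith
  have hev : ∀ (s : ℝ), s = 1 ∨ s = -1 → ∀ (w : G) (B : ℝ), Lead l B w → 0 < s * B →
      ∀ᶠ x in 𝓝[>] (0:ℝ), 0 < s * (E w x - x) := by
    intro s hs w B hw hB
    rcases hs with rfl | rfl
    · filter_upwards [hw.ev_pos (by linarith)] with x hx
      linarith
    · filter_upwards [hw.ev_neg (by linarith)] with x hx
      linarith
  have hs : ∀ n : ℕ, (-1:ℝ) ^ n = 1 ∨ (-1:ℝ) ^ n = -1 := fun n => neg_one_pow_eq_or ℝ n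
  induction n with
  | zero =>
    obtain ⟨q, hq, d, -, hd, hpos⟩ := hsgn 1 (Or.inl rfl) 0
    rw [zero_add] at hpos
    obtain ⟨x, hx, hx'⟩ := ((hev 1 (Or.inl rfl) q d hd hpos).and (ev_Ioo hη)).exists
    refine ⟨q, hq, d, fun _ => x, hd, by simpa using hpos, fun _ _ => hx', ?_, ?_⟩
    · intro j hj i hi; omega
    · intro i hi
      obtain rfl : i = 0 := by omega
      simpa using hx
  | succ n ih =>
    obtain ⟨w, hw, B, x, hB, hBs, hxm, hxa, hxs⟩ := ih
    obtain ⟨q, hq, d, hqk, hql, hpos⟩ := hsgn ((-1) ^ (n+1)) (hs _) B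
    have h1 : ∀ᶠ t : ℕ in atTop, ∀ i ∈ Finset.range (n+1),
        0 < (-1) ^ i * (E (w * ((f ^ t)⁻¹ * q * f ^ t)) (x i) - x i) := by
      rw [Filter.eventually_all_finset]
      intro i hi
      have hi' : i ≤ n := by rw [Finset.mem_range] at hi; omega
      have e1 := ((E_cont w).tendsto (x i)).comp (hconv q hqk (x i) (hxm i hi'))
      have e2 := (e1.sub_const (x i)).const_mul ((-1:ℝ) ^ i)
      filter_upwards [e2.eventually_const_lt (hxs i hi')] with t ht
      rw [E_mul]
      exact ht
    obtain ⟨t, ht⟩ := h1.exists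
    have hL := hB.mul hl (hql.conj (hT t).1 (hT t).2)
    have h2 : ∀ᶠ y in 𝓝[>] (0:ℝ), ∀ i ∈ Finset.range (n+1), y < x i := by
      rw [Filter.eventually_all_finset]
      intro i hi
      have hi' : i ≤ n := by rw [Finset.mem_range] at hi; omega
      filter_upwards [ev_Ioo (hxm i hi').1] with y hy using hy.2
    obtain ⟨y, ⟨hy1, hy2⟩, hy3⟩ := ((h2.and (ev_Ioo hη)).and (hev _ (hs (n+1)) _ _ hL hpos)).exists
    refine ⟨_, Γ.mul_mem hw (Γ.mul_mem (Γ.mul_mem (Γ.inv_mem (Γ.pow_mem hf t)) hq)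
      (Γ.pow_mem hf t)), _, Function.update x (n+1) y, hL, hpos, ?_, ?_, ?_⟩
    · intro i hi
      by_cases h : i = n+1
      · subst h; simpa using hy2
      · rw [Function.update_of_ne h]; exact hxm i (by omega)
    · intro j hj i hi
      have hin : i ≠ n + 1 := by omega
      rw [Function.update_of_ne hin]
      by_cases h : j = n+1
      · subst h
        rw [Function.update_self]
        exact hy1 i (Finset.mem_range.2 (by omega))
      · rw [Function.update_of_ne h]; exact hxa j (by omega) i hi
    · intro i hi
      by_cases h : i = n+1
      · subst h; simpa using hy3
      · rw [Function.update_of_ne h]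
        exact ht i (Finset.mem_range.2 (by omega))

lemma contradiction_of_alternate {w : G} {x : ℕ → ℝ} {N : ℕ}
    (hxm : ∀ i ≤ N+1, x i ∈ Ioo 0 1) (hxa : ∀ j ≤ N+1, ∀ i < j, x j < x i)
    (hxs : ∀ i ≤ N+1, 0 < (-1) ^ i * (E w (x i) - x i))
    (hN : w ≠ 1 → (interiorFixedPoints w).Finite ∧ (interiorFixedPoints w).ncard ≤ N) : False := by
  have hw : w ≠ 1 := by
    rintro rfl
    have := hxs 0 (by omega)
    have h0 := hxm 0 (by omega)
    rw [E_one ⟨h0.1.le, h0.2.le⟩] at this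
    simp at this
  obtain ⟨hfin, hcard⟩ := hN hw
  have hfix : ∀ i, ∃ p : I, i ≤ N → w p = p ∧ x (i+1) < p ∧ (p:ℝ) < x i := by
    intro i
    by_cases hi : i ≤ N
    swap
    · exact ⟨⟨0, zmem⟩, fun h => absurd h hi⟩
    have h1 := hxs i (by omega)
    have h2 := hxs (i+1) (by omega)
    have h3 := hxa (i+1) (by omega) i (by omega)
    have hm1 := hxm i (by omega)
    have hm2 := hxm (i+1) (by omega)
    have hcont : ContinuousOn (fun t => (-1:ℝ) ^ i * (E w t - t)) (Icc (x (i+1)) (x i)) :=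
      (continuous_const.mul ((E_cont w).sub continuous_id)).continuousOn
    have h4 := intermediate_value_Ioo h3.le hcont
    rw [pow_succ] at h2
    obtain ⟨p, hp, hp0⟩ := h4 (show (0:ℝ) ∈ _ from ⟨by linarith, h1⟩)
    have hp1 : p ∈ Icc (0:ℝ) 1 := ⟨(hm2.1.trans hp.1).le, (hp.2.trans hm1.2).le⟩
    refine ⟨⟨p, hp1⟩, fun _ => ⟨?_, hp.1, hp.2⟩⟩
    apply Subtype.ext
    rw [← E_coe]
    have hp0 : (-1:ℝ) ^ i * (E w p - p) = 0 := hp0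
    have : E w p - p = 0 := by
      rcases mul_eq_zero.1 hp0 with h | h
      · exact absurd h (pow_ne_zero _ (by norm_num))
      · exact h
    change E w p = p
    linarith
  choose p hp using hfix
  have hanti : ∀ j ≤ N, ∀ i < j, p i ≠ p j := by
    intro j hj i hij heq
    have h1 := (hp j hj).2.2
    have h2 := (hp i (by omega)).2.1
    rw [heq] at h2
    rcases (Nat.succ_le_of_lt hij).eq_or_lt with h | h
    · rw [Nat.succ_eq_add_one] at h; rw [h] at h2; linarith
    · have := hxa j (by omega) (i+1) h
      linarith
  have hinj : Set.InjOn p (Finset.range (N+1) : Set ℕ) := by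
    intro i hi j hj hij
    simp only [Finset.coe_range, mem_Iio] at hi hj
    rcases lt_trichotomy i j with h | h | h
    · exact absurd hij (hanti j (by omega) i h)
    · exact h
    · exact absurd hij.symm (hanti i (by omega) j h)
  have hsub : p '' (Finset.range (N+1) : Set ℕ) ⊆ interiorFixedPoints w := by
    rintro _ ⟨i, hi, rfl⟩
    simp only [Finset.coe_range, mem_Iio] at hi
    obtain ⟨h1, h2, h3⟩ := hp i (by omega)
    exact ⟨h1, (hxm (i+1) (by omega)).1.trans h2, h3.trans (hxm i (by omega)).2⟩
  have := Set.ncard_le_ncard hsub hfin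
  rw [Set.InjOn.ncard_image hinj, Set.ncard_coe_finset, Finset.card_range] at this
  omega

lemma no_pair (Γ : Subgroup G) {N : ℕ}
    (hN : ∀ f ∈ Γ, f ≠ 1 →
      (interiorFixedPoints f).Finite ∧ (interiorFixedPoints f).ncard ≤ N)
    {f g : G} (hf : f ∈ Γ) (hg : g ∈ Γ) {k l : ℕ} {b c : ℝ} (hk : 1 ≤ k) (hl : 1 ≤ l)
    (hfk : Lead k c f) (hc : c < 0)
    (hgk : Lead k 0 g) (hgl : Lead l b g) (hb : b ≠ 0)
    (hT : ∀ n : ℕ, TI (f ^ n) ∧ TI (f ^ n)⁻¹) : False := by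
  obtain ⟨δ, hδ, hδ1, hlt, hcc⟩ := exists_delta (by simpa using (hT 1).1) hfk hc
  obtain ⟨w, hw, B, x, -, -, hxm, hxa, hxs⟩ := alternate Γ hf hg hk hl (η := E f δ)
    (E_pos f ⟨hδ.le, hδ1⟩ hδ) hgk hgl hb hT
    (fun q hq x hx => conj_tendsto hk hfk hc hδ1 hlt hcc hq hx.1 hx.2) (N+1)
  exact contradiction_of_alternate
    (fun i hi => ⟨(hxm i hi).1, (hxm i hi).2.trans_le (E_mem f δ).2⟩) hxa hxs (hN w hw)

lemma analytic_ext {σ : G} (h : IsAnalyticDiffeo σ) :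
    ∃ F : ℝ → ℝ, AnalyticAt ℝ F 0 ∧ ∀ x ∈ Icc (0:ℝ) 1, E σ x = F x := by
  obtain ⟨F, -, hF, -, -, -, he, -⟩ := h
  exact ⟨F, hF 0 zmem, fun x hx => (E_coe σ ⟨x, hx⟩).trans (he ⟨x, hx⟩)⟩

lemma udw : UniqueDiffWithinAt ℝ (Icc (0:ℝ) 1) 0 := uniqueDiffOn_Icc one_pos 0 zmem

lemma diffW {σ : G} (h : IsAnalyticDiffeo σ) :
    DifferentiableWithinAt ℝ (E σ) (Icc 0 1) 0 := by
  obtain ⟨F, hF, he⟩ := analytic_ext h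
  exact hF.differentiableAt.differentiableWithinAt.congr he (he 0 zmem)

lemma TI_of {σ : G} (h : IsAnalyticDiffeo σ) (hd : derivWithin (E σ) (Icc 0 1) 0 = 1) : TI σ := by
  obtain ⟨F, hF, he⟩ := analytic_ext h
  refine ⟨F, hF, ?_, he⟩
  rw [← hd, derivWithin_congr he (he 0 zmem), hF.differentiableAt.derivWithin udw]

/-- The derivative at `0` as a homomorphism. -/
noncomputable def dHom (Γ : Subgroup G) (hΓ : ∀ f ∈ Γ, IsAnalyticDiffeo f) : ↥Γ →* ℝ where
  toFun σ := derivWithin (E σ) (Icc 0 1) 0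
  map_one' := by
    have h : derivWithin (E (1 : G)) (Icc 0 1) 0 = derivWithin id (Icc 0 1) 0 :=
      derivWithin_congr (fun x hx => E_one hx) (E_one zmem)
    exact h.trans (derivWithin_id _ _ udw)
  map_mul' σ τ := by
    have h1 := (diffW (hΓ _ σ.2)).hasDerivWithinAt
    have h2 := (diffW (hΓ _ τ.2)).hasDerivWithinAt
    have h3 := HasDerivWithinAt.comp (h₂ := E σ) (h := E τ) 0 (by rw [E_zero]; exact h1) h2
      (fun x _ => E_mem _ x)
    rw [← h3.derivWithin udw]
    congr 1
    funext x
    exact E_mul _ _ x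

lemma comm_TI (Γ : Subgroup G) (hΓ : ∀ f ∈ Γ, IsAnalyticDiffeo f) {a : ↥Γ}
    (ha : a ∈ commutator ↥Γ) : TI (a : G) := by
  have h := Abelianization.commutator_subset_ker (dHom Γ hΓ).toHomUnits ha
  rw [MonoidHom.mem_ker] at h
  have h2 : dHom Γ hΓ a = 1 := by
    have := congrArg Units.val h
    simpa using this
  exact TI_of (hΓ _ a.2) h2

lemma final_aux (Γ : Subgroup G) (hΓ : ∀ f ∈ Γ, IsAnalyticDiffeo f) {N : ℕ}
    (hN : ∀ f ∈ Γ, f ≠ 1 →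
      (interiorFixedPoints f).Finite ∧ (interiorFixedPoints f).ncard ≤ N)
    (a b : ↥Γ) (ha : a ∈ commutator ↥Γ) (hb : b ∈ commutator ↥Γ) {k m : ℕ} {c d : ℝ}
    (hk : 1 ≤ k) (hkm : k ≤ m) (hac : Lead k c (a : G)) (hc : c ≠ 0) (hbd : Lead m d (b : G)) :
    a * b = b * a := by
  by_contra hne
  set g : ↥Γ := a * b * a⁻¹ * b⁻¹ with hgdef
  have hg1 : (g : G) ≠ 1 := by
    intro h
    apply hne
    have h' : g = 1 := Subtype.ext h
    rw [hgdef, mul_inv_eq_one, mul_inv_eq_iff_eq_mul] at h'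
    exact h'
  have hgm : g ∈ commutator ↥Γ :=
    mul_mem (mul_mem (mul_mem ha hb) (inv_mem ha)) (inv_mem hb)
  obtain ⟨l, e, hl, he, hle⟩ := (comm_TI Γ hΓ hgm).lead (hN _ g.2 hg1).1
  obtain ⟨d', hbd'⟩ : ∃ d', Lead k d' (b : G) := by
    rcases hkm.eq_or_lt with h | h
    · exact ⟨d, h ▸ hbd⟩
    · exact ⟨0, hbd.lower h⟩
  have hgk : Lead k 0 (g : G) := by
    have := (((hac.mul hk hbd').mul hk (hac.inv hk)).mul hk (hbd'.inv hk))
    have e0 : c + d' + -c + -d' = 0 := by ring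
    rw [e0] at this
    exact this
  have hT : ∀ f : ↥Γ, f ∈ commutator ↥Γ → ∀ n : ℕ, TI ((f : G) ^ n) ∧ TI ((f : G) ^ n)⁻¹ := by
    intro f hf n
    exact ⟨comm_TI Γ hΓ (pow_mem hf n), comm_TI Γ hΓ (inv_mem (pow_mem hf n))⟩
  rcases lt_or_gt_of_ne hc with h | h
  · exact no_pair Γ hN a.2 g.2 hk hl hac h hgk hle he (hT a ha)
  · exact no_pair Γ hN (a⁻¹).2 g.2 hk hl (hac.inv hk) (by linarith) hgk hle he
      (hT a⁻¹ (inv_mem ha))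

end MetaB

/-- If every nontrivial element of a subgroup `Γ` of `Diff^ω_+([0,1])` has at most `N`
fixed points in `(0,1)`, then `Γ` is metabelian: its commutator subgroup is abelian. -/
theorem metabelian_of_bounded_fixed_points
    (Γ : Subgroup (↥(Set.Icc (0:ℝ) 1) ≃o ↥(Set.Icc (0:ℝ) 1)))
    (hΓ : ∀ f ∈ Γ, IsAnalyticDiffeo f)
    (hN : ∃ N : ℕ, 1 ≤ N ∧ ∀ f ∈ Γ, f ≠ 1 →
      (interiorFixedPoints f).Finite ∧ (interiorFixedPoints f).ncard ≤ N) :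
    ∀ a b : ↥Γ, a ∈ commutator ↥Γ → b ∈ commutator ↥Γ → a * b = b * a := by
  obtain ⟨N, -, hN⟩ := hN
  intro a b ha hb
  by_cases ha1 : (a : MetaB.G) = 1
  · have : a = 1 := Subtype.ext ha1
    rw [this, one_mul, mul_one]
  by_cases hb1 : (b : MetaB.G) = 1
  · have : b = 1 := Subtype.ext hb1
    rw [this, one_mul, mul_one]
  obtain ⟨k, c, hk, hc, hkc⟩ := (MetaB.comm_TI Γ hΓ ha).lead (hN _ a.2 ha1).1
  obtain ⟨m, d, hm, hd, hmd⟩ := (MetaB.comm_TI Γ hΓ hb).lead (hN _ b.2 hb1).1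
  rcases le_total k m with h | h
  · exact MetaB.final_aux Γ hΓ hN a b ha hb hk h hkc hc hmd
  · exact (MetaB.final_aux Γ hΓ hN b a hb ha hm h hmd hd hkc).symm
end

section
/- Let Γ be a non-metabelian subgroup of Diff^ω_+([0,1]) having no global fixed point in the open interval (0,1). Then for all points 0 < p₁ < … < p_n < 1 and all ε > 0, there is an element f ∈ Γ such that f(p_i) ≠ p_i for every i ∈ {1,…,n}, and yet |f(p_i) − p_i| < ε for every i. -/
namespace SD
open Set Filter Topology

abbrev I := ↥(Set.Icc (0:ℝ) 1)
abbrev GG := I ≃o I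

lemma lip {G : ℝ → ℝ} (hG : AnalyticOnNhd ℝ G (Icc 0 1)) :
    ∃ K : ℝ, 0 ≤ K ∧ ∀ x ∈ Icc (0:ℝ) 1, ∀ y ∈ Icc (0:ℝ) 1, |G y - G x| ≤ K * |y - x| := by
  have h1 : ContinuousOn (deriv G) (Icc 0 1) := hG.deriv.continuousOn
  obtain ⟨K, hK⟩ := isCompact_Icc.exists_bound_of_continuousOn h1
  refine ⟨max K 0, le_max_right _ _, fun x hx y hy => ?_⟩
  have := (convex_Icc (0:ℝ) 1).norm_image_sub_le_of_norm_deriv_le (f := G) (C := max K 0)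
    (fun x hx => (hG x hx).differentiableAt) (fun x hx => (hK x hx).trans (le_max_left _ _)) hx hy
  simpa [Real.norm_eq_abs] using this

lemma map_zero' (f : GG) : f ⟨0, by simp⟩ = ⟨0, by simp⟩ := f.map_bot

/-- multiplier -/
def M (f : GG) (α : ℝ) : Prop := ∃ C : ℝ, 0 ≤ C ∧ ∀ x : I, |(f x : ℝ) - α * x| ≤ C * (x:ℝ)^2

lemma exists_M {f : GG} (hf : IsAnalyticDiffeo f) : ∃ α, M f α := by
  obtain ⟨F, G, hF, -, -, -, hfF, -⟩ := hf
  have h2 : ContDiffOn ℝ ((1:ℕ)+1) F (Icc 0 1) := fun x hx => (hF x hx).contDiffAt.contDiffWithinAt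
  obtain ⟨C, hC⟩ := exists_taylor_mean_remainder_bound (zero_le_one) h2
  refine ⟨derivWithin F (Icc 0 1) 0, max C 0, le_max_right _ _, fun x => ?_⟩
  have h0 : F 0 = 0 := by
    have := hfF ⟨0, by simp⟩
    rw [map_zero'] at this
    simpa using this.symm
  have := hC x x.2
  rw [taylorWithinEval_succ] at this
  simp only [taylor_within_zero_eval, h0] at this
  simp at this
  rw [hfF, mul_comm (derivWithin _ _ _)]
  refine this.trans ?_
  gcongr
  exact le_max_left _ _

lemma M_one_one : M 1 1 := ⟨0, le_rfl, fun x => by simp⟩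

lemma M_mul {f g : GG} {α β : ℝ} (hf : M f α) (hg : M g β) : M (f * g) (α * β) := by
  obtain ⟨C, hC0, hC⟩ := hf
  obtain ⟨D, hD0, hD⟩ := hg
  refine ⟨C * (|β| + D)^2 + |α| * D, by positivity, fun x => ?_⟩
  have h1 := hC (g x)
  have h2 := hD x
  have hx0 := x.2.1
  have hx1 := x.2.2
  have hg0 := (g x).2.1
  have h3 : (g x : ℝ) ≤ (|β| + D) * x := by
    have h4 := (abs_le.1 h2).2
    have h5 : β * x ≤ |β| * x := by gcongr; exact le_abs_self _
    have h6 : D * (x:ℝ)^2 ≤ D * x := by gcongr; nlinarith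
    linarith
  have h7 : (((f * g) x : I) : ℝ) - α * β * x = ((f (g x) : ℝ) - α * (g x)) + α * ((g x : ℝ) - β * x) := by
    rw [RelIso.mul_apply]; ring
  rw [h7]
  calc _ ≤ |(f (g x) : ℝ) - α * (g x)| + |α * ((g x : ℝ) - β * x)| := abs_add_le _ _
    _ ≤ C * ((|β| + D) * x)^2 + |α| * (D * (x:ℝ)^2) := by
        rw [abs_mul]
        gcongr
        refine h1.trans ?_
        gcongr
    _ = _ := by ring

lemma M_unique_one {γ : ℝ} (h : M 1 γ) : γ = 1 := by
  obtain ⟨C, hC0, hC⟩ := h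
  by_contra hne
  have hp : 0 < |1 - γ| := abs_pos.2 (sub_ne_zero.2 (Ne.symm hne))
  set t : ℝ := min 1 (|1-γ| / (2 * (C + 1))) with ht
  have ht0 : 0 < t := lt_min one_pos (by positivity)
  have h1 := hC ⟨t, ht0.le, min_le_left _ _⟩
  simp only [RelIso.coe_one, id] at h1
  have h2 : t - γ * t = (1 - γ) * t := by ring
  rw [h2, abs_mul, abs_of_pos ht0] at h1
  have h3 : t ≤ |1-γ| / (2 * (C + 1)) := min_le_right _ _
  rw [le_div_iff₀ (by positivity)] at h3
  have h4 : |1-γ| ≤ C * t := by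
    have : |1-γ| * t ≤ (C * t) * t := by nlinarith
    exact le_of_mul_le_mul_right this ht0
  nlinarith

lemma commutator_M (Γ : Subgroup GG) (hΓ : ∀ f ∈ Γ, IsAnalyticDiffeo f) (a : ↥Γ)
    (ha : a ∈ commutator ↥Γ) : M a 1 := by
  let N : Subgroup ↥Γ :=
    { carrier := {g | M g 1}
      mul_mem' := fun {a b} ha hb => by
        have := M_mul ha hb
        simpa using this
      one_mem' := M_one_one
      inv_mem' := fun {a} ha => by
        obtain ⟨β, hβ⟩ := exists_M (hΓ _ (a⁻¹).2)
        have h1 := M_mul ha hβ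
        have h2 : ((a:GG) * ((a⁻¹ : ↥Γ) : GG)) = 1 := by simp
        rw [h2, one_mul] at h1
        have := M_unique_one h1
        subst this
        exact hβ }
  have hle : commutator ↥Γ ≤ N := by
    rw [commutator_def, Subgroup.commutator_le]
    intro a _ b _
    obtain ⟨α, hα⟩ := exists_M (hΓ _ a.2)
    obtain ⟨β, hβ⟩ := exists_M (hΓ _ b.2)
    obtain ⟨α', hα'⟩ := exists_M (hΓ _ (a⁻¹).2)
    obtain ⟨β', hβ'⟩ := exists_M (hΓ _ (b⁻¹).2)
    have h1 : α * α' = 1 := by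
      apply M_unique_one
      have := M_mul hα hα'
      simpa using this
    have h2 : β * β' = 1 := by
      apply M_unique_one
      have := M_mul hβ hβ'
      simpa using this
    have h3 := M_mul (M_mul (M_mul hα hβ) hα') hβ'
    have h4 : α * β * α' * β' = 1 := by
      calc _ = (α * α') * (β * β') := by ring
        _ = 1 := by rw [h1, h2, one_mul]
    rw [h4] at h3
    exact h3
  exact hle ha

lemma distort {f : GG} (hf : IsAnalyticDiffeo f) : ∃ L : ℝ, 0 ≤ L ∧
    ∀ s t a b a' b' : I, s ≤ a → a < b → b ≤ t → s ≤ a' → a' < b' → b' ≤ t →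
      (1 - L * ((t:ℝ) - s)) * (((f b' : ℝ) - f a') * ((b:ℝ) - a)) ≤ ((f b : ℝ) - f a) * ((b':ℝ) - a') := by
  obtain ⟨F, G, hF, -, hd, -, hfF, -⟩ := hf
  obtain ⟨K, hK0, hK⟩ := lip hF.deriv
  have hc : ContinuousOn (fun x => |deriv F x|) (Icc 0 1) := hF.deriv.continuousOn.abs
  obtain ⟨x0, hx0, hmin⟩ := isCompact_Icc.exists_isMinOn (nonempty_Icc.2 zero_le_one) hc
  set μ := |deriv F x0| with hμ
  have hμ0 : 0 < μ := abs_pos.2 (hd x0 hx0)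
  refine ⟨K / μ, by positivity, ?_⟩
  have mvt : ∀ a b : I, a < b → ∃ ξ : I, a ≤ ξ ∧ ξ ≤ b ∧ (f b : ℝ) - f a = |deriv F ξ| * ((b:ℝ) - a) := by
    intro a b hab
    have hab' : (a:ℝ) < b := hab
    obtain ⟨ξ, hξ, h⟩ := exists_deriv_eq_slope F hab'
      (fun x hx => (hF x ⟨a.2.1.trans hx.1, hx.2.trans b.2.2⟩).continuousAt.continuousWithinAt)
      (fun x hx => (hF x ⟨a.2.1.trans hx.1.le, hx.2.le.trans b.2.2⟩).differentiableAt.differentiableWithinAt)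
    refine ⟨⟨ξ, a.2.1.trans hξ.1.le, hξ.2.le.trans b.2.2⟩, hξ.1.le, hξ.2.le, ?_⟩
    have h1 : (f a : ℝ) < f b := f.strictMono hab
    have hpos : 0 < deriv F ξ := by
      rw [h, ← hfF, ← hfF]
      exact div_pos (sub_pos.2 h1) (sub_pos.2 hab')
    simp only
    rw [abs_of_pos hpos, h, hfF, hfF, div_mul_cancel₀]
    exact (sub_pos.2 hab').ne'
  intro s t a b a' b' hsa hab hbt hsa' hab' hbt'
  obtain ⟨ξ, hξ1, hξ2, hξ⟩ := mvt a b hab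
  obtain ⟨ζ, hζ1, hζ2, hζ⟩ := mvt a' b' hab'
  rw [hξ, hζ]
  have q1 : 0 < (b:ℝ) - a := sub_pos.2 hab
  have q2 : 0 < (b':ℝ) - a' := sub_pos.2 hab'
  have e1 : |(ξ:ℝ) - ζ| ≤ (t:ℝ) - s := by
    have i1 : (s:ℝ) ≤ ξ := hsa.trans hξ1
    have i2 : (ξ:ℝ) ≤ t := hξ2.trans hbt
    have i3 : (s:ℝ) ≤ ζ := hsa'.trans hζ1
    have i4 : (ζ:ℝ) ≤ t := hζ2.trans hbt'
    rw [abs_le]; constructor <;> linarith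
  have e2 : |deriv F ξ| ≥ |deriv F ζ| - K * ((t:ℝ) - s) := by
    have := hK ξ ξ.2 ζ ζ.2
    have h3 := abs_sub_abs_le_abs_sub (deriv F ζ) (deriv F ξ)
    have h4 : K * |(ζ:ℝ) - ξ| ≤ K * ((t:ℝ) - s) := by
      rw [abs_sub_comm]; gcongr
    linarith
  have e3 : μ ≤ |deriv F ζ| := hmin ζ.2
  have e5 : 0 ≤ (t:ℝ) - s := (abs_nonneg _).trans e1
  have e4 : (1 - K / μ * ((t:ℝ) - s)) * |deriv F ζ| ≤ |deriv F ξ| := by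
    have : K * ((t:ℝ) - s) ≤ K / μ * ((t:ℝ) - s) * |deriv F ζ| := by
      calc K * ((t:ℝ) - s) = K / μ * ((t:ℝ) - s) * μ := by field_simp
        _ ≤ _ := by gcongr
    linarith
  calc _ = ((1 - K / μ * ((t:ℝ) - s)) * |deriv F ζ|) * (((b':ℝ) - a') * ((b:ℝ) - a)) := by ring
    _ ≤ |deriv F ξ| * (((b':ℝ) - a') * ((b:ℝ) - a)) := by gcongr
    _ = _ := by ring

lemma order {f : GG} (hf : IsAnalyticDiffeo f) (h1 : f ≠ 1) : ∃ (k : ℕ) (c C r : ℝ),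
    0 < c ∧ 0 ≤ C ∧ 0 < r ∧
    ((∀ x : I, 0 < (x:ℝ) → (x:ℝ) < r → c * (x:ℝ)^(k+1) ≤ x - f x) ∨
      (∀ x : I, 0 < (x:ℝ) → (x:ℝ) < r → c * (x:ℝ)^(k+1) ≤ f x - x)) ∧
    (∀ x : I, (x:ℝ) < r → |(f x:ℝ) - x| ≤ C * (x:ℝ)^(k+1)) ∧
    (∀ (x y : I) (t : ℝ), (x:ℝ) ≤ t → (y:ℝ) ≤ t → t < r →
      |((f y : ℝ) - y) - ((f x : ℝ) - x)| ≤ C * t^k * |(y:ℝ) - x|) := by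
  obtain ⟨F, G, hF, -, hd, -, hfF, -⟩ := hf
  have hΦ : AnalyticOnNhd ℝ (fun x => F x - x) (Icc 0 1) := hF.sub analyticOnNhd_id
  have h00 : (0:ℝ) ∈ Icc (0:ℝ) 1 := by simp
  have hne : ¬ ∀ᶠ z in 𝓝 (0:ℝ), F z - z = 0 := by
    intro h
    apply h1
    have := hΦ.eqOn_of_preconnected_of_eventuallyEq (analyticOnNhd_const (v := (0:ℝ)))
      (convex_Icc (0:ℝ) 1).isPreconnected h00 h
    ext x
    have h3 := this x.2
    simp only at h3
    rw [hfF]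
    simpa [sub_eq_zero] using h3
  obtain ⟨m, g, hg, hg0, hgm⟩ := ((hΦ 0 h00).exists_eventuallyEq_pow_smul_nonzero_iff).2 hne
  have hF0 : F 0 = 0 := by
    have := hfF ⟨0, by simp⟩
    rw [map_zero'] at this
    simpa using this.symm
  obtain ⟨k, rfl⟩ : ∃ k, m = k + 1 := by
    rcases m with _ | k
    · have := hgm.self_of_nhds
      simp [hF0] at this
      exact absurd this.symm hg0
    · exact ⟨k, rfl⟩
  simp only [sub_zero, smul_eq_mul] at hgm
  have hgc := hg.continuousAt
  have hap : 0 < |g 0| := abs_pos.2 hg0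
  have hgd := hg.deriv.continuousAt
  -- eventual facts
  have E1 : ∀ᶠ z in 𝓝 (0:ℝ), |g z - g 0| < |g 0| / 2 := by
    have := Metric.continuousAt_iff'.1 hgc (|g 0|/2) (by positivity)
    simpa [Real.dist_eq] using this
  have E2 : ∀ᶠ z in 𝓝 (0:ℝ), |deriv g z - deriv g 0| < 1 := by
    have := Metric.continuousAt_iff'.1 hgd 1 (by positivity)
    simpa [Real.dist_eq] using this
  have E3 := hg.eventually_analyticAt
  have E4 := hgm.eventually_nhds
  obtain ⟨r, hr0, hr⟩ := Metric.eventually_nhds_iff.1 (E1.and (E2.and (E3.and E4)))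
  set D := (k+1) * (2 * |g 0|) + (|deriv g 0| + 1) with hD
  refine ⟨k, |g 0| / 2, D + 2 * |g 0|, min r 1, by positivity, by positivity, by positivity, ?_, ?_, ?_⟩
  · rcases lt_or_gt_of_ne hg0 with hneg | hpos
    · left
      intro x hx hxr
      obtain ⟨e1, -, -, e4⟩ := @hr x (by simpa [abs_of_pos hx] using lt_of_lt_of_le hxr (min_le_left _ _))
      have e5 := e4.self_of_nhds
      rw [hfF]
      rw [abs_of_neg hneg] at e1 ⊢
      have e6 := abs_lt.1 e1
      have : (x:ℝ) - F x = (x:ℝ)^(k+1) * (- g x) := by linarith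
      rw [this, mul_comm]
      gcongr
      linarith
    · right
      intro x hx hxr
      obtain ⟨e1, -, -, e4⟩ := @hr x (by simpa [abs_of_pos hx] using lt_of_lt_of_le hxr (min_le_left _ _))
      have e5 := e4.self_of_nhds
      rw [hfF, e5]
      rw [abs_of_pos hpos] at e1 ⊢
      have e6 := abs_lt.1 e1
      rw [mul_comm]
      gcongr
      linarith
  · intro x hxr
    have hx := x.2.1
    obtain ⟨e1, -, -, e4⟩ := @hr x (by simpa [abs_of_nonneg hx] using lt_of_lt_of_le hxr (min_le_left _ _))
    have e5 := e4.self_of_nhds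
    rw [hfF, e5, abs_mul, abs_of_nonneg (by positivity), mul_comm]
    have : |g x| ≤ D + 2 * |g 0| := by
      have := abs_sub_abs_le_abs_sub (g x) (g 0)
      have : 0 ≤ D := by positivity
      linarith
    gcongr
  · intro x y t hx hy ht
    have ht0 : 0 ≤ t := x.2.1.trans hx
    have hder : ∀ z ∈ Icc (0:ℝ) t, DifferentiableAt ℝ (fun x => F x - x) z ∧
        ‖deriv (fun x => F x - x) z‖ ≤ (D + 2 * |g 0|) * t^k := by
      intro z hz
      obtain ⟨e1, e2, e3, e4⟩ := @hr z (by
        simpa [abs_of_nonneg hz.1] using lt_of_le_of_lt hz.2 (lt_of_lt_of_le ht (min_le_left _ _)))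
      have hz1 : z ≤ 1 := hz.2.trans (ht.le.trans (min_le_right _ _))
      have hz0 := hz.1
      refine ⟨(hΦ z ⟨hz.1, hz1⟩).differentiableAt, ?_⟩
      have hE : (fun x => F x - x) =ᶠ[𝓝 z] fun x => x^(k+1) * g x := e4
      rw [hE.deriv_eq]
      have hh : HasDerivAt (fun x => x^(k+1) * g x) (((k+1:ℕ):ℝ) * z^k * g z + z^(k+1) * deriv g z) z := by
        have := (hasDerivAt_pow (k+1) z).mul e3.differentiableAt.hasDerivAt
        exact this
      rw [hh.deriv, Real.norm_eq_abs]
      have a1 : |g z| ≤ 2 * |g 0| := by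
        have := abs_sub_abs_le_abs_sub (g z) (g 0)
        linarith
      have a2 : |deriv g z| ≤ |deriv g 0| + 1 := by
        have := abs_sub_abs_le_abs_sub (deriv g z) (deriv g 0)
        linarith
      calc _ ≤ |((k+1:ℕ):ℝ) * z^k * g z| + |z^(k+1) * deriv g z| := abs_add_le _ _
        _ = (k+1) * z^k * |g z| + z^k * (z * |deriv g z|) := by
            rw [abs_mul, abs_mul, abs_mul, abs_of_nonneg (by positivity : (0:ℝ) ≤ z^k),
              abs_of_nonneg (by positivity : (0:ℝ) ≤ z^(k+1)), Nat.abs_cast]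
            push_cast; ring
        _ ≤ (k+1) * z^k * (2 * |g 0|) + z^k * (1 * (|deriv g 0| + 1)) := by gcongr
        _ = D * z^k := by rw [hD]; ring
        _ ≤ (D + 2 * |g 0|) * t^k := by
            gcongr
            · linarith
            · exact hz.2
    have := (convex_Icc (0:ℝ) t).norm_image_sub_le_of_norm_deriv_le
      (fun z hz => (hder z hz).1) (fun z hz => (hder z hz).2) ⟨x.2.1, hx⟩ ⟨y.2.1, hy⟩
    simpa [Real.norm_eq_abs, hfF] using this

lemma M_bound {f : GG} (hf : M f 1) : ∃ E : ℝ, 1 ≤ E ∧ ∀ x : I, (f x : ℝ) ≤ E * x := by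
  obtain ⟨C, hC0, hC⟩ := hf
  refine ⟨1 + C, by linarith, fun x => ?_⟩
  have h := (abs_le.1 (hC x)).2
  have h1 := x.2.1
  have h2 := x.2.2
  have h6 : C * (x:ℝ)^2 ≤ C * x := by gcongr; nlinarith
  linarith

lemma comm_bound {f g : GG} {k : ℕ} {C D E r : ℝ} (hC : 0 ≤ C) (hD : 0 ≤ D) (hE : 1 ≤ E) (hr : 0 < r)
    (hfC : ∀ x : I, (x:ℝ) < r → |(f x:ℝ) - x| ≤ C * (x:ℝ)^(k+1))
    (hfL : ∀ (x y : I) (t : ℝ), (x:ℝ) ≤ t → (y:ℝ) ≤ t → t < r →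
      |((f y : ℝ) - y) - ((f x : ℝ) - x)| ≤ C * t^k * |(y:ℝ) - x|)
    (hgC : ∀ x : I, (x:ℝ) < r → |(g x:ℝ) - x| ≤ D * (x:ℝ)^2)
    (hgL : ∀ (x y : I) (t : ℝ), (x:ℝ) ≤ t → (y:ℝ) ≤ t → t < r →
      |((g y : ℝ) - y) - ((g x : ℝ) - x)| ≤ D * t * |(y:ℝ) - x|)
    (hf : ∀ x : I, (f x : ℝ) ≤ E * x) (hg : ∀ x : I, (g x : ℝ) ≤ E * x)
    (hfi : ∀ x : I, (f⁻¹ x : ℝ) ≤ E * x) (hgi : ∀ x : I, (g⁻¹ x : ℝ) ≤ E * x) :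
    ∃ B r' : ℝ, 0 ≤ B ∧ 0 < r' ∧ ∀ y : I, (y:ℝ) < r' →
      |((f * g * f⁻¹ * g⁻¹) y : ℝ) - y| ≤ B * (y:ℝ)^(k+2) := by
  have hE0 : 0 < E := by linarith
  refine ⟨2 * C * D * (E^3)^(k+2), r / E^3, by positivity, by positivity, fun y hy => ?_⟩
  rw [lt_div_iff₀ (by positivity)] at hy
  set x : I := f⁻¹ (g⁻¹ y) with hx
  have hy0 := y.2.1
  have hx0 := x.2.1
  have hfx : f x = g⁻¹ y := by rw [hx, RelIso.apply_inv_self]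
  have hgfx : g (f x) = y := by rw [hfx, RelIso.apply_inv_self]
  set t : ℝ := E^3 * y with ht
  have ht0 : 0 ≤ t := by positivity
  have htr : t < r := by rw [ht]; linarith
  have hx2 : (x:ℝ) ≤ E^2 * y := by
    calc (x:ℝ) ≤ E * (g⁻¹ y : I) := hfi _
      _ ≤ E * (E * y) := by gcongr; exact hgi _
      _ = _ := by ring
  have hE2 : E^2 * (y:ℝ) ≤ t := by rw [ht]; gcongr; norm_num
  have hxt : (x:ℝ) ≤ t := hx2.trans hE2
  have hft : (f x:ℝ) ≤ t := by
    calc (f x:ℝ) ≤ E * x := hf _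
      _ ≤ E * (E^2 * y) := by gcongr
      _ = t := by rw [ht]; ring
  have hgt : (g x:ℝ) ≤ t := by
    calc (g x:ℝ) ≤ E * x := hg _
      _ ≤ E * (E^2 * y) := by gcongr
      _ = t := by rw [ht]; ring
  have hw : (f * g * f⁻¹ * g⁻¹) y = f (g x) := by simp [RelIso.mul_apply, hx]
  have key : ((f * g * f⁻¹ * g⁻¹) y : ℝ) - y =
      ((((f (g x) : I):ℝ) - g x) - ((f x : ℝ) - x)) - ((((g (f x) : I):ℝ) - f x) - ((g x : ℝ) - x)) := by
    rw [hw, hgfx]; ring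
  rw [key]
  have b1 := hfL x (g x) t hxt hgt htr
  have b2 := hgL x (f x) t hxt hft htr
  have b3 := hfC x (hxt.trans_lt htr)
  have b4 := hgC x (hxt.trans_lt htr)
  calc _ ≤ |(((f (g x) : I):ℝ) - g x) - ((f x : ℝ) - x)| + |(((g (f x) : I):ℝ) - f x) - ((g x : ℝ) - x)| :=
        abs_sub _ _
    _ ≤ C * t^k * (D * t^2) + D * t * (C * t^(k+1)) := by
        gcongr
        · exact b1.trans (by gcongr; exact b4.trans (by gcongr))
        · exact b2.trans (by gcongr; exact b3.trans (by gcongr))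
    _ = 2 * C * D * t^(k+2) := by ring
    _ = _ := by rw [ht]; ring

lemma iter_lt {f : GG} {b : I} (h : f b < b) (n : ℕ) : (f^(n+1)) b < (f^n) b := by
  rw [pow_succ, RelIso.mul_apply]
  exact (f^n).strictMono h

lemma iter_anti {f : GG} {b : I} (h : f b < b) : Antitone fun n : ℕ => (f^n) b :=
  antitone_nat_of_succ_le fun n => (iter_lt h n).le

lemma iter_le {f : GG} {b : I} (h : f b < b) (n : ℕ) : (f^n) b ≤ b := by
  have := iter_anti h (Nat.zero_le n)
  simpa using this

lemma pow_succ_apply' (f : GG) (n : ℕ) (b : I) : (f^(n+1)) b = f ((f^n) b) := by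
  rw [pow_succ', RelIso.mul_apply]

lemma dyn {f : GG} {L : ℝ} (hL : 0 ≤ L)
    (hdist : ∀ s t a b a' b' : I, s ≤ a → a < b → b ≤ t → s ≤ a' → a' < b' → b' ≤ t →
      (1 - L * ((t:ℝ) - s)) * (((f b' : ℝ) - f a') * ((b:ℝ) - a)) ≤ ((f b : ℝ) - f a) * ((b':ℝ) - a'))
    {a b : I} (hab : a < b) (hfb : f b ≤ a) (hb : L * (b:ℝ) ≤ 1/2) (n : ℕ) :
    (1 - L * ((b:ℝ) - (f^n) b)) * ((((f^n) b : I):ℝ) - (f^(n+1)) b) * ((b:ℝ) - a) ≤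
      ((((f^n) b : I) : ℝ) - (f^n) a) * ((b:ℝ) - f b) := by
  have hfb' : f b < b := hfb.trans_lt hab
  induction n with
  | zero => simp; exact le_of_eq (mul_comm _ _)
  | succ n ih =>
    have s1 : (f^(n+1)) b ≤ (f^n) a := by
      rw [pow_succ, RelIso.mul_apply]; exact (f^n).monotone hfb
    have h := hdist ((f^(n+1)) b) ((f^n) b) ((f^n) a) ((f^n) b) ((f^(n+1)) b) ((f^n) b) s1
      ((f^n).strictMono hab) le_rfl le_rfl (iter_lt hfb' n) le_rfl
    rw [← pow_succ_apply', ← pow_succ_apply', ← pow_succ_apply'] at h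
    have q : (((f^(n+1)) b : I):ℝ) < (f^n) b := iter_lt hfb' n
    have q' : (((f^(n+1+1)) b : I):ℝ) < (f^(n+1)) b := iter_lt hfb' (n+1)
    have qb : (((f^n) b : I):ℝ) ≤ b := iter_le hfb' n
    have q0 : (0:ℝ) ≤ ((f^(n+1)) b : I) := ((f^(n+1)) b).2.1
    have hab' : (a:ℝ) < b := hab
    have hfb'' : (f b:ℝ) < b := hfb'
    set bn : ℝ := (((f^n) b : I) : ℝ)
    set bn1 : ℝ := (((f^(n+1)) b : I) : ℝ)
    set bn2 : ℝ := (((f^(n+1+1)) b : I) : ℝ)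
    set an : ℝ := (((f^n) a : I) : ℝ)
    set an1 : ℝ := (((f^(n+1)) a : I) : ℝ)
    have g1 : 0 ≤ L * (bn - bn1) := by apply mul_nonneg hL; linarith
    have g2 : 0 ≤ L * ((b:ℝ) - bn) := by apply mul_nonneg hL; linarith
    have g3 : L * ((b:ℝ) - bn) + L * (bn - bn1) ≤ L * b := by
      rw [← mul_add]; gcongr; linarith
    refine le_of_mul_le_mul_right (a := bn - bn1) ?_ (by linarith)
    calc (1 - L * ((b:ℝ) - bn1)) * (bn1 - bn2) * (b - a) * (bn - bn1)
        ≤ ((1 - L * (bn - bn1)) * (1 - L * ((b:ℝ) - bn))) * (bn1 - bn2) * (b - a) * (bn - bn1) := by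
          have : 1 - L * ((b:ℝ) - bn1) ≤ (1 - L * (bn - bn1)) * (1 - L * ((b:ℝ) - bn)) := by
            nlinarith [mul_nonneg g1 g2]
          have : 0 ≤ bn1 - bn2 := by linarith
          have : 0 ≤ (b:ℝ) - a := by linarith
          have : 0 ≤ bn - bn1 := by linarith
          gcongr
      _ = (1 - L * (bn - bn1)) * (bn1 - bn2) * ((1 - L * ((b:ℝ) - bn)) * (bn - bn1) * (b - a)) := by ring
      _ ≤ (1 - L * (bn - bn1)) * (bn1 - bn2) * ((bn - an) * ((b:ℝ) - f b)) := by
          apply mul_le_mul_of_nonneg_left ih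
          apply mul_nonneg <;> linarith
      _ = ((1 - L * (bn - bn1)) * ((bn1 - bn2) * (bn - an))) * ((b:ℝ) - f b) := by ring
      _ ≤ ((bn1 - an1) * (bn - bn1)) * ((b:ℝ) - f b) := by
          apply mul_le_mul_of_nonneg_right h; linarith
      _ = _ := by ring

lemma iter_tendsto {f : GG} {k : ℕ} {c r : ℝ} (hc : 0 < c)
    (hcon : ∀ x : I, 0 < (x:ℝ) → (x:ℝ) < r → c * (x:ℝ)^(k+1) ≤ x - f x)
    {b : I} (hb0 : 0 < (b:ℝ)) (hbr : (b:ℝ) < r) (hfb : f b < b) :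
    Tendsto (fun n : ℕ => (((f^n) b : I) : ℝ)) atTop (𝓝 0) := by
  have hanti : Antitone (fun n : ℕ => (((f^n) b : I) : ℝ)) := fun m n h => iter_anti hfb h
  have hbdd : BddBelow (range (fun n : ℕ => (((f^n) b : I) : ℝ))) :=
    ⟨0, by rintro _ ⟨n, rfl⟩; exact ((f^n) b).2.1⟩
  have ht := tendsto_atTop_ciInf hanti hbdd
  set l := ⨅ n : ℕ, (((f^n) b : I) : ℝ)
  have hl0 : 0 ≤ l := ge_of_tendsto' ht fun n => ((f^n) b).2.1
  have ht1 := ht.comp (tendsto_add_atTop_nat 1)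
  have h1 : Tendsto (fun n : ℕ => c * (((f^n) b : I) : ℝ)^(k+1)) atTop (𝓝 (c * l^(k+1))) :=
    (ht.pow _).const_mul _
  have h2 := ht.sub ht1
  have h3 : c * l^(k+1) ≤ l - l := by
    refine le_of_tendsto_of_tendsto' h1 h2 fun n => ?_
    have hle : (((f^n) b : I):ℝ) ≤ b := iter_le hfb n
    rcases (((f^n) b).2.1).eq_or_lt with h0 | h0
    · have hz := ((f^(n+1)) b).2.1
      have hlt : (((f^(n+1)) b : I):ℝ) < (f^n) b := iter_lt hfb n
      linarith
    · have := hcon _ h0 (hle.trans_lt hbr)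
      rw [← pow_succ_apply'] at this
      exact this
  have h4 : l = 0 := by
    by_contra h
    have : 0 < l := lt_of_le_of_ne hl0 (Ne.symm h)
    have : 0 < c * l^(k+1) := by positivity
    linarith
  rwa [h4] at ht

/-- Everything we need about the contraction `f` and the flatter element `w`, on `(0,r)`. -/
structure Setup (f w : GG) (r : ℝ) : Prop where
  hr : 0 < r
  hr1 : r ≤ 1
  con : ∃ (k : ℕ) (c B L : ℝ), 0 < c ∧ 0 ≤ B ∧ 0 ≤ L ∧
    (∀ x : I, 0 < (x:ℝ) → (x:ℝ) < r → c * (x:ℝ)^(k+1) ≤ x - f x) ∧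
    (∀ x : I, (x:ℝ) < r → |(w x : ℝ) - x| ≤ B * (x:ℝ)^(k+2)) ∧ L * r ≤ 1/2 ∧
    (∀ s t a b a' b' : I, s ≤ a → a < b → b ≤ t → s ≤ a' → a' < b' → b' ≤ t →
      (1 - L * ((t:ℝ) - s)) * (((f b' : ℝ) - f a') * ((b:ℝ) - a)) ≤ ((f b : ℝ) - f a) * ((b':ℝ) - a'))
  nofix : ∀ x : I, 0 < (x:ℝ) → (x:ℝ) < r → w x ≠ x

lemma Setup.lt {f w : GG} {r : ℝ} (S : Setup f w r) (x : I) (h0 : 0 < (x:ℝ)) (h1 : (x:ℝ) < r) :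
    f x < x := by
  obtain ⟨k, c, B, L, hc, hB, hL, hcon, -⟩ := S.con
  have := hcon x h0 h1
  have h2 : 0 < c * (x:ℝ)^(k+1) := by positivity
  show (f x : ℝ) < x
  linarith

lemma pos_map {f : GG} {x : I} (h : 0 < (x:ℝ)) : 0 < (f x : ℝ) := by
  have h1 : (⟨0, by simp⟩ : I) < x := h
  have h2 := f.strictMono h1
  rw [map_zero'] at h2
  exact h2

lemma squeeze {f w : GG} {r : ℝ} (S : Setup f w r) {a b : I} (hab : a < b) (hfb : f b ≤ a)
    (hbr : (b:ℝ) < r) : ∀ᶠ n : ℕ in atTop, ∀ z : I, z ≤ (f^n) b →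
      |(w z : ℝ) - z| < (((f^n) b : I):ℝ) - (f^n) a := by
  obtain ⟨k, c, B, L, hc, hB, hL, hcon, hw, hLr, hdist⟩ := S.con
  have hab' : (a:ℝ) < b := hab
  have hb0 : 0 < (b:ℝ) := a.2.1.trans_lt hab'
  have hfb' : f b < b := hfb.trans_lt hab
  have hfb'' : (f b : ℝ) < b := hfb'
  have ht := iter_tendsto hc hcon hb0 hbr hfb'
  set κ : ℝ := c * ((b:ℝ) - a) / 2 with hκ
  have hκ0 : 0 < κ := by rw [hκ]; have : 0 < (b:ℝ) - a := by linarith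
                         positivity
  have ht2 : Tendsto (fun n : ℕ => B * (((f^n) b : I) : ℝ)) atTop (𝓝 0) := by
    simpa using ht.const_mul B
  filter_upwards [ht2.eventually (gt_mem_nhds hκ0)] with n hn z hz
  have hbn : 0 < (((f^n) b : I) : ℝ) := pos_map hb0
  have hble : (((f^n) b : I):ℝ) ≤ b := iter_le hfb' n
  have hLb : L * (b:ℝ) ≤ 1/2 := le_trans (by gcongr) hLr
  have hd := dyn hL hdist hab hfb hLb n
  have h1 := hcon _ hbn (hble.trans_lt hbr)
  rw [← pow_succ_apply'] at h1
  have hz' : (z:ℝ) ≤ ((f^n) b : I) := hz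
  have hz0 := z.2.1
  have h2 := hw z ((hz'.trans hble).trans_lt hbr)
  have hb1 : (b:ℝ) - f b ≤ 1 := by linarith [b.2.2, (f b).2.1]
  have hmono : (((f^n) a : I):ℝ) < (f^n) b := (f^n).strictMono hab
  set bn : ℝ := (((f^n) b : I) : ℝ)
  set bn1 : ℝ := (((f^(n+1)) b : I) : ℝ)
  set an : ℝ := (((f^n) a : I) : ℝ)
  have g3 : 1/2 ≤ 1 - L * ((b:ℝ) - bn) := by
    have : L * ((b:ℝ) - bn) ≤ L * b := by gcongr; linarith
    linarith
  have hp : 0 < bn^(k+1) := by positivity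
  calc |(w z : ℝ) - z| ≤ B * (z:ℝ)^(k+2) := h2
    _ ≤ B * bn^(k+2) := by gcongr
    _ = (B * bn) * bn^(k+1) := by ring
    _ < κ * bn^(k+1) := by gcongr
    _ = 1/2 * (c * bn^(k+1)) * ((b:ℝ) - a) := by rw [hκ]; ring
    _ ≤ (1 - L * ((b:ℝ) - bn)) * (bn - bn1) * ((b:ℝ) - a) := by
        have : 0 ≤ (b:ℝ) - a := by linarith
        have : 0 ≤ c * bn^(k+1) := by positivity
        gcongr
    _ ≤ (bn - an) * ((b:ℝ) - f b) := hd
    _ ≤ (bn - an) * 1 := by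
        have : 0 ≤ bn - an := by linarith
        gcongr
    _ = bn - an := mul_one _

lemma point {f w : GG} {r : ℝ} (S : Setup f w r) {x lo hi : I} (hx0 : 0 < (x:ℝ)) (hxr : (x:ℝ) < r)
    (hlo : lo < x) (hhi : x < hi) : ∀ᶠ n : ℕ in atTop,
      lo < ((f^n)⁻¹ * w * f^n) x ∧ ((f^n)⁻¹ * w * f^n) x < hi ∧ ((f^n)⁻¹ * w * f^n) x ≠ x := by
  have hfx := S.lt x hx0 hxr
  have hr1 := S.hr1
  let ρ : I := ⟨((x:ℝ) + r)/2, by linarith, by linarith⟩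
  have hρx : x < ρ := by show (x:ℝ) < ((x:ℝ) + r)/2; linarith
  have hρr : (ρ:ℝ) < r := by show ((x:ℝ) + r)/2 < r; linarith
  set a : I := max lo (f x)
  set b : I := min hi (min (f⁻¹ x) ρ)
  have hax : a < x := max_lt hlo hfx
  have hfix : x < f⁻¹ x := by
    have := (f⁻¹).strictMono hfx
    rwa [RelIso.inv_apply_self] at this
  have hxb : x < b := lt_min hhi (lt_min hfix hρx)
  have hbr : (b:ℝ) < r := by
    have : b ≤ ρ := (min_le_right _ _).trans (min_le_right _ _)
    have : (b:ℝ) ≤ ρ := this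
    linarith
  have hfb : f b ≤ x := by
    have : b ≤ f⁻¹ x := (min_le_right _ _).trans (min_le_left _ _)
    have := f.monotone this
    rwa [RelIso.apply_inv_self] at this
  filter_upwards [squeeze S hax (le_max_right _ _) hxr, squeeze S hxb hfb hbr] with n h1 h2
  have e1 := h1 ((f^n) x) le_rfl
  have e2 := h2 ((f^n) x) ((f^n).monotone hxb.le)
  rw [abs_lt] at e1 e2
  have u1 : (f^n) a < w ((f^n) x) := by
    show (((f^n) a : I):ℝ) < _
    linarith [e1.1]
  have u2 : w ((f^n) x) < (f^n) b := by
    show _ < (((f^n) b : I):ℝ)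
    linarith [e2.2]
  have v1 := ((f^n)⁻¹).strictMono u1
  have v2 := ((f^n)⁻¹).strictMono u2
  rw [RelIso.inv_apply_self] at v1 v2
  refine ⟨(le_max_left _ _).trans_lt v1, v2.trans_le (min_le_left _ _), fun h => ?_⟩
  have h3 : (f^n)⁻¹ (w ((f^n) x)) = x := h
  have h4 := congrArg (f^n) h3
  rw [RelIso.apply_inv_self] at h4
  refine S.nofix ((f^n) x) (pos_map hx0) ?_ h4
  have : (((f^n) x : I):ℝ) ≤ x := iter_le hfx n
  linarith

lemma exists_setup {f g : GG} (af : IsAnalyticDiffeo f) (ag : IsAnalyticDiffeo g)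
    (aw : IsAnalyticDiffeo (f * g * f⁻¹ * g⁻¹))
    (mf : M f 1) (mg : M g 1) (mf' : M f⁻¹ 1) (mg' : M g⁻¹ 1) (hcomm : f * g ≠ g * f)
    (hcontr : ∃ r > 0, ∀ x : I, 0 < (x:ℝ) → (x:ℝ) < r → f x < x) :
    ∃ r, Setup f (f * g * f⁻¹ * g⁻¹) r := by
  have hf1 : f ≠ 1 := by rintro rfl; simp at hcomm
  have hg1 : g ≠ 1 := by rintro rfl; simp at hcomm
  have hw1 : f * g * f⁻¹ * g⁻¹ ≠ 1 := by
    intro h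
    apply hcomm
    rw [mul_inv_eq_one, mul_inv_eq_iff_eq_mul] at h
    exact h
  obtain ⟨k, c, C, r, hc, hC, hr, hs, hfC, hfL⟩ := order af hf1
  obtain ⟨kg, cg, Cg, rg, hcg, hCg, hrg, hsg, hgC, hgL⟩ := order ag hg1
  obtain ⟨kw, cw, Cw, rw', hcw, hCw, hrw, hsw, -, -⟩ := order aw hw1
  obtain ⟨r0, hr0, hcontr⟩ := hcontr
  obtain ⟨L, hL, hdist⟩ := distort af
  obtain ⟨D, hD, hgD⟩ := mg
  have hcon : ∀ x : I, 0 < (x:ℝ) → (x:ℝ) < min r r0 → c * (x:ℝ)^(k+1) ≤ x - f x := by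
    intro x hx hxr
    rcases hs with hs | hs
    · exact hs x hx (hxr.trans_le (min_le_left _ _))
    · have h1 := hs x hx (hxr.trans_le (min_le_left _ _))
      have h2 : (f x : ℝ) < x := hcontr x hx (hxr.trans_le (min_le_right _ _))
      have : 0 < c * (x:ℝ)^(k+1) := by positivity
      linarith
  have hkg : 1 ≤ kg := by
    by_contra hk
    have hk : kg = 0 := by omega
    subst hk
    set t : ℝ := min (min 1 (rg/2)) (cg / (2 * (D + 1))) with ht
    have ht0 : 0 < t := by positivity
    have t1 : t ≤ 1 := (min_le_left _ _).trans (min_le_left _ _)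
    have t2 : t ≤ rg/2 := (min_le_left _ _).trans (min_le_right _ _)
    have t3 : t ≤ cg / (2 * (D + 1)) := min_le_right _ _
    rw [le_div_iff₀ (by positivity)] at t3
    have b1 := hgD ⟨t, ht0.le, t1⟩
    have b2 : cg * t ≤ D * t^2 := by
      rw [one_mul, abs_le] at b1
      simp only [zero_add, pow_one] at hsg
      rcases hsg with h | h
      · have := h ⟨t, ht0.le, t1⟩ ht0 (by show t < rg; linarith)
        simp only at this b1
        linarith [b1.1]
      · have := h ⟨t, ht0.le, t1⟩ ht0 (by show t < rg; linarith)
        simp only at this b1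
        linarith [b1.2]
    have b3 : cg ≤ D * t := by
      have : cg * t ≤ (D * t) * t := by nlinarith
      exact le_of_mul_le_mul_right this ht0
    nlinarith
  obtain ⟨E1, hE1, e1⟩ := M_bound mf
  obtain ⟨E2, hE2, e2⟩ := M_bound (f := g) ⟨D, hD, hgD⟩
  obtain ⟨E3, hE3, e3⟩ := M_bound mf'
  obtain ⟨E4, hE4, e4⟩ := M_bound mg'
  set E := E1 + E2 + E3 + E4 with hE
  have up : ∀ {E' : ℝ} (x : I), E' ≤ E → E' * (x:ℝ) ≤ E * x := fun x h =>
    mul_le_mul_of_nonneg_right h x.2.1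
  have hρ : 0 < min (min r rg) 1 := by positivity
  obtain ⟨B, r', hB, hr', hwB⟩ := comm_bound (f := f) (g := g) (k := k) (C := C) (D := D + Cg) (E := E)
    (r := min (min r rg) 1) hC (by positivity) (by linarith) hρ
    (fun x hx => hfC x (hx.trans_le ((min_le_left _ _).trans (min_le_left _ _))))
    (fun x y t h1 h2 h3 => hfL x y t h1 h2 (h3.trans_le ((min_le_left _ _).trans (min_le_left _ _))))
    (fun x hx => by
      have := hgD x
      rw [one_mul] at this
      refine this.trans ?_
      gcongr
      linarith)
    (fun x y t h1 h2 h3 => by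
      have ht0 : 0 ≤ t := x.2.1.trans h1
      have ht1 : t ≤ 1 := h3.le.trans (min_le_right _ _)
      refine (hgL x y t h1 h2 (h3.trans_le ((min_le_left _ _).trans (min_le_right _ _)))).trans ?_
      have h5 : t^kg ≤ t := by
        calc t^kg ≤ t^1 := pow_le_pow_of_le_one ht0 ht1 hkg
          _ = t := pow_one t
      gcongr
      linarith)
    (fun x => (e1 x).trans (up x (by linarith))) (fun x => (e2 x).trans (up x (by linarith)))
    (fun x => (e3 x).trans (up x (by linarith))) (fun x => (e4 x).trans (up x (by linarith)))
  set R := min (min (min r r0) r') (min (min rw' 1) (1 / (2 * (L + 1)))) with hR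
  have hR0 : 0 < R := by positivity
  have R1 : R ≤ min r r0 := (min_le_left _ _).trans (min_le_left _ _)
  have R2 : R ≤ r' := (min_le_left _ _).trans (min_le_right _ _)
  have R3 : R ≤ rw' := (min_le_right _ _).trans ((min_le_left _ _).trans (min_le_left _ _))
  have R4 : R ≤ 1 := (min_le_right _ _).trans ((min_le_left _ _).trans (min_le_right _ _))
  have R5 : R ≤ 1 / (2 * (L + 1)) := (min_le_right _ _).trans (min_le_right _ _)
  refine ⟨R, hR0, R4, ⟨k, c, B, L, hc, hB, hL, fun x h0 h1 => hcon x h0 (h1.trans_le R1),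
    fun x hx => hwB x (hx.trans_le R2), ?_, hdist⟩, ?_⟩
  · rw [le_div_iff₀ (by positivity)] at R5
    nlinarith
  · intro x h0 h1 h2
    have hp : 0 < cw * (x:ℝ)^(kw+1) := by positivity
    rcases hsw with h | h
    · have := h x h0 (h1.trans_le R3)
      rw [h2] at this
      linarith
    · have := h x h0 (h1.trans_le R3)
      rw [h2] at this
      linarith

lemma contr_or {f : GG} (af : IsAnalyticDiffeo f) (mf : M f 1) (hf1 : f ≠ 1) :
    (∃ r > 0, ∀ x : I, 0 < (x:ℝ) → (x:ℝ) < r → f x < x) ∨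
    (∃ r > 0, ∀ x : I, 0 < (x:ℝ) → (x:ℝ) < r → f⁻¹ x < x) := by
  obtain ⟨k, c, C, r, hc, hC, hr, hs, -, -⟩ := order af hf1
  rcases hs with h | h
  · left
    refine ⟨r, hr, fun x h0 h1 => ?_⟩
    have := h x h0 h1
    have h2 : 0 < c * (x:ℝ)^(k+1) := by positivity
    show (f x : ℝ) < x
    linarith
  · right
    refine ⟨r, hr, fun x h0 h1 => ?_⟩
    by_contra hcon
    push Not at hcon
    have := h x h0 h1
    have h2 : 0 < c * (x:ℝ)^(k+1) := by positivity
    have h3 : x < f x := by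
      show (x:ℝ) < f x
      linarith
    have h4 := (f⁻¹).strictMono h3
    rw [RelIso.inv_apply_self] at h4
    exact absurd h4 (not_lt.2 hcon)

lemma exists_small (Γ : Subgroup GG)
    (hnofix : ¬ ∃ x : I, 0 < (x : ℝ) ∧ (x : ℝ) < 1 ∧ ∀ g ∈ Γ, g x = x)
    (p : I) (hp1 : (p:ℝ) < 1) {r : ℝ} (hr : 0 < r) : ∃ h ∈ Γ, (h p : ℝ) < r := by
  by_contra hcon
  push Not at hcon
  apply hnofix
  let S : Set ℝ := {y | ∃ h ∈ Γ, (h p : ℝ) = y}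
  have hne : S.Nonempty := ⟨_, 1, Γ.one_mem, rfl⟩
  have hbd : BddBelow S := ⟨0, by rintro _ ⟨h, -, rfl⟩; exact (h p).2.1⟩
  have hpS : sInf S ≤ p := csInf_le hbd ⟨1, Γ.one_mem, rfl⟩
  have hrS : r ≤ sInf S := le_csInf hne (by rintro _ ⟨h, hh, rfl⟩; exact hcon h hh)
  let s : I := ⟨sInf S, by linarith, by linarith⟩
  have hlow : ∀ h ∈ Γ, s ≤ h p := fun h hh => csInf_le hbd ⟨h, hh, rfl⟩
  have hgl : ∀ z : I, (∀ h ∈ Γ, z ≤ h p) → z ≤ s := fun z hz =>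
    le_csInf hne (by rintro _ ⟨h, hh, rfl⟩; exact hz h hh)
  have key : ∀ g ∈ Γ, g s ≤ s := fun g hg => hgl _ fun h hh => by
    have := g.monotone (hlow (g⁻¹ * h) (Γ.mul_mem (Γ.inv_mem hg) hh))
    rwa [RelIso.mul_apply, RelIso.apply_inv_self] at this
  refine ⟨s, by show 0 < sInf S; linarith, by show sInf S < 1; linarith, fun g hg => ?_⟩
  apply le_antisymm (key g hg)
  have := g.monotone (key g⁻¹ (Γ.inv_mem hg))
  rwa [RelIso.apply_inv_self] at this

lemma final (Γ : Subgroup GG)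
    (hΓ : ∀ f ∈ Γ, IsAnalyticDiffeo f)
    (hnm : ¬ (∀ a b : ↥Γ, a ∈ commutator ↥Γ → b ∈ commutator ↥Γ → a * b = b * a)) :
    ∃ f ∈ Γ, ∃ w ∈ Γ, ∃ r, Setup f w r := by
  push Not at hnm
  obtain ⟨a, b, ha, hb, hab⟩ := hnm
  have hab' : (a:GG) * b ≠ b * a := fun h => hab (Subtype.ext h)
  have ma := commutator_M Γ hΓ a ha
  have mb := commutator_M Γ hΓ b hb
  have ma' := commutator_M Γ hΓ a⁻¹ (inv_mem ha)
  have mb' := commutator_M Γ hΓ b⁻¹ (inv_mem hb)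
  have ha1 : (a:GG) ≠ 1 := by intro h; rw [h] at hab'; simp at hab'
  rcases contr_or (hΓ _ a.2) ma ha1 with h | h
  · exact ⟨a, a.2, _, (a * b * a⁻¹ * b⁻¹).2, exists_setup (hΓ _ a.2) (hΓ _ b.2)
      (hΓ _ (a * b * a⁻¹ * b⁻¹).2) ma mb ma' mb' hab' h⟩
  · have ma'' : M ((a:GG)⁻¹)⁻¹ 1 := by rw [inv_inv]; exact ma
    refine ⟨(a:GG)⁻¹, (a⁻¹).2, _, (a⁻¹ * b * a⁻¹⁻¹ * b⁻¹).2, exists_setup (hΓ _ (a⁻¹).2) (hΓ _ b.2)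
      (hΓ _ (a⁻¹ * b * a⁻¹⁻¹ * b⁻¹).2) ma' mb ma'' mb' ?_ h⟩
    intro h2
    apply hab'
    have h2' : (a:GG)⁻¹ * b = b * (a:GG)⁻¹ := h2
    rw [inv_mul_eq_iff_eq_mul, ← mul_assoc, eq_mul_inv_iff_mul_eq] at h2'
    exact h2'.symm

end SD

/-- If a non-metabelian subgroup of `Diff^ω_+([0,1])` has no global fixed point in `(0,1)`,
then any finite set of interior points can be displaced by an arbitrarily small amount:
some element of the group fixes none of the points but moves each of them less than `ε`. -/
theorem small_displacement_of_nonmetabelian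
    (Γ : Subgroup (↥(Set.Icc (0:ℝ) 1) ≃o ↥(Set.Icc (0:ℝ) 1)))
    (hΓ : ∀ f ∈ Γ, IsAnalyticDiffeo f)
    (hnm : ¬ (∀ a b : ↥Γ, a ∈ commutator ↥Γ → b ∈ commutator ↥Γ → a * b = b * a))
    (hnofix : ¬ ∃ x : ↥(Set.Icc (0:ℝ) 1), 0 < (x : ℝ) ∧ (x : ℝ) < 1 ∧ ∀ g ∈ Γ, g x = x) :
    ∀ (n : ℕ) (p : Fin n → ↥(Set.Icc (0:ℝ) 1)),
      StrictMono p → (∀ i, 0 < (p i : ℝ) ∧ (p i : ℝ) < 1) →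
      ∀ ε : ℝ, 0 < ε →
        ∃ f ∈ Γ, ∀ i, f (p i) ≠ p i ∧ |(f (p i) : ℝ) - (p i : ℝ)| < ε := by
  intro n p hp hp01 ε hε
  obtain ⟨f, hf, w, hw, r, S⟩ := SD.final Γ hΓ hnm
  rcases n with _ | n
  · exact ⟨1, Γ.one_mem, fun i => i.elim0⟩
  obtain ⟨h, hh, hhr⟩ := SD.exists_small Γ hnofix (p (Fin.last n)) (hp01 _).2 S.hr
  have hev : ∀ᶠ k : ℕ in Filter.atTop, ∀ i, (h⁻¹ * ((f^k)⁻¹ * w * f^k) * h) (p i) ≠ p i ∧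
      |((h⁻¹ * ((f^k)⁻¹ * w * f^k) * h) (p i) : ℝ) - (p i : ℝ)| < ε := by
    rw [Filter.eventually_all]
    intro i
    have hi0 := (hp01 i).1
    have hi1 := (hp01 i).2
    let lo : SD.I := ⟨max 0 ((p i : ℝ) - ε/2), le_max_left _ _, max_le zero_le_one (by linarith)⟩
    let hi : SD.I := ⟨min 1 ((p i : ℝ) + ε/2), le_min zero_le_one (by linarith), min_le_left _ _⟩
    have hlo : lo < p i := by
      show max 0 ((p i : ℝ) - ε/2) < p i
      exact max_lt hi0 (by linarith)
    have hhi : p i < hi := by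
      show (p i : ℝ) < min 1 ((p i : ℝ) + ε/2)
      exact lt_min hi1 (by linarith)
    have hle : (h (p i) : ℝ) ≤ h (p (Fin.last n)) := h.monotone (hp.monotone (Fin.le_last i))
    have hpt := SD.point S (x := h (p i)) (SD.pos_map hi0) (hle.trans_lt hhr)
      (h.strictMono hlo) (h.strictMono hhi)
    filter_upwards [hpt] with k hk
    obtain ⟨k1, k2, k3⟩ := hk
    have v1 := (h⁻¹).strictMono k1
    have v2 := (h⁻¹).strictMono k2
    rw [RelIso.inv_apply_self] at v1 v2
    constructor
    · intro he
      apply k3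
      have he' : h⁻¹ (((f^k)⁻¹ * w * f^k) (h (p i))) = p i := he
      have := congrArg h he'
      rwa [RelIso.apply_inv_self] at this
    · have v1' : max 0 ((p i : ℝ) - ε/2) < ((h⁻¹ * ((f^k)⁻¹ * w * f^k) * h) (p i) : ℝ) := v1
      have v2' : ((h⁻¹ * ((f^k)⁻¹ * w * f^k) * h) (p i) : ℝ) < min 1 ((p i : ℝ) + ε/2) := v2
      have w1 := (le_max_right _ _).trans_lt v1'
      have w2 := v2'.trans_le (min_le_right _ _)
      rw [abs_lt]
      constructor <;> linarith
  obtain ⟨k, hk⟩ := hev.exists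
  exact ⟨_, Γ.mul_mem (Γ.mul_mem (Γ.inv_mem hh) (Γ.mul_mem (Γ.mul_mem (Γ.inv_mem (Γ.pow_mem hf k)) hw)
    (Γ.pow_mem hf k))) hh, hk⟩
end

section
/- Let ≼ be a left-order on the free group F₂ on two generators whose orbit under the conjugacy action of F₂ on the space LO(F₂) of left-orders is dense in LO(F₂). Then ≼ satisfies no verbal property: for every nonempty reduced word W(a,b) in two letters whose reduced form carries both positive and negative exponents, ≼ is not a W-order. -/
/-- A subset of a group (given by its indicator function `P : Γ → Bool`, so that the
power set `Γ → Bool` carries the product topology with `Bool` discrete) is the positive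
cone of a left-order if it is closed under multiplication, does not contain `1`, and
every `g ≠ 1` lies in exactly one of `P`, `P⁻¹`. -/
def IsLeftOrderCone {Γ : Type*} [Group Γ] (P : Γ → Bool) : Prop :=
  (∀ a b : Γ, P a = true → P b = true → P (a * b) = true) ∧
  P 1 = false ∧
  (∀ g : Γ, g ≠ 1 → (P g = true ↔ P g⁻¹ = false))

/-- A reduced word `w` in two letters carries both positive and negative exponents. -/
def HasBothSigns (w : FreeGroup (Fin 2)) : Prop :=
  (∃ x, (x, true) ∈ w.toWord) ∧ (∃ x, (x, false) ∈ w.toWord)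

/-- A left-order with positive cone `P` is a `W`-order if `W(f,g)` is positive whenever
`f` and `g` are. -/
def IsWOrder {Γ : Type*} [Group Γ] (w : FreeGroup (Fin 2)) (P : Γ → Bool) : Prop :=
  ∀ f g : Γ, P f = true → P g = true → P ((FreeGroup.lift ![f, g]) w) = true

/-- The space of left-orders on the free group `F₂`, as the set of positive cones inside
the power set `F₂ → Bool` with the product topology. -/
def LOF2 : Type := {P : FreeGroup (Fin 2) → Bool // IsLeftOrderCone P}

instance : TopologicalSpace LOF2 :=
  instTopologicalSpaceSubtype

/-- The image of a positive cone under the conjugacy (right translation) action of `h`: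
the positive cone of the order `≼_h` defined by `f ≺_h g ↔ fh ≺ gh`; its positive
elements are the `g` with `h⁻¹ g h` positive. -/
def coneConj (h : FreeGroup (Fin 2)) (P : FreeGroup (Fin 2) → Bool) :
    FreeGroup (Fin 2) → Bool :=
  fun g => P (h⁻¹ * g * h)

open Order Order.PartialIso in
/-- Any finite partial isomorphism of `ℚ` extends to an automorphism. -/
lemma exists_orderIso_extending (p : PartialIso ℚ ℚ) :
    ∃ σ : ℚ ≃o ℚ, ∀ q ∈ p.val, σ q.1 = q.2 := by
  classical
  let toCofinal : ℚ ⊕ ℚ → Cofinal (PartialIso ℚ ℚ) := fun q ↦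
    Sum.recOn q (definedAtLeft ℚ) (definedAtRight ℚ)
  let I : Ideal (PartialIso ℚ ℚ) := idealOfCofinals p toCofinal
  let F a := funOfIdeal a I (cofinal_meets_idealOfCofinals _ toCofinal (Sum.inl a))
  let G b := invOfIdeal b I (cofinal_meets_idealOfCofinals _ toCofinal (Sum.inr b))
  refine ⟨OrderIso.ofCmpEqCmp (fun a ↦ (F a).val) (fun b ↦ (G b).val) ?_, ?_⟩
  · intro a b
    rcases (F a).prop with ⟨f, hf, ha⟩
    rcases (G b).prop with ⟨g, hg, hb⟩
    rcases I.directed _ hf _ hg with ⟨m, _, fm, gm⟩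
    exact m.prop (a, _) (fm ha) (_, b) (gm hb)
  · intro q hq
    change (F q.1).val = q.2
    rcases (F q.1).prop with ⟨f, hf, ha⟩
    rcases I.directed _ hf _ (mem_idealOfCofinals p toCofinal) with ⟨m, _, fm, gm⟩
    have h := m.prop (q.1, _) (fm ha) q (gm hq)
    simp only [cmp_self_eq_eq] at h
    exact (cmp_eq_eq_iff _ _).1 h.symm

/-- Insert a pair lying strictly below everything. -/
lemma exists_insert (A : Order.PartialIso ℚ ℚ) (x y : ℚ)
    (h : ∀ q ∈ A.val, x < q.1 ∧ y < q.2) :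
    ∃ B : Order.PartialIso ℚ ℚ, B.val = insert (x, y) A.val := by
  refine ⟨⟨insert (x, y) A.val, ?_⟩, rfl⟩
  intro p hp q hq
  rw [Finset.mem_insert] at hp hq
  rcases hp with rfl | hp <;> rcases hq with rfl | hq
  · simp
  · have := h q hq
    rw [(cmp_eq_lt_iff _ _).2 this.1, (cmp_eq_lt_iff _ _).2 this.2]
  · have := h p hp
    rw [(cmp_eq_gt_iff _ _).2 this.1, (cmp_eq_gt_iff _ _).2 this.2]
  · exact A.prop p hp q hq

/-- Source coordinate of a pair for a letter of the given sign. -/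
def srcCoord (b : Bool) (q : ℚ × ℚ) : ℚ := cond b q.1 q.2

lemma phase_two (R : List (Fin 2 × Bool)) :
    ∀ (A : Fin 2 → Order.PartialIso ℚ ℚ) (p : ℚ) (l : Fin 2 × Bool),
      (∀ c, ∀ q ∈ (A c).val, p ≤ q.1 ∧ p ≤ q.2) →
      (∀ m : Fin 2 × Bool, (l.1 = m.1 → l.2 = m.2) →
        ∀ q ∈ (A m.1).val, p < srcCoord m.2 q) →
      List.IsChain (fun a b : Fin 2 × Bool => a.1 = b.1 → a.2 = b.2) (l :: R) →
      ∃ σ : Fin 2 → (ℚ ≃o ℚ), (∀ c, ∀ q ∈ (A c).val, σ c q.1 = q.2) ∧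
        (FreeGroup.lift σ (FreeGroup.mk R.reverse)) p ≤ p := by
  induction R with
  | nil =>
    intro A p l _ _ _
    choose σ hσ using fun c => exists_orderIso_extending (A c)
    refine ⟨σ, hσ, ?_⟩
    simp
  | cons m R ih =>
    intro A p l h1 h2 hch
    rw [List.isChain_cons_cons] at hch
    obtain ⟨hlm, hch⟩ := hch
    have h3 := h2 m hlm
    obtain ⟨d, b⟩ := m
    let x : ℚ := cond b p (p - 1)
    let y : ℚ := cond b (p - 1) p
    obtain ⟨B, hB⟩ := exists_insert (A d) x y (by
      intro q hq
      have e1 := h1 d q hq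
      have e2 := h3 q hq
      cases b <;> simp only [srcCoord, cond_true, cond_false, x, y] at * <;>
        constructor <;> linarith)
    have hsub : ∀ c, ∀ q, q ∈ ((Function.update A d B) c).val ↔
        (q ∈ (A c).val ∨ (c = d ∧ q = (x, y))) := by
      intro c q
      by_cases hc : c = d
      · subst hc
        simp only [Function.update_self, hB, Finset.mem_insert, true_and]
        tauto
      · simp [Function.update_of_ne hc, hc]
    obtain ⟨σ, hσ, hle⟩ := ih (Function.update A d B) (p - 1) (d, b) (by
        intro c q hq
        rcases (hsub c q).1 hq with hq | ⟨rfl, rfl⟩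
        · have := h1 c q hq
          constructor <;> linarith
        · cases b <;> simp [x, y]) (by
        intro m hm q hq
        rcases (hsub _ q).1 hq with hq | ⟨hmd, rfl⟩
        · have := h1 _ q hq
          unfold srcCoord
          cases m.2 <;> simp only [cond_true, cond_false] <;> linarith
        · have := hm hmd.symm
          simp only at this
          rw [← this]
          cases b <;> simp [srcCoord, x, y]) hch
    refine ⟨σ, fun c q hq => hσ c q ((hsub c q).2 (Or.inl hq)), ?_⟩
    have hxy : σ d x = y := hσ d (x, y) ((hsub d _).2 (Or.inr ⟨rfl, rfl⟩))
    have hstep : (cond b (σ d) (σ d)⁻¹) p = p - 1 := by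
      cases b
      · simp only [cond_true, cond_false, x, y] at hxy ⊢
        conv_lhs => rw [← hxy]
        exact RelIso.inv_apply_self _ _
      · exact hxy
    have : (FreeGroup.lift σ (FreeGroup.mk ((d, b) :: R).reverse)) p
        = (FreeGroup.lift σ (FreeGroup.mk R.reverse)) (p - 1) := by
      rw [← hstep]
      simp only [FreeGroup.lift_mk, List.reverse_cons, List.map_append, List.prod_append,
        List.map_cons, List.map_nil, List.prod_cons, List.prod_nil, mul_one]
      rfl
    rw [this]
    linarith

/-- The affine model: `s` acts as `x + 1`, the other generator as `δ (x + 1)`. -/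
def affMap (s : Fin 2) (δ : ℚ) (c : Fin 2) (x : ℚ) : ℚ :=
  if c = s then x + 1 else δ * (x + 1)

lemma affMap_strictMono (s : Fin 2) (δ : ℚ) (hδ : 0 < δ) (c : Fin 2) :
    StrictMono (affMap s δ c) := by
  intro x y h
  unfold affMap
  split_ifs
  · linarith
  · exact mul_lt_mul_of_pos_left (by linarith) hδ

lemma phase_one (s : Fin 2) (δ : ℚ) (hδ : 0 < δ) (hδ1 : δ ≤ 1) (u : List (Fin 2 × Bool))
    (hu : ∀ l ∈ u, l.2 = true) :
    ∃ (S : Finset ℚ) (v : ℚ), 0 ∈ S ∧ (∀ x ∈ S, 0 ≤ x) ∧ v ∈ S ∧ v ≤ u.length ∧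
      (∀ l, u.head? = some l → l.1 ≠ s → v ≤ δ * u.length) ∧
      ∀ σ : Fin 2 → (ℚ ≃o ℚ), (∀ c, ∀ x ∈ S, σ c x = affMap s δ c x) →
        (FreeGroup.lift σ (FreeGroup.mk u)) 0 = v := by
  classical
  induction u with
  | nil => exact ⟨{0}, 0, by simp, by simp, by simp, by simp, by simp, by simp⟩
  | cons l u ih =>
    obtain ⟨S, v, h0, hS, hv, hvl, -, hσ⟩ := ih (fun l hl => hu l (List.mem_cons_of_mem _ hl))
    have hv0 := hS v hv
    refine ⟨insert (affMap s δ l.1 v) S, affMap s δ l.1 v, Finset.mem_insert_of_mem h0, ?_,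
      Finset.mem_insert_self _ _, ?_, ?_, ?_⟩
    · intro x hx
      rcases Finset.mem_insert.1 hx with rfl | hx
      · unfold affMap
        split_ifs <;> positivity
      · exact hS x hx
    · unfold affMap
      push_cast [List.length_cons]
      split_ifs
      · linarith
      · nlinarith
    · intro l' hl' hne
      simp only [List.head?_cons, Option.some.injEq] at hl'
      subst hl'
      simp only [affMap, hne, if_false]
      push_cast [List.length_cons]
      exact mul_le_mul_of_nonneg_left (by linarith) hδ.le
    · intro σ h
      have e := hσ σ (fun c x hx => h c x (Finset.mem_insert_of_mem hx))
      have e2 := h l.1 v (Finset.mem_insert_of_mem hv)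
      rw [← e2, ← e]
      simp only [FreeGroup.lift_mk, List.map_cons, List.prod_cons, hu l List.mem_cons_self,
        cond_true]
      rfl

lemma split_last_false (L : List (Fin 2 × Bool)) (h : ∃ x, (x, false) ∈ L) :
    ∃ V s u, L = V ++ (s, false) :: u ∧ ∀ l ∈ u, l.2 = true := by
  induction L with
  | nil => simp at h
  | cons l L ih =>
    by_cases h' : ∃ x, (x, false) ∈ L
    · obtain ⟨V, s, u, rfl, hu⟩ := ih h'
      exact ⟨l :: V, s, u, rfl, hu⟩
    · obtain ⟨x, hx⟩ := h
      rcases List.mem_cons.1 hx with rfl | hx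
      · refine ⟨[], x, L, rfl, ?_⟩
        rintro ⟨c, b⟩ hl
        cases b
        · exact absurd ⟨c, hl⟩ h'
        · rfl
      · exact absurd ⟨x, hx⟩ h'

/-- The dynamical core. -/
lemma exists_action (w : FreeGroup (Fin 2)) (hw : ∃ x, (x, false) ∈ w.toWord) :
    ∃ σ : Fin 2 → (ℚ ≃o ℚ), (∀ c, 0 < σ c 0) ∧ (FreeGroup.lift σ w) 0 < 0 := by
  classical
  obtain ⟨V, s, u, hL, hu⟩ := split_last_false _ hw
  have hred : FreeGroup.IsReduced w.toWord := FreeGroup.isReduced_toWord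
  let δ : ℚ := 1 / (u.length + 2)
  have hδ : 0 < δ := by positivity
  have hδ1 : δ * (u.length + 2) = 1 := by
    simp only [δ]; field_simp
  have hlen : (0 : ℚ) ≤ u.length := by positivity
  have hδ2 : δ ≤ 1 := by nlinarith
  obtain ⟨S, v, h0, hS, hv, hvl, hvd, hσ⟩ := phase_one s δ hδ hδ2 u hu
  have hv0 := hS v hv
  have hv1 : v < 1 := by
    cases u with
    | nil => simp at hvl; linarith
    | cons l u =>
      have hne : l.1 ≠ s := by
        intro hls
        rw [hL] at hred
        have := (List.isChain_append_cons_cons.1 hred).2.1 hls.symm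
        rw [hu l List.mem_cons_self] at this
        simp at this
      have := hvd l rfl hne
      nlinarith
  -- the initial partial isomorphisms
  let T : Fin 2 → Finset ℚ := fun c => if c = s then insert (v - 1) S else S
  let A : Fin 2 → Order.PartialIso ℚ ℚ := fun c =>
    ⟨(T c).image (fun x => (x, affMap s δ c x)), by
      intro p hp q hq
      obtain ⟨x, -, rfl⟩ := Finset.mem_image.1 hp
      obtain ⟨y, -, rfl⟩ := Finset.mem_image.1 hq
      exact ((affMap_strictMono s δ hδ c).cmp_map_eq x y).symm⟩
  have hA : ∀ c q, q ∈ (A c).val ↔ ∃ x ∈ T c, (x, affMap s δ c x) = q := by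
    intro c q
    exact Finset.mem_image
  have hT : ∀ c x, x ∈ T c → (0 ≤ x ∨ (c = s ∧ x = v - 1)) := by
    intro c x hx
    by_cases hc : c = s
    · simp only [T, hc, if_true, Finset.mem_insert] at hx
      rcases hx with rfl | hx
      · exact Or.inr ⟨hc, rfl⟩
      · exact Or.inl (hS x hx)
    · simp only [T, hc, if_false] at hx
      exact Or.inl (hS x hx)
  have hST : ∀ c x, x ∈ S → x ∈ T c := by
    intro c x hx
    simp only [T]
    split_ifs
    · exact Finset.mem_insert_of_mem hx
    · exact hx
  have haff : ∀ c x, x ∈ T c → 0 ≤ affMap s δ c x := by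
    intro c x hx
    rcases hT c x hx with h | ⟨rfl, rfl⟩
    · unfold affMap
      split_ifs <;> positivity
    · simp [affMap, hv0]
  have hchain : List.IsChain (fun a b : Fin 2 × Bool => a.1 = b.1 → a.2 = b.2)
      ((s, false) :: V.reverse) := by
    have h1 : List.IsChain (fun a b : Fin 2 × Bool => a.1 = b.1 → a.2 = b.2)
        (V ++ [(s, false)]) := by
      refine hred.infix ⟨[], u, ?_⟩
      rw [hL]; simp
    have h2 := List.isChain_reverse.2 (h1.imp (S := fun a b => b.1 = a.1 → b.2 = a.2)
      (fun a b h e => (h e.symm).symm))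
    simpa using h2
  obtain ⟨σ, hext, hle⟩ := phase_two V.reverse A (v - 1) (s, false) (by
      intro c q hq
      obtain ⟨x, hx, rfl⟩ := (hA c q).1 hq
      have h1 := haff c x hx
      refine ⟨?_, by simp only; linarith⟩
      rcases hT c x hx with h | ⟨-, rfl⟩
      · simp only; linarith
      · exact le_rfl) (by
      rintro ⟨c, b⟩ hm q hq
      obtain ⟨x, hx, rfl⟩ := (hA c q).1 hq
      have h1 := haff c x hx
      cases b
      · simp only [srcCoord, cond_false]; linarith
      · simp only [srcCoord, cond_true]
        rcases hT c x hx with h | ⟨rfl, rfl⟩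
        · linarith
        · simp at hm) hchain
  have hext' : ∀ c x, x ∈ T c → σ c x = affMap s δ c x := fun c x hx =>
    hext c (x, affMap s δ c x) ((hA c _).2 ⟨x, hx, rfl⟩)
  refine ⟨σ, ?_, ?_⟩
  · intro c
    rw [hext' c 0 (hST c 0 h0)]
    unfold affMap
    split_ifs <;> simp [hδ]
  · have e1 := hσ σ (fun c x hx => hext' c x (hST c x hx))
    have e2 : σ s (v - 1) = v := by
      rw [hext' s (v - 1) (by simp [T])]
      simp [affMap]
    have e3 : (σ s)⁻¹ v = v - 1 := by
      conv_lhs => rw [← e2]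
      exact RelIso.inv_apply_self _ _
    have e4 : (FreeGroup.lift σ w) 0 = (FreeGroup.lift σ (FreeGroup.mk V)) (v - 1) := by
      rw [← FreeGroup.mk_toWord (x := w), hL, ← e3, ← e1]
      simp only [FreeGroup.lift_mk, List.map_append, List.prod_append,
        List.map_cons, List.prod_cons, cond_false]
      rfl
    rw [List.reverse_reverse] at hle
    rw [e4]
    linarith

/-- The lexicographic order induced by an action on `ℚ` based at `0`. -/
lemma exists_cone (P : FreeGroup (Fin 2) → Bool) (hP : IsLeftOrderCone P)
    (φ : FreeGroup (Fin 2) →* (ℚ ≃o ℚ)) :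
    ∃ Q : FreeGroup (Fin 2) → Bool, IsLeftOrderCone Q ∧
      (∀ g, 0 < φ g 0 → Q g = true) ∧ (∀ g, φ g 0 < 0 → Q g = false) := by
  classical
  have hmul : ∀ a b, φ (a * b) 0 = φ a (φ b 0) := fun a b => by rw [map_mul]; rfl
  have hinv : ∀ a, φ a (φ a⁻¹ 0) = 0 := fun a => by
    rw [← hmul, mul_inv_cancel, map_one]; rfl
  obtain ⟨h1, h2, h3⟩ := hP
  refine ⟨fun g => decide (0 < φ g 0 ∨ (φ g 0 = 0 ∧ P g = true)), ⟨?_, ?_, ?_⟩, ?_, ?_⟩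
  · intro a b ha hb
    rw [decide_eq_true_eq] at *
    rw [hmul]
    rcases hb with hb | ⟨hb, hb'⟩
    · have := (φ a).strictMono hb
      left
      rcases ha with ha | ⟨ha, -⟩ <;> linarith
    · rw [hb]
      rcases ha with ha | ⟨ha, ha'⟩
      · exact Or.inl ha
      · exact Or.inr ⟨ha, h1 a b ha' hb'⟩
  · simp [h2]
  · intro g hg
    rw [decide_eq_true_eq, decide_eq_false_iff_not]
    have e := hinv g
    have e3 := h3 g hg
    rcases lt_trichotomy (φ g⁻¹ 0) 0 with h | h | h
    · have := (φ g).strictMono h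
      rw [e] at this
      exact ⟨fun _ hh => by rcases hh with hh | hh <;> linarith [hh], fun _ => Or.inl this⟩
    · rw [h] at e
      rw [h, e, e3]
      simp
    · have := (φ g).strictMono h
      rw [e] at this
      refine ⟨fun hh => ?_, fun hh => absurd (Or.inl h) hh⟩
      rcases hh with hh | hh <;> linarith [hh]
  · intro g hg
    simp [hg]
  · intro g hg
    simp [hg.le, hg.ne]

/-- A left-order on `F₂` whose orbit under the conjugacy action is dense in the space of
left-orders satisfies no verbal property: it is not a `W`-order for any nonempty reduced
word `W` carrying both positive and negative exponents. -/
theorem dense_conjugacy_orbit_no_verbal_property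
    (P : FreeGroup (Fin 2) → Bool) (hP : IsLeftOrderCone P)
    (hdense : Dense {Q : LOF2 | ∃ h : FreeGroup (Fin 2), Q.1 = coneConj h P}) :
    ∀ w : FreeGroup (Fin 2), w ≠ 1 → HasBothSigns w → ¬ IsWOrder w P := by
  classical
  rintro w - ⟨-, hneg⟩ hW
  obtain ⟨σ, hpos, hlt⟩ := exists_action w hneg
  obtain ⟨Q, hQ, hQ1, hQ2⟩ := exists_cone P hP (FreeGroup.lift σ)
  have hcont : ∀ g : FreeGroup (Fin 2), Continuous (fun R : LOF2 => R.1 g) := fun g =>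
    (continuous_apply g).comp continuous_subtype_val
  have hop : ∀ (g : FreeGroup (Fin 2)) (b : Bool), IsOpen {R : LOF2 | R.1 g = b} := fun g b =>
    (isOpen_discrete {b}).preimage (hcont g)
  have hopen := ((hop (FreeGroup.of 0) true).inter (hop (FreeGroup.of 1) true)).inter
    (hop w false)
  obtain ⟨R, ⟨⟨hR0, hR1⟩, hRw⟩, h, hR⟩ := hdense.inter_open_nonempty _ hopen
    ⟨⟨Q, hQ⟩, ⟨hQ1 _ (by simpa using hpos 0), hQ1 _ (by simpa using hpos 1)⟩, hQ2 _ hlt⟩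
  simp only [Set.mem_ofPred_eq, hR, coneConj] at hR0 hR1 hRw
  have key := hW _ _ hR0 hR1
  have hconj : FreeGroup.lift ![h⁻¹ * FreeGroup.of 0 * h, h⁻¹ * FreeGroup.of 1 * h]
      = (MulAut.conj h⁻¹).toMonoidHom := by
    ext i
    fin_cases i <;> simp
  rw [hconj] at key
  simp [hRw] at key
end

section
/- For every nonempty reduced word W(a,b) in two letters whose reduced form carries both positive and negative exponents, the set of W-orders on the free group F₂ on two generators is a closed subset of the space LO(F₂) of left-orders of F₂ and has empty interior. -/
section ExtensionLemmas

/-- A finite partial increasing map of a countable dense order without endpoints extends to an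
order automorphism. -/
theorem exists_orderIso_extend_finset {Ω : Type*} [LinearOrder Ω] [Countable Ω] [DenselyOrdered Ω]
    [NoMinOrder Ω] [NoMaxOrder Ω] [Nonempty Ω] (S : Finset (Ω × Ω))
    (hS : ∀ p ∈ S, ∀ q ∈ S, (p.1 < q.1 ↔ p.2 < q.2)) :
    ∃ e : Ω ≃o Ω, ∀ p ∈ S, e p.1 = p.2 := by
  classical
  cases nonempty_encodable Ω
  have hcmp : ∀ p ∈ S, ∀ q ∈ S, cmp p.1 q.1 = cmp p.2 q.2 := by
    intro p hp q hq
    have h1 := hS p hp q hq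
    have h2 := hS q hq p hp
    rcases lt_trichotomy p.1 q.1 with h | h | h
    · rw [(cmp_eq_lt_iff _ _).2 h, (cmp_eq_lt_iff _ _).2 (h1.1 h)]
    · have h3 : p.2 = q.2 := by
        apply le_antisymm
        · exact not_lt.1 fun h' => (h2.2 h').ne h.symm
        · exact not_lt.1 fun h' => (h1.2 h').ne h
      rw [(cmp_eq_eq_iff _ _).2 h, (cmp_eq_eq_iff _ _).2 h3]
    · rw [(cmp_eq_gt_iff _ _).2 h, (cmp_eq_gt_iff _ _).2 (h2.1 h)]
  let p0 : Order.PartialIso Ω Ω := ⟨S, hcmp⟩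
  let toC : Ω ⊕ Ω → Order.Cofinal (Order.PartialIso Ω Ω) := fun p ↦
    Sum.recOn p (Order.PartialIso.definedAtLeft Ω) (Order.PartialIso.definedAtRight Ω)
  let I : Order.Ideal (Order.PartialIso Ω Ω) := Order.idealOfCofinals p0 toC
  let F a := Order.PartialIso.funOfIdeal a I
    (Order.cofinal_meets_idealOfCofinals _ toC (Sum.inl a))
  let G b := Order.PartialIso.invOfIdeal b I
    (Order.cofinal_meets_idealOfCofinals _ toC (Sum.inr b))
  refine ⟨OrderIso.ofCmpEqCmp (fun a ↦ (F a).val) (fun b ↦ (G b).val) fun a b ↦ by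
      rcases (F a).prop with ⟨f, hf, ha⟩
      rcases (G b).prop with ⟨g, hg, hb⟩
      rcases I.directed _ hf _ hg with ⟨m, _, fm, gm⟩
      exact m.prop (a, _) (fm ha) (_, b) (gm hb), ?_⟩
  intro p hp
  change (F p.1).val = p.2
  rcases (F p.1).prop with ⟨f, hf, ha⟩
  have h0 : p0 ∈ I := Order.mem_idealOfCofinals _ _
  rcases I.directed _ hf _ h0 with ⟨m, _, fm, gm⟩
  have h := m.prop (p.1, (F p.1).val) (fm ha) p (gm hp)
  rw [cmp_self_eq_eq] at h
  exact (cmp_eq_eq_iff _ _).1 h.symm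

theorem exists_orderIso_glue {Ω : Type*} [LinearOrder Ω] (e τ : Ω ≃o Ω) (m : Ω)
    (h : e m = τ m) :
    ∃ e' : Ω ≃o Ω, (∀ t, t < m → e' t = e t) ∧ ∀ t, m ≤ t → e' t = τ t := by
  classical
  let F : Ω → Ω := fun t => if t < m then e t else τ t
  have hm : StrictMono F := by
    intro s t hst
    by_cases hs : s < m <;> by_cases ht : t < m
    · simp [F, hs, ht, hst]
    · simp only [F, hs, ht, if_true, if_false]
      calc e s < e m := e.strictMono hs
        _ = τ m := h
        _ ≤ τ t := τ.monotone (not_lt.1 ht)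
    · exact absurd (hst.trans ht) hs
    · simp [F, hs, ht, hst]
  have hsurj : Function.Surjective F := by
    intro y
    by_cases hy : y < e m
    · refine ⟨e.symm y, ?_⟩
      have : e.symm y < m := by rwa [OrderIso.symm_apply_lt]
      simp [F, this]
    · refine ⟨τ.symm y, ?_⟩
      have : ¬ τ.symm y < m := by rwa [OrderIso.symm_apply_lt, ← h]
      simp [F, this]
  refine ⟨hm.orderIsoOfSurjective F hsurj, ?_, ?_⟩
  · intro t ht
    simp [F, ht]
  · intro t ht
    simp [F, not_lt.2 ht]

/-- Extension of a finite partial map, with prescribed behaviour on a final segment. -/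
theorem exists_orderIso_extend {Ω : Type*} [LinearOrder Ω] [Countable Ω] [DenselyOrdered Ω]
    [NoMinOrder Ω] [NoMaxOrder Ω] (S : Finset (Ω × Ω))
    (hS : ∀ p ∈ S, ∀ q ∈ S, (p.1 < q.1 ↔ p.2 < q.2)) (m : Ω) (τ : Ω ≃o Ω)
    (hm : ∀ p ∈ S, p.1 < m ∧ p.2 < τ m) :
    ∃ e : Ω ≃o Ω, (∀ p ∈ S, e p.1 = p.2) ∧ ∀ t, m ≤ t → e t = τ t := by
  classical
  have : Nonempty Ω := ⟨m⟩
  obtain ⟨e, he⟩ := exists_orderIso_extend_finset (insert (m, τ m) S) (by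
    intro p hp q hq
    rcases Finset.mem_insert.1 hp with rfl | hp <;> rcases Finset.mem_insert.1 hq with rfl | hq
    · simp
    · exact iff_of_false (hm q hq).1.not_gt (hm q hq).2.not_gt
    · exact iff_of_true (hm p hp).1 (hm p hp).2
    · exact hS p hp q hq)
  obtain ⟨e', h1, h2⟩ := exists_orderIso_glue e τ m (he (m, τ m) (Finset.mem_insert_self _ _))
  refine ⟨e', fun p hp => ?_, h2⟩
  rw [h1 _ (hm p hp).1]
  exact he p (Finset.mem_insert_of_mem hp)

end ExtensionLemmas

section Words

/-- Action of a word on a point. -/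
def wordAct {Ω : Type*} [LinearOrder Ω] (e : Fin 2 → Ω ≃o Ω) : List (Fin 2 × Bool) → Ω → Ω
  | [], t => t
  | (c, true) :: L, t => e c (wordAct e L t)
  | (c, false) :: L, t => (e c).symm (wordAct e L t)

theorem lift_mk_apply {Ω : Type*} [LinearOrder Ω] (e : Fin 2 → Ω ≃o Ω) (L : List (Fin 2 × Bool))
    (t : Ω) : (FreeGroup.lift e (FreeGroup.mk L)) t = wordAct e L t := by
  induction L with
  | nil => rfl
  | cons c L ih =>
    rcases c with ⟨c, b⟩
    have : FreeGroup.mk ((c, b) :: L) = FreeGroup.mk [(c, b)] * FreeGroup.mk L := by simp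
    rw [this, map_mul, RelIso.mul_apply, ih]
    cases b
    · simp [wordAct, FreeGroup.lift_mk]; rfl
    · simp [wordAct, FreeGroup.lift_mk]

theorem wordAct_append {Ω : Type*} [LinearOrder Ω] (e : Fin 2 → Ω ≃o Ω)
    (L L' : List (Fin 2 × Bool)) (t : Ω) :
    wordAct e (L ++ L') t = wordAct e L (wordAct e L' t) := by
  induction L with
  | nil => rfl
  | cons c L ih =>
    rcases c with ⟨c, b⟩
    cases b <;> simp [wordAct, ih]

theorem exists_last_false (L : List (Fin 2 × Bool)) (h : ∃ x, (x, false) ∈ L) :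
    ∃ U x V, L = U ++ (x, false) :: V ∧ ∀ c ∈ V, c.2 = true := by
  induction L with
  | nil => simp at h
  | cons c L ih =>
    by_cases h' : ∃ x, (x, false) ∈ L
    · obtain ⟨U, x, V, rfl, hV⟩ := ih h'
      exact ⟨c :: U, x, V, rfl, hV⟩
    · obtain ⟨x, hx⟩ := h
      rcases List.mem_cons.1 hx with rfl | hx
      · refine ⟨[], x, L, rfl, ?_⟩
        rintro ⟨d, b⟩ hd
        cases b
        · exact absurd ⟨d, hd⟩ h'
        · rfl
      · exact absurd ⟨x, hx⟩ h'

/-- The descending phase. -/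
theorem exists_descending (x : Fin 2) (r : ℚ) (U : List (Fin 2 × Bool))
    (hU : FreeGroup.IsReduced (U ++ [(x, false)])) :
    ∃ S : Fin 2 → Finset (ℚ × ℚ),
      (∀ d, ∀ p ∈ S d, ∀ q ∈ S d, (p.1 < q.1 ↔ p.2 < q.2)) ∧
      (∀ d, ∀ p ∈ S d, r - U.length ≤ p.1 ∧ p.1 ≤ r ∧ r - U.length ≤ p.2 ∧ p.2 ≤ r) ∧
      (∀ p ∈ S x, p.1 < r) ∧
      (∀ d, ∀ p ∈ S d, (p.1 = r - U.length → (U ++ [(x, false)]).head? = some (d, false)) ∧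
        (p.2 = r - U.length → (U ++ [(x, false)]).head? = some (d, true))) ∧
      (∀ e : Fin 2 → ℚ ≃o ℚ, (∀ d, ∀ p ∈ S d, e d p.1 = p.2) →
        wordAct e U r = r - U.length) := by
  classical
  induction U with
  | nil =>
    refine ⟨fun _ => ∅, ?_⟩
    simp [wordAct]
  | cons c U ih =>
    have hred : FreeGroup.IsReduced (U ++ [(x, false)]) :=
      hU.infix ⟨[c], [], by simp⟩
    have hhead : ∀ c', (U ++ [(x, false)]).head? = some c' → (c.1 = c'.1 → c.2 = c'.2) := by
      intro c' hc'
      rw [List.cons_append] at hU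
      rcases hL : U ++ [(x, false)] with _ | ⟨c'', L⟩
      · simp at hL
      · rw [hL] at hU hc'
        simp only [List.head?_cons, Option.some.injEq] at hc'
        subst hc'
        exact (FreeGroup.isReduced_cons_cons.1 hU).1
    obtain ⟨S, h1, h2, h3, h4, h5⟩ := ih hred
    have hn : (0 : ℚ) ≤ U.length := by positivity
    set n : ℚ := (U.length : ℚ) with hndef
    rcases c with ⟨d, b⟩
    have hx : ∀ b', d = x → b = !b' → b' = false → (0 : ℚ) < n := by
      intro b' hd hb hb'
      subst hb' hb hd
      rcases U with _ | ⟨c', U⟩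
      · exact absurd (hhead (d, false) rfl rfl) (by simp)
      · rw [hndef]; simp; positivity
    cases b with
    | true =>
      have key : ∀ p ∈ S d, r - n < p.1 ∧ r - n - 1 < p.2 := by
        intro p hp
        obtain ⟨k1, k2, k3, k4⟩ := h2 d p hp
        refine ⟨lt_of_le_of_ne k1 fun h => ?_, by linarith⟩
        have := hhead _ ((h4 d p hp).1 h.symm) rfl
        simp at this
      refine ⟨Function.update S d (insert (r - n, r - n - 1) (S d)), ?_, ?_, ?_, ?_, ?_⟩
      · intro d'
        by_cases hd : d' = d
        · subst hd
          simp only [Function.update_self]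
          intro p hp q hq
          rcases Finset.mem_insert.1 hp with rfl | hp <;>
            rcases Finset.mem_insert.1 hq with rfl | hq
          · simp
          · exact iff_of_true (key q hq).1 (key q hq).2
          · exact iff_of_false (key p hp).1.not_gt (key p hp).2.not_gt
          · exact h1 _ p hp q hq
        · rw [Function.update_of_ne hd]; exact h1 d'
      · intro d' p hp
        push_cast [List.length_cons]
        by_cases hd : d' = d
        · subst hd
          simp only [Function.update_self] at hp
          rcases Finset.mem_insert.1 hp with rfl | hp
          · refine ⟨?_, ?_, ?_, ?_⟩ <;> simp only <;> linarith
          · obtain ⟨k1, k2, k3, k4⟩ := h2 _ p hp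
            refine ⟨?_, ?_, ?_, ?_⟩ <;> linarith
        · rw [Function.update_of_ne hd] at hp
          obtain ⟨k1, k2, k3, k4⟩ := h2 _ p hp
          refine ⟨?_, ?_, ?_, ?_⟩ <;> linarith
      · intro p hp
        by_cases hd : x = d
        · subst hd
          simp only [Function.update_self] at hp
          rcases Finset.mem_insert.1 hp with rfl | hp
          · have := hx false rfl rfl rfl
            simp only; linarith
          · exact h3 p hp
        · rw [Function.update_of_ne hd] at hp
          exact h3 p hp
      · intro d' p hp
        push_cast [List.length_cons]
        by_cases hd : d' = d
        · subst hd
          simp only [Function.update_self] at hp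
          rcases Finset.mem_insert.1 hp with rfl | hp
          · refine ⟨fun h => ?_, fun h => rfl⟩
            simp only at h; linarith
          · obtain ⟨k1, k2, k3, k4⟩ := h2 _ p hp
            refine ⟨fun h => ?_, fun h => ?_⟩ <;> linarith
        · rw [Function.update_of_ne hd] at hp
          obtain ⟨k1, k2, k3, k4⟩ := h2 _ p hp
          refine ⟨fun h => ?_, fun h => ?_⟩ <;> linarith
      · intro e he
        have h6 : wordAct e U r = r - n := by
          apply h5 e
          intro d' p hp
          apply he d' p
          by_cases hd : d' = d
          · subst hd
            simp only [Function.update_self]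
            exact Finset.mem_insert_of_mem hp
          · rwa [Function.update_of_ne hd]
        have h7 : e d (r - n) = r - n - 1 :=
          he d (r - n, r - n - 1) (by simp [Function.update_self])
        simp only [wordAct, h6, h7]
        push_cast [List.length_cons]
        ring
    | false =>
      have key : ∀ p ∈ S d, r - n - 1 < p.1 ∧ r - n < p.2 := by
        intro p hp
        obtain ⟨k1, k2, k3, k4⟩ := h2 d p hp
        refine ⟨by linarith, lt_of_le_of_ne k3 fun h => ?_⟩
        have := hhead _ ((h4 d p hp).2 h.symm) rfl
        simp at this
      refine ⟨Function.update S d (insert (r - n - 1, r - n) (S d)), ?_, ?_, ?_, ?_, ?_⟩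
      · intro d'
        by_cases hd : d' = d
        · subst hd
          simp only [Function.update_self]
          intro p hp q hq
          rcases Finset.mem_insert.1 hp with rfl | hp <;>
            rcases Finset.mem_insert.1 hq with rfl | hq
          · simp
          · exact iff_of_true (key q hq).1 (key q hq).2
          · exact iff_of_false (key p hp).1.not_gt (key p hp).2.not_gt
          · exact h1 _ p hp q hq
        · rw [Function.update_of_ne hd]; exact h1 d'
      · intro d' p hp
        push_cast [List.length_cons]
        by_cases hd : d' = d
        · subst hd
          simp only [Function.update_self] at hp
          rcases Finset.mem_insert.1 hp with rfl | hp
          · refine ⟨?_, ?_, ?_, ?_⟩ <;> simp only <;> linarith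
          · obtain ⟨k1, k2, k3, k4⟩ := h2 _ p hp
            refine ⟨?_, ?_, ?_, ?_⟩ <;> linarith
        · rw [Function.update_of_ne hd] at hp
          obtain ⟨k1, k2, k3, k4⟩ := h2 _ p hp
          refine ⟨?_, ?_, ?_, ?_⟩ <;> linarith
      · intro p hp
        by_cases hd : x = d
        · subst hd
          simp only [Function.update_self] at hp
          rcases Finset.mem_insert.1 hp with rfl | hp
          · simp only; linarith
          · exact h3 p hp
        · rw [Function.update_of_ne hd] at hp
          exact h3 p hp
      · intro d' p hp
        push_cast [List.length_cons]
        by_cases hd : d' = d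
        · subst hd
          simp only [Function.update_self] at hp
          rcases Finset.mem_insert.1 hp with rfl | hp
          · refine ⟨fun h => rfl, fun h => ?_⟩
            simp only at h; linarith
          · obtain ⟨k1, k2, k3, k4⟩ := h2 _ p hp
            refine ⟨fun h => ?_, fun h => ?_⟩ <;> linarith
        · rw [Function.update_of_ne hd] at hp
          obtain ⟨k1, k2, k3, k4⟩ := h2 _ p hp
          refine ⟨fun h => ?_, fun h => ?_⟩ <;> linarith
      · intro e he
        have h6 : wordAct e U r = r - n := by
          apply h5 e
          intro d' p hp
          apply he d' p
          by_cases hd : d' = d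
          · subst hd
            simp only [Function.update_self]
            exact Finset.mem_insert_of_mem hp
          · rwa [Function.update_of_ne hd]
        have h7 : e d (r - n - 1) = r - n :=
          he d (r - n - 1, r - n) (by simp [Function.update_self])
        simp only [wordAct, h6]
        rw [OrderIso.symm_apply_eq]
        push_cast [List.length_cons]
        rw [← sub_sub, h7]

/-- An affine contraction. -/
theorem exists_contraction (N : ℕ) :
    ∃ τ : ℚ ≃o ℚ, ∀ t, τ t = t / (4 * (N + 1)) + 1 / 2 := by
  have hN : (0 : ℚ) < 4 * (N + 1) := by positivity
  refine ⟨StrictMono.orderIsoOfSurjective (fun t : ℚ => t / (4 * (N + 1)) + 1 / 2) ?_ ?_,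
    fun t => rfl⟩
  · intro s t hst
    have := div_lt_div_of_pos_right hst hN
    simp only; linarith
  · intro y
    refine ⟨(y - 1 / 2) * (4 * (N + 1)), ?_⟩
    simp only
    field_simp
    ring

/-- A reduced word with a negative letter is made negative by suitable positive automorphisms. -/
theorem exists_neg_word (L : List (Fin 2 × Bool)) (hL : FreeGroup.IsReduced L)
    (h : ∃ x, (x, false) ∈ L) :
    ∃ e : Fin 2 → ℚ ≃o ℚ, (∀ c, 0 < e c 0) ∧ wordAct e L 0 < 0 := by
  classical
  obtain ⟨U, x, V, rfl, hV⟩ := exists_last_false L h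
  obtain ⟨τ', hτ'⟩ := exists_contraction V.length
  let e0 : Fin 2 → ℚ ≃o ℚ := fun c => if c = x then OrderIso.addRight 1 else τ'
  have e0x : ∀ t, e0 x t = t + 1 := fun t => by simp [e0]
  have e0d : ∀ d, d ≠ x → ∀ t, e0 d t = t / (4 * (V.length + 1)) + 1 / 2 := fun d hd t => by
    simp [e0, hd, hτ']
  have hNpos : (0 : ℚ) < 4 * (V.length + 1) := by positivity
  have bnd : ∀ t : ℚ, 0 ≤ t → t ≤ V.length →
      0 ≤ t / (4 * (V.length + 1)) ∧ t / (4 * (V.length + 1)) ≤ 1 / 4 := by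
    intro t h0 h1
    refine ⟨by positivity, ?_⟩
    rw [div_le_iff₀ hNpos]
    linarith
  have phase1 : ∀ V' : List (Fin 2 × Bool), (∀ c ∈ V', c.2 = true) → V'.length ≤ V.length →
      (0 ≤ wordAct e0 V' 0 ∧ wordAct e0 V' 0 ≤ V'.length) ∧
      ∀ e : Fin 2 → ℚ ≃o ℚ, (∀ c t, 0 ≤ t → e c t = e0 c t) →
        wordAct e V' 0 = wordAct e0 V' 0 := by
    intro V'
    induction V' with
    | nil => intro _ _; simp [wordAct]
    | cons c V' ih =>
      intro hc hlen
      rcases c with ⟨d, b⟩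
      have hb : b = true := hc (d, b) (by simp)
      subst hb
      simp only [List.length_cons] at hlen
      obtain ⟨⟨i1, i2⟩, i3⟩ := ih (fun c hc' => hc c (List.mem_cons_of_mem _ hc')) (by omega)
      have hlen' : ((V'.length : ℚ)) + 1 ≤ V.length := by exact_mod_cast hlen
      refine ⟨?_, ?_⟩
      · push_cast [List.length_cons]
        simp only [wordAct]
        by_cases hd : d = x
        · subst hd
          rw [e0x]
          constructor <;> linarith
        · rw [e0d d hd]
          have := bnd _ i1 (by linarith)
          have h0 : (0 : ℚ) ≤ V'.length := by positivity
          constructor <;> linarith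
      · intro e he
        simp only [wordAct]
        rw [i3 e he, he _ _ i1]
  obtain ⟨⟨v1, v2⟩, v3⟩ := phase1 V hV le_rfl
  set y := wordAct e0 V 0 with hy
  have hy1 : y < 1 := by
    rcases V with _ | ⟨⟨d, b⟩, V'⟩
    · simp [hy, wordAct]
    · have hb : b = true := hV (d, b) (by simp)
      subst hb
      have hd : d ≠ x := by
        rintro rfl
        have h1 : FreeGroup.IsReduced ((d, false) :: (d, true) :: V') :=
          hL.infix ⟨U, [], by simp⟩
        have := (FreeGroup.isReduced_cons_cons.1 h1).1 rfl
        simp at this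
      obtain ⟨⟨w1, w2⟩, -⟩ := phase1 V' (fun c hc' => hV c (List.mem_cons_of_mem _ hc'))
        (by simp)
      rw [hy]
      simp only [wordAct]
      rw [e0d d hd]
      have := bnd _ w1 (by push_cast [List.length_cons]; linarith)
      linarith
  set r := y - 1 with hr
  have hUred : FreeGroup.IsReduced (U ++ [(x, false)]) := hL.infix ⟨[], V, by simp⟩
  obtain ⟨S, h1, h2, h3, -, h5⟩ := exists_descending x r U hUred
  have hex : ∀ c, ∃ e : ℚ ≃o ℚ, (∀ p ∈ S c, e p.1 = p.2) ∧
      ∀ t, (if c = x then r else 0) ≤ t → e t = e0 c t := by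
    intro c
    refine exists_orderIso_extend (S c) (h1 c) _ (e0 c) ?_
    intro p hp
    obtain ⟨k1, k2, k3, k4⟩ := h2 c p hp
    by_cases hc : c = x
    · subst hc
      rw [if_pos rfl, e0x]
      exact ⟨h3 p hp, by linarith⟩
    · rw [if_neg hc, e0d c hc]
      exact ⟨by linarith, by rw [zero_div]; linarith⟩
  choose e he1 he2 using hex
  have he0 : ∀ c t, 0 ≤ t → e c t = e0 c t := by
    intro c t ht
    apply he2
    split_ifs
    · linarith
    · exact ht
  refine ⟨e, ?_, ?_⟩
  · intro c
    rw [he0 c 0 le_rfl]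
    by_cases hc : c = x
    · subst hc; rw [e0x]; norm_num
    · rw [e0d c hc]; norm_num
  · rw [wordAct_append]
    simp only [wordAct]
    rw [v3 e he0]
    have : (e x).symm y = r := by
      rw [OrderIso.symm_apply_eq, he2 x r (by simp), e0x]
      rw [hr]; ring
    rw [this, h5 e he1]
    have : (0 : ℚ) ≤ U.length := by positivity
    linarith

end Words

section Perturbation

/-- The order induced by an action at a point, ties being broken by an old order. -/
noncomputable def inducedCone {G Ω : Type*} [Group G] [LinearOrder Ω] (ρ : G →* (Ω ≃o Ω)) (p : Ω)
    (P : G → Bool) : G → Bool :=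
  fun g => decide (p < ρ g p) || (decide (ρ g p = p) && P g)

theorem inducedCone_iff {G Ω : Type*} [Group G] [LinearOrder Ω] (ρ : G →* (Ω ≃o Ω)) (p : Ω)
    (P : G → Bool) (g : G) :
    inducedCone ρ p P g = true ↔ p < ρ g p ∨ (ρ g p = p ∧ P g = true) := by
  simp [inducedCone]

theorem inducedCone_isCone {G Ω : Type*} [Group G] [LinearOrder Ω] (ρ : G →* (Ω ≃o Ω)) (p : Ω)
    (P : G → Bool) (hP : IsLeftOrderCone P) : IsLeftOrderCone (inducedCone ρ p P) := by
  obtain ⟨h1, h2, h3⟩ := hP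
  refine ⟨?_, ?_, ?_⟩
  · intro a b ha hb
    rw [inducedCone_iff] at *
    rw [map_mul, RelIso.mul_apply]
    rcases ha with ha | ⟨ha, ha'⟩ <;> rcases hb with hb | ⟨hb, hb'⟩
    · exact Or.inl (ha.trans ((ρ a).strictMono hb))
    · rw [hb]; exact Or.inl ha
    · left
      have := (ρ a).strictMono hb
      rwa [ha] at this
    · rw [hb]; exact Or.inr ⟨ha, h1 a b ha' hb'⟩
  · rw [Bool.eq_false_iff]
    intro h
    rw [inducedCone_iff] at h
    simp [h2] at h
  · intro g hg
    have hinv : ∀ x y, ρ g⁻¹ x = y ↔ x = ρ g y := by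
      intro x y
      rw [map_inv]
      exact (ρ g).symm_apply_eq
    have hlt : p < ρ g⁻¹ p ↔ ρ g p < p := by
      rw [map_inv]
      exact (ρ g).lt_symm_apply
    rw [inducedCone_iff, ← Bool.not_eq_true, inducedCone_iff, hlt, hinv, h3 g hg,
      ← Bool.not_eq_true]
    rcases lt_trichotomy p (ρ g p) with h | h | h
    · simp [h, h.not_gt, h.ne]
    · rw [← h]; simp
    · simp [h, h.not_gt, h.ne, h.ne']

theorem exists_cone_embedding (P : FreeGroup (Fin 2) → Bool) (hP : IsLeftOrderCone P) :
    ∃ φ : FreeGroup (Fin 2) → ℚ, ∀ x y, φ x < φ y ↔ P (x⁻¹ * y) = true := by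
  classical
  obtain ⟨h1, h2, h3⟩ := hP
  let lo : LinearOrder (FreeGroup (Fin 2)) :=
    { le := fun x y => x = y ∨ P (x⁻¹ * y) = true
      lt := fun x y => P (x⁻¹ * y) = true
      le_refl := fun x => Or.inl rfl
      le_trans := by
        rintro x y z (rfl | h) (rfl | h')
        · exact Or.inl rfl
        · exact Or.inr h'
        · exact Or.inr h
        · right
          have := h1 _ _ h h'
          simpa [mul_assoc] using this
      lt_iff_le_not_ge := by
        intro x y
        constructor
        · intro h
          refine ⟨Or.inr h, ?_⟩
          rintro (rfl | h')
          · simp [h2] at h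
          · have := h1 _ _ h h'
            simp [mul_assoc, h2] at this
        · rintro ⟨rfl | h, h'⟩
          · exact absurd (Or.inl rfl) h'
          · exact h
      le_antisymm := by
        rintro x y (rfl | h) (h' | h')
        · rfl
        · rfl
        · exact h'.symm
        · have := h1 _ _ h h'
          simp [mul_assoc, h2] at this
      le_total := by
        intro x y
        by_cases hxy : x = y
        · exact Or.inl (Or.inl hxy)
        · have hne : x⁻¹ * y ≠ 1 := fun h => hxy (inv_mul_eq_one.1 h)
          have := h3 _ hne
          rw [mul_inv_rev, inv_inv] at this
          cases h : P (y⁻¹ * x)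
          · exact Or.inl (Or.inr (this.2 h))
          · exact Or.inr (Or.inr rfl)
      toDecidableLE := Classical.decRel _ }
  obtain ⟨φ⟩ := @Order.embedding_from_countable_to_dense (FreeGroup (Fin 2)) ℚ lo _ _ _ _
  exact ⟨φ, fun x y => φ.lt_iff_lt⟩

theorem wordAct_intertwine {Ω Ω' : Type*} [LinearOrder Ω] [LinearOrder Ω'] (σ : Fin 2 → Ω ≃o Ω)
    (e : Fin 2 → Ω' ≃o Ω') (ψ : Ω' → Ω) (h : ∀ c t, σ c (ψ t) = ψ (e c t))
    (L : List (Fin 2 × Bool)) (t : Ω') : wordAct σ L (ψ t) = ψ (wordAct e L t) := by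
  induction L with
  | nil => rfl
  | cons c L ih =>
    rcases c with ⟨c, b⟩
    cases b
    · simp only [wordAct, ih]
      rw [OrderIso.symm_apply_eq, h, OrderIso.apply_symm_apply]
    · simp only [wordAct, ih, h]

/-- Shift of the blocks of `ℚ ×ₗ ℚ`. -/
theorem exists_shift : ∃ τ : (ℚ ×ₗ ℚ) ≃o (ℚ ×ₗ ℚ),
    ∀ i t, τ (toLex (i, t)) = toLex (i + 1, t) := by
  let F : (ℚ ×ₗ ℚ) → (ℚ ×ₗ ℚ) := fun z => toLex ((ofLex z).1 + 1, (ofLex z).2)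
  have hF : StrictMono F := by
    intro x y hxy
    rw [Prod.Lex.lt_iff] at hxy ⊢
    simpa [F] using hxy
  refine ⟨hF.orderIsoOfSurjective F ?_, fun i t => rfl⟩
  intro y
  exact ⟨toLex ((ofLex y).1 - 1, (ofLex y).2), by simp [F]⟩

/-- A family of automorphisms of the blocks of `ℚ ×ₗ ℚ`. -/
theorem exists_blockwise (e : ℚ → (ℚ ≃o ℚ)) : ∃ τ : (ℚ ×ₗ ℚ) ≃o (ℚ ×ₗ ℚ),
    ∀ i t, τ (toLex (i, t)) = toLex (i, e i t) := by
  let F : (ℚ ×ₗ ℚ) → (ℚ ×ₗ ℚ) := fun z => toLex ((ofLex z).1, e (ofLex z).1 (ofLex z).2)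
  have hF : StrictMono F := by
    intro x y hxy
    rw [Prod.Lex.lt_iff] at hxy ⊢
    rcases hxy with h | ⟨h, h'⟩
    · exact Or.inl h
    · refine Or.inr ⟨h, ?_⟩
      simp only [F, ofLex_toLex, h]
      exact (e _).strictMono h'
  refine ⟨hF.orderIsoOfSurjective F ?_, fun i t => rfl⟩
  intro y
  exact ⟨toLex ((ofLex y).1, (e (ofLex y).1).symm (ofLex y).2), by simp [F]⟩

theorem exists_perturbation (w : FreeGroup (Fin 2)) (hneg : ∃ x, (x, false) ∈ w.toWord)
    (P : FreeGroup (Fin 2) → Bool) (hP : IsLeftOrderCone P) (S : Finset (FreeGroup (Fin 2))) :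
    ∃ P' : FreeGroup (Fin 2) → Bool, IsLeftOrderCone P' ∧ (∀ s ∈ S, P' s = P s) ∧
      ¬ IsWOrder w P' := by
  classical
  obtain ⟨e, he0, heneg⟩ := exists_neg_word w.toWord FreeGroup.isReduced_toWord hneg
  obtain ⟨φ₀, hφ₀⟩ := exists_cone_embedding P hP
  have hinj : ∀ x y, φ₀ x = φ₀ y → x = y := by
    intro x y hxy
    by_contra hne
    have hne' : x⁻¹ * y ≠ 1 := fun h => hne (inv_mul_eq_one.1 h)
    have h1 := hP.2.2 _ hne'
    rw [mul_inv_rev, inv_inv] at h1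
    have h2 := (hφ₀ x y).not.1 hxy.not_lt
    have h3 := (hφ₀ y x).not.1 hxy.not_gt
    exact h2 (h1.2 (by simpa using h3))
  have hmul : ∀ g x y, φ₀ (g * x) < φ₀ (g * y) ↔ φ₀ x < φ₀ y := by
    intro g x y
    rw [hφ₀, hφ₀]
    have : (g * x)⁻¹ * (g * y) = x⁻¹ * y := by group
    rw [this]
  let φ : FreeGroup (Fin 2) → ℚ ×ₗ ℚ := fun x => toLex (φ₀ x, 0)
  have hφ : ∀ x y, φ x < φ y ↔ φ₀ x < φ₀ y := by
    intro x y
    simp [φ, Prod.Lex.toLex_lt_toLex]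
  let T : Finset (FreeGroup (Fin 2)) :=
    insert 1 (S.biUnion fun s => (s.toWord.tails.map FreeGroup.mk).toFinset)
  have hT : ∀ s ∈ S, ∀ L, L <:+ s.toWord → FreeGroup.mk L ∈ T := by
    intro s hs L hL
    refine Finset.mem_insert_of_mem (Finset.mem_biUnion.2 ⟨s, hs, ?_⟩)
    simp only [List.mem_toFinset, List.mem_map, List.mem_tails]
    exact ⟨L, hL, rfl⟩
  have hT' : ∀ s ∈ T, ∃ L₀ : List (Fin 2 × Bool), FreeGroup.mk L₀ = s ∧
      ∀ L, L <:+ L₀ → FreeGroup.mk L ∈ T := by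
    intro s hs
    rcases Finset.mem_insert.1 hs with rfl | hs
    · refine ⟨[], rfl, ?_⟩
      intro L hL
      rw [List.suffix_nil.1 hL]
      exact Finset.mem_insert_self _ _
    · obtain ⟨s', hs', h⟩ := Finset.mem_biUnion.1 hs
      simp only [List.mem_toFinset, List.mem_map, List.mem_tails] at h
      obtain ⟨L₀, hL₀, rfl⟩ := h
      exact ⟨L₀, rfl, fun L hL => hT s' hs' L (hL.trans hL₀)⟩
  obtain ⟨v, hvT, hvmax⟩ := Finset.exists_max_image T φ₀ ⟨1, Finset.mem_insert_self _ _⟩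
  have hα : ∃ α : FreeGroup (Fin 2), (α = FreeGroup.of 0 ∨ α = (FreeGroup.of 0)⁻¹) ∧
      φ₀ v < φ₀ (α * v) := by
    have hne : v⁻¹ * (FreeGroup.of 0 * v) ≠ 1 := by
      intro h
      have h2 := inv_mul_eq_one.1 h
      exact FreeGroup.of_ne_one (0 : Fin 2) (right_eq_mul.1 h2)
    have h1 := hP.2.2 _ hne
    cases h : P (v⁻¹ * (FreeGroup.of 0 * v))
    · refine ⟨_, Or.inr rfl, ?_⟩
      rw [hφ₀]
      rw [h] at h1
      have h2 : (v⁻¹ * (FreeGroup.of 0 * v))⁻¹ = v⁻¹ * ((FreeGroup.of 0)⁻¹ * v) := by group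
      rw [h2] at h1
      simpa using h1
    · exact ⟨_, Or.inl rfl, (hφ₀ _ _).2 h⟩
  obtain ⟨α, hαeq, hαv⟩ := hα
  have hαvT : α * v ∉ T := fun h => (hvmax _ h).not_gt hαv
  set m := φ₀ v with hm
  let β : FreeGroup (Fin 2) := FreeGroup.of 1
  have hpairs : ∀ g : FreeGroup (Fin 2), ∀ p ∈ (T.filter fun x => g * x ∈ T).image
      (fun x => (φ x, φ (g * x))), ∀ q ∈ (T.filter fun x => g * x ∈ T).image
      (fun x => (φ x, φ (g * x))), (p.1 < q.1 ↔ p.2 < q.2) := by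
    intro g p hp q hq
    obtain ⟨x, -, rfl⟩ := Finset.mem_image.1 hp
    obtain ⟨y, -, rfl⟩ := Finset.mem_image.1 hq
    simp only [hφ, hmul]
  have hcount : Countable (ℚ ×ₗ ℚ) := inferInstanceAs (Countable (ℚ × ℚ))
  obtain ⟨τA, hτA⟩ := exists_shift
  obtain ⟨τB, hτB⟩ := exists_blockwise
    (fun i => if i = m + 2 then e 0 else if i = m + 3 then e 1 else OrderIso.refl ℚ)
  obtain ⟨A, hA1, hA2⟩ := exists_orderIso_extend _ (hpairs α) (toLex (m, 0)) τA (by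
    intro p hp
    obtain ⟨x, hx, rfl⟩ := Finset.mem_image.1 hp
    obtain ⟨hx1, hx2⟩ := Finset.mem_filter.1 hx
    rw [hτA]
    simp only [φ, Prod.Lex.toLex_lt_toLex]
    refine ⟨Or.inl (lt_of_le_of_ne (hvmax x hx1) fun h => ?_), Or.inl ?_⟩
    · rw [hinj _ _ h] at hx2
      exact hαvT hx2
    · have := hvmax _ hx2
      linarith)
  obtain ⟨B, hB1, hB2⟩ := exists_orderIso_extend _ (hpairs β) (toLex (m + 1, 0)) τB (by
    intro p hp
    obtain ⟨x, hx, rfl⟩ := Finset.mem_image.1 hp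
    obtain ⟨hx1, hx2⟩ := Finset.mem_filter.1 hx
    rw [hτB]
    simp only [φ, Prod.Lex.toLex_lt_toLex]
    have k1 := hvmax _ hx1
    have k2 := hvmax _ hx2
    exact ⟨Or.inl (by linarith), Or.inl (by linarith)⟩)
  have hA : ∀ i t, m < i → A (toLex (i, t)) = toLex (i + 1, t) := by
    intro i t hi
    rw [hA2, hτA]
    rw [Prod.Lex.toLex_le_toLex]
    exact Or.inl hi
  have hAv : A (φ v) = toLex (m + 1, 0) := by
    rw [hA2, hτA]
    exact le_rfl
  have hB : ∀ i t, m + 1 < i → B (toLex (i, t)) = τB (toLex (i, t)) := by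
    intro i t hi
    rw [hB2]
    rw [Prod.Lex.toLex_le_toLex]
    exact Or.inl hi
  have hBf : ∀ t, B (toLex (m + 2, t)) = toLex (m + 2, e 0 t) := by
    intro t
    rw [hB _ _ (by linarith), hτB, if_pos rfl]
  have hBg : ∀ t, B (toLex (m + 3, t)) = toLex (m + 3, e 1 t) := by
    intro t
    rw [hB _ _ (by linarith), hτB, if_neg (by intro h; linarith), if_pos rfl]
  have hAT : ∀ x ∈ T, α * x ∈ T → A (φ x) = φ (α * x) := by
    intro x hx hx'
    exact hA1 (φ x, φ (α * x)) (Finset.mem_image.2 ⟨x, Finset.mem_filter.2 ⟨hx, hx'⟩, rfl⟩)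
  have hBT : ∀ x ∈ T, β * x ∈ T → B (φ x) = φ (β * x) := by
    intro x hx hx'
    exact hB1 (φ x, φ (β * x)) (Finset.mem_image.2 ⟨x, Finset.mem_filter.2 ⟨hx, hx'⟩, rfl⟩)
  -- the perturbed action
  have hρ : ∃ σ : Fin 2 → (ℚ ×ₗ ℚ) ≃o (ℚ ×ₗ ℚ),
      FreeGroup.lift σ α = A ∧ FreeGroup.lift σ β = B ∧
      ∀ c, ∀ x ∈ T, FreeGroup.of c * x ∈ T → σ c (φ x) = φ (FreeGroup.of c * x) := by
    rcases hαeq with h | h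
    · refine ⟨![A, B], by simp [h], by simp [β], ?_⟩
      intro c
      fin_cases c
      · simpa [h] using hAT
      · simpa [β] using hBT
    · refine ⟨![A⁻¹, B], by simp [h], by simp [β], ?_⟩
      intro c
      fin_cases c
      · intro x hx hx'
        have h1 := hAT _ hx' (by simpa [h] using hx)
        change A.symm (φ x) = _
        rw [OrderIso.symm_apply_eq]
        rw [h] at h1
        simpa using h1.symm
      · simpa [β] using hBT
  obtain ⟨σ, hσα, hσβ, hσT⟩ := hρ
  set ρ := FreeGroup.lift σ with hρdef
  have hword : ∀ L : List (Fin 2 × Bool), (∀ L', L' <:+ L → FreeGroup.mk L' ∈ T) →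
      wordAct σ L (φ 1) = φ (FreeGroup.mk L) := by
    intro L
    induction L with
    | nil => intro _; rfl
    | cons c L ih =>
      intro hL
      have h1 := ih fun L' hL' => hL L' (hL'.trans (List.suffix_cons _ _))
      have h2 := hL _ List.suffix_rfl
      have h3 := hL L (List.suffix_cons _ _)
      rcases c with ⟨c, b⟩
      have h4 : FreeGroup.mk ((c, b) :: L) = FreeGroup.mk [(c, b)] * FreeGroup.mk L := by simp
      cases b
      · have h5 : FreeGroup.of c * FreeGroup.mk ((c, false) :: L) = FreeGroup.mk L := by
          rw [h4, ← mul_assoc]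
          have : FreeGroup.mk [(c, false)] = (FreeGroup.of c)⁻¹ := by
            simp [FreeGroup.of, FreeGroup.inv_mk, FreeGroup.invRev]
          rw [this]; simp
        simp only [wordAct, h1]
        rw [OrderIso.symm_apply_eq, hσT c _ h2 (by rwa [h5]), h5]
      · simp only [wordAct, h1]
        have h5 : FreeGroup.mk ((c, true) :: L) = FreeGroup.of c * FreeGroup.mk L := h4
        rw [h5] at h2 ⊢
        exact hσT c _ h3 h2
  have hρT : ∀ s ∈ T, ρ s (φ 1) = φ s := by
    intro s hs
    obtain ⟨L, rfl, hL⟩ := hT' s hs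
    rw [hρdef, lift_mk_apply, hword L hL]
  -- the two elements
  let h : FreeGroup (Fin 2) := α * v
  have hh : ρ h (φ 1) = toLex (m + 1, 0) := by
    simp only [h, map_mul, RelIso.mul_apply]
    rw [hρT v hvT, hσα, hAv]
  let fg : Fin 2 → FreeGroup (Fin 2) :=
    ![h⁻¹ * (α⁻¹ * (β * (α * h))), h⁻¹ * (α⁻¹ * (α⁻¹ * (β * (α * (α * h)))))]
  let ψ : ℚ → ℚ ×ₗ ℚ := fun t => (ρ h).symm (toLex (m + 1, t))
  have hψ : ∀ s t, ψ s < ψ t ↔ s < t := by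
    intro s t
    simp [ψ, Prod.Lex.toLex_lt_toLex]
  have hψ0 : ψ 0 = φ 1 := by
    simp only [ψ]
    rw [OrderIso.symm_apply_eq, hh]
  have hinvap : ∀ g x, ρ g⁻¹ x = (ρ g).symm x := by
    intro g x
    rw [map_inv]; rfl
  have hstep : ∀ c t, ρ (fg c) (ψ t) = ψ (e c t) := by
    intro c t
    have k1 : ∀ s, A (toLex (m + 1, s)) = toLex (m + 2, s) := by
      intro s
      rw [hA _ _ (by linarith)]
      congr 2; ring
    have k2 : ∀ s, A (toLex (m + 2, s)) = toLex (m + 3, s) := by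
      intro s
      rw [hA _ _ (by linarith)]
      congr 2; ring
    have k3 : ∀ s, A.symm (toLex (m + 2, s)) = toLex (m + 1, s) := by
      intro s; rw [OrderIso.symm_apply_eq, k1]
    have k4 : ∀ s, A.symm (toLex (m + 3, s)) = toLex (m + 2, s) := by
      intro s; rw [OrderIso.symm_apply_eq, k2]
    fin_cases c
    · change ρ (h⁻¹ * (α⁻¹ * (β * (α * h)))) (ψ t) = ψ (e 0 t)
      rw [map_mul, map_mul _ α⁻¹, map_mul _ β, map_mul _ α]
      simp only [RelIso.mul_apply, hinvap, hσα, hσβ, ψ, OrderIso.apply_symm_apply]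
      rw [k1, hBf, k3]
    · change ρ (h⁻¹ * (α⁻¹ * (α⁻¹ * (β * (α * (α * h)))))) (ψ t) = ψ (e 1 t)
      rw [map_mul, map_mul _ α⁻¹, map_mul _ α⁻¹, map_mul _ β, map_mul _ α, map_mul _ α]
      simp only [RelIso.mul_apply, hinvap, hσα, hσβ, ψ, OrderIso.apply_symm_apply]
      rw [k1, k2, hBg, k4, k3]
  refine ⟨inducedCone ρ (φ 1) P, inducedCone_isCone _ _ _ hP, ?_, ?_⟩
  · intro s hs
    have hsT : s ∈ T := by
      have := hT s hs s.toWord List.suffix_rfl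
      rwa [FreeGroup.mk_toWord] at this
    rw [Bool.eq_iff_iff, inducedCone_iff, hρT s hsT, hφ, hφ₀]
    simp only [inv_one, one_mul]
    constructor
    · rintro (h' | ⟨-, h'⟩) <;> exact h'
    · exact Or.inl
  · intro hW
    have hpos : ∀ c, inducedCone ρ (φ 1) P (fg c) = true := by
      intro c
      rw [inducedCone_iff]
      left
      rw [← hψ0, hstep, hψ]
      exact he0 c
    have := hW (fg 0) (fg 1) (hpos 0) (hpos 1)
    have hfg : ![fg 0, fg 1] = fg := by
      ext c; fin_cases c <;> rfl
    rw [hfg, inducedCone_iff] at this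
    have hcomp : ρ (FreeGroup.lift fg w) = FreeGroup.lift (fun c => ρ (fg c)) w := by
      have : ρ.comp (FreeGroup.lift fg) = FreeGroup.lift (fun c => ρ (fg c)) := by
        ext c; simp
      rw [← this]; rfl
    have hval : ρ (FreeGroup.lift fg w) (φ 1) < φ 1 := by
      rw [hcomp, ← hψ0]
      conv_lhs => rw [← FreeGroup.mk_toWord (x := w)]
      rw [lift_mk_apply, wordAct_intertwine _ e ψ hstep, hψ]
      exact heneg
    rcases this with h' | ⟨h', -⟩
    · exact h'.not_gt hval
    · exact hval.ne h'

end Perturbation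

/-- For every nonempty reduced word `W` in two letters carrying both positive and
negative exponents, the set of `W`-orders on `F₂` is closed with empty interior in the
space of left-orders of `F₂`. -/
theorem wOrders_closed_empty_interior
    (w : FreeGroup (Fin 2)) (hw : w ≠ 1) (hsigns : HasBothSigns w) :
    IsClosed {P : LOF2 | IsWOrder w P.1} ∧
    interior {P : LOF2 | IsWOrder w P.1} = ∅ := by
  have hcont : Continuous (fun P : LOF2 => P.1) := continuous_subtype_val
  have hev : ∀ g, Continuous (fun P : LOF2 => P.1 g) := fun g => (continuous_apply g).comp hcont
  constructor
  · have hc : ∀ g b, IsClopen {P : LOF2 | P.1 g = b} := fun g b =>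
      (isClopen_discrete {b}).preimage (hev g)
    simp only [IsWOrder, Set.setOf_forall]
    refine isClosed_iInter fun f => isClosed_iInter fun g => ?_
    simp only [imp_iff_not_or, Set.setOf_or]
    exact (hc f true).compl.isClosed.union ((hc g true).compl.isClosed.union (hc _ true).isClosed)
  · rw [Set.eq_empty_iff_forall_notMem]
    intro P hP
    rw [mem_interior] at hP
    obtain ⟨U, hU, hUo, hPU⟩ := hP
    obtain ⟨V, hV, rfl⟩ := isOpen_induced_iff.1 hUo
    obtain ⟨I, u, hu, hIu⟩ := isOpen_pi_iff.1 hV P.1 hPU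
    obtain ⟨P', hP', hagree, hnot⟩ := exists_perturbation w hsigns.2 P.1 P.2 I
    refine hnot (hU (a := ⟨P', hP'⟩) (hIu ?_))
    intro g hg
    change P' g ∈ u g
    rw [hagree g hg]
    exact (hu g hg).2
end

section
/- Let Γ be a group of orientation-preserving homeomorphisms of the real line. Assume that for every k ≥ 1 there exist f, g ∈ Γ and real numbers p₁ < q₁ < p₂ < q₂ < … < p_{2k+1} < q_{2k+1} such that: g(p_i) = p_i and f(q_i) = q_i for all i ∈ {1,…,2k+1}; every fixed point of f in [p₁, q_{2k+1}] and every fixed point of g in [p₁, q_{2k+1}] is topologically transversal; and f and g have no common fixed point in [p₁, q_{2k+1}]. Then Γ satisfies no nontrivial law. -/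
theorem aux_fix_pow (f : ℝ ≃o ℝ) (u : ℝ) (h : f u = u) (n : ℕ) : (f ^ n) u = u := by
  induction n with
  | zero => rfl
  | succ n ih => rw [pow_succ', RelIso.mul_apply, ih, h]

theorem aux_fix_inv (f : ℝ ≃o ℝ) (u : ℝ) : f⁻¹ u = u ↔ f u = u := by
  constructor
  · intro h
    have h2 : f (f⁻¹ u) = u := by
      rw [← RelIso.mul_apply, mul_inv_cancel]; rfl
    rw [h] at h2
    exact h2
  · intro h
    have h2 : f⁻¹ (f u) = u := by
      rw [← RelIso.mul_apply, inv_mul_cancel]; rfl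
    rw [h] at h2
    exact h2

theorem aux_fix_zpow (f : ℝ ≃o ℝ) (u : ℝ) (h : f u = u) (n : ℤ) : (f ^ n) u = u := by
  cases n with
  | ofNat n => simpa using aux_fix_pow f u h n
  | negSucc n =>
    rw [zpow_negSucc, aux_fix_inv]
    exact aux_fix_pow f u h _

/-- Uniform attraction of points away from the fixed set, forward iterates. -/
theorem aux_half (f : ℝ ≃o ℝ) (a b δ : ℝ) (hδ : 0 < δ) (ha : f a = a) (hb : f b = b) :
    ∃ N : ℕ, ∀ n : ℕ, N ≤ n → ∀ x ∈ Set.Icc a b,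
      (∀ u ∈ Set.Icc a b, f u = u → δ ≤ |x - u|) →
      ∃ u ∈ Set.Icc a b, f u = u ∧ |(f ^ n) x - u| < δ := by
  set K : Set ℝ := {x | x ∈ Set.Icc a b ∧ ∀ u ∈ Set.Icc a b, f u = u → δ ≤ |x - u|} with hK
  have hcl : IsClosed {x : ℝ | ∀ u ∈ Set.Icc a b, f u = u → δ ≤ |x - u|} := by
    have : {x : ℝ | ∀ u ∈ Set.Icc a b, f u = u → δ ≤ |x - u|} =
        ⋂ u ∈ {u | u ∈ Set.Icc a b ∧ f u = u}, {x : ℝ | δ ≤ |x - u|} := by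
      ext x; simp
    rw [this]
    refine isClosed_biInter fun u _ => isClosed_le continuous_const (by fun_prop)
  have hKc : IsCompact K := isCompact_Icc.inter_right hcl
  obtain ⟨c, hc, hcK⟩ := hKc.exists_forall_le' (f := fun x => |f x - x|) (a := 0)
    (by have := f.continuous; fun_prop)
    (by
      rintro x ⟨hx, hx2⟩
      rw [abs_pos, sub_ne_zero]
      intro h
      have := hx2 x hx h
      simp at this
      linarith)
  obtain ⟨N, hN⟩ := exists_nat_gt ((b - a) / c)
  rw [div_lt_iff₀ hc] at hN
  refine ⟨N, fun n hn x hx hx2 => ?_⟩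
  have hmem : ∀ j : ℕ, (f ^ j) x ∈ Set.Icc a b := by
    intro j
    constructor
    · rw [← aux_fix_pow f a ha j]; exact (f ^ j).monotone hx.1
    · rw [← aux_fix_pow f b hb j]; exact (f ^ j).monotone hx.2
  have hs : ∀ j : ℕ, (f ^ (j + 1)) x = f ((f ^ j) x) := fun j => by
    rw [pow_succ', RelIso.mul_apply]
  have hs2 : ∀ j : ℕ, (f ^ (j + 1)) x = (f ^ j) (f x) := fun j => by
    rw [pow_succ, RelIso.mul_apply]
  have hne : f x ≠ x := by
    intro h
    have := hx2 x hx h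
    simp at this
    linarith
  have h0 : (f ^ 0) x = x := rfl
  rcases lt_or_gt_of_ne hne with hlt | hgt
  · have hst : ∀ j : ℕ, (f ^ (j + 1)) x < (f ^ j) x := fun j => by
      rw [hs2]; exact (f ^ j).strictMono hlt
    have hanti : Antitone fun j : ℕ => (f ^ j) x := antitone_nat_of_succ_le fun j => (hst j).le
    have : ∃ j, j < N ∧ (f ^ j) x ∉ K := by
      by_contra! hcon
      have key : ∀ j : ℕ, j ≤ N → (f ^ j) x ≤ x - j * c := by
        intro j
        induction j with
        | zero => intro _; simp
        | succ j ih =>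
          intro hj
          have h1 := ih (by omega)
          have h2 : c ≤ |f ((f ^ j) x) - (f ^ j) x| := hcK _ (hcon j (by omega))
          rw [← hs, abs_of_neg (by linarith [hst j])] at h2
          push_cast
          linarith
      have := key N le_rfl
      have := (hmem N).1
      have := hx.2
      linarith
    obtain ⟨j, hj, hjK⟩ := this
    have : ∃ u ∈ Set.Icc a b, f u = u ∧ |(f ^ j) x - u| < δ := by
      by_contra! hcon
      exact hjK ⟨hmem j, hcon⟩
    obtain ⟨u, hu, hfu, hd⟩ := this
    refine ⟨u, hu, hfu, ?_⟩
    have hj0 : (f ^ j) x ≤ x := hanti (Nat.zero_le j)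
    have hjn : (f ^ n) x ≤ (f ^ j) x := hanti (by omega : j ≤ n)
    have hxu := hx2 u hu hfu
    have hux : u < x := by
      by_contra! h
      rw [abs_lt] at hd
      rw [abs_of_nonpos (by linarith)] at hxu
      linarith
    have hun : u ≤ (f ^ n) x := by
      rw [← aux_fix_pow f u hfu n]; exact (f ^ n).monotone hux.le
    rw [abs_lt] at hd ⊢
    constructor <;> linarith
  · have hst : ∀ j : ℕ, (f ^ j) x < (f ^ (j + 1)) x := fun j => by
      rw [hs2]; exact (f ^ j).strictMono hgt
    have hmono : Monotone fun j : ℕ => (f ^ j) x := monotone_nat_of_le_succ fun j => (hst j).le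
    have : ∃ j, j < N ∧ (f ^ j) x ∉ K := by
      by_contra! hcon
      have key : ∀ j : ℕ, j ≤ N → x + j * c ≤ (f ^ j) x := by
        intro j
        induction j with
        | zero => intro _; simp
        | succ j ih =>
          intro hj
          have h1 := ih (by omega)
          have h2 : c ≤ |f ((f ^ j) x) - (f ^ j) x| := hcK _ (hcon j (by omega))
          rw [← hs, abs_of_pos (by linarith [hst j])] at h2
          push_cast
          linarith
      have := key N le_rfl
      have := (hmem N).2
      have := hx.1
      linarith
    obtain ⟨j, hj, hjK⟩ := this
    have : ∃ u ∈ Set.Icc a b, f u = u ∧ |(f ^ j) x - u| < δ := by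
      by_contra! hcon
      exact hjK ⟨hmem j, hcon⟩
    obtain ⟨u, hu, hfu, hd⟩ := this
    refine ⟨u, hu, hfu, ?_⟩
    have hj0 : x ≤ (f ^ j) x := hmono (Nat.zero_le j)
    have hjn : (f ^ j) x ≤ (f ^ n) x := hmono (by omega : j ≤ n)
    have hxu := hx2 u hu hfu
    have hux : x < u := by
      by_contra! h
      rw [abs_lt] at hd
      rw [abs_of_nonneg (by linarith)] at hxu
      linarith
    have hun : (f ^ n) x ≤ u := by
      rw [← aux_fix_pow f u hfu n]; exact (f ^ n).monotone hux.le
    rw [abs_lt] at hd ⊢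
    constructor <;> linarith

/-- A power `N` such that all nontrivial powers of `f ^ N` attract uniformly. -/
theorem aux_full (f : ℝ ≃o ℝ) (a b δ : ℝ) (hδ : 0 < δ) (ha : f a = a) (hb : f b = b) :
    ∃ N : ℕ, ∀ n : ℤ, n ≠ 0 → ∀ x ∈ Set.Icc a b,
      (∀ u ∈ Set.Icc a b, f u = u → δ ≤ |x - u|) →
      ∃ u ∈ Set.Icc a b, f u = u ∧ |((f ^ N) ^ n) x - u| < δ := by
  obtain ⟨N₁, h₁⟩ := aux_half f a b δ hδ ha hb
  obtain ⟨N₂, h₂⟩ := aux_half f⁻¹ a b δ hδ ((aux_fix_inv _ _).2 ha) ((aux_fix_inv _ _).2 hb)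
  simp only [aux_fix_inv] at h₂
  refine ⟨max N₁ N₂, fun n hn x hx hx2 => ?_⟩
  obtain ⟨m, rfl | rfl⟩ := n.eq_nat_or_neg
  · have hm : 1 ≤ m := by
      rcases Nat.eq_zero_or_pos m with h | h
      · simp [h] at hn
      · exact h
    rw [zpow_natCast, ← pow_mul]
    exact h₁ _ (by nlinarith [le_max_left N₁ N₂]) x hx hx2
  · have hm : 1 ≤ m := by
      rcases Nat.eq_zero_or_pos m with h | h
      · simp [h] at hn
      · exact h
    rw [zpow_neg, zpow_natCast, ← pow_mul, ← inv_pow]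
    exact h₂ _ (by nlinarith [le_max_right N₁ N₂]) x hx hx2

/-- Sign of a letter. -/
def auxSgn (b : Bool) : ℤ := cond b 1 (-1)

/-- The images of the generators. -/
def auxGen {M : Type*} [Group M] (F G : M) {N : ℕ} (i : Fin N) : M :=
  F ^ ((i : ℤ) + 1) * G * (F ^ ((i : ℤ) + 1))⁻¹

theorem auxGen_cons {M : Type*} [Group M] (F G : M) {N : ℕ} (i : Fin N) (b : Bool)
    (L : List (Fin N × Bool)) :
    FreeGroup.lift (auxGen F G) (FreeGroup.mk ((i, b) :: L)) =
      F ^ ((i : ℤ) + 1) * G ^ auxSgn b * F ^ (-((i : ℤ) + 1)) *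
        FreeGroup.lift (auxGen F G) (FreeGroup.mk L) := by
  have : FreeGroup.mk ((i, b) :: L) = FreeGroup.mk [(i, b)] * FreeGroup.mk L := by
    rw [FreeGroup.mul_mk]; rfl
  rw [this, map_mul, zpow_neg]
  congr 1
  generalize hF' : F ^ ((i : ℤ) + 1) = F'
  cases b <;> simp [FreeGroup.lift_mk, auxGen, auxSgn, mul_assoc, hF']

theorem aux_pp (F G : ℝ ≃o ℝ) (S : ℕ → Set ℝ) (U V : Set ℝ) (hd : Disjoint U V) (K : ℕ)
    (hF : ∀ j < K, ∀ x ∈ S j, x ∉ U → ∀ n : ℤ, n ≠ 0 → (F ^ n) x ∈ S (j + 1) ∧ (F ^ n) x ∈ U)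
    (hG : ∀ j < K, ∀ x ∈ S j, x ∉ V → ∀ n : ℤ, n ≠ 0 → (G ^ n) x ∈ S (j + 1) ∧ (G ^ n) x ∈ V)
    (x : ℝ) (hx : x ∈ S 0) (hxU : x ∉ U) {N : ℕ} (L : List (Fin N × Bool)) :
    ∀ (i : Fin N) (b : Bool), FreeGroup.IsReduced ((i, b) :: L) → 2 * (L.length + 1) ≤ K →
      ∃ j < 2 * (L.length + 1), ∃ z ∈ S j, z ∉ V ∧ ∃ n : ℕ, 1 ≤ n ∧
        (FreeGroup.lift (auxGen F G) (FreeGroup.mk ((i, b) :: L))) x =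
          (F ^ ((i : ℤ) + 1)) ((G ^ (auxSgn b * n)) z) := by
  have hUV : ∀ y, y ∈ U → y ∉ V := fun y h1 h2 => Set.disjoint_left.1 hd h1 h2
  have hsg : ∀ (b : Bool) (n : ℕ), 1 ≤ n → auxSgn b * n ≠ 0 := by
    intro b n hn
    cases b <;> simp [auxSgn] <;> omega
  induction L with
  | nil =>
    intro i b _ hK
    obtain ⟨h1, h2⟩ := hF 0 (by simp at hK; omega) x hx hxU (-((i : ℤ) + 1)) (by omega)
    refine ⟨1, by simp, _, h1, hUV _ h2, 1, le_rfl, ?_⟩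
    rw [auxGen_cons]
    simp only [RelIso.mul_apply, Nat.cast_one, mul_one]
    rfl
  | cons c L ih =>
    obtain ⟨i', b'⟩ := c
    intro i b hred hK
    simp only [List.length_cons] at hK ⊢
    have hred' : ((i = i' → b = b')) ∧ FreeGroup.IsReduced ((i', b') :: L) := by
      rw [FreeGroup.isReduced_cons_cons] at hred
      exact hred
    obtain ⟨j, hj, z, hz, hzV, n, hn, he⟩ := ih i' b' hred'.2 (by omega)
    rw [auxGen_cons]
    simp only [RelIso.mul_apply, he]
    by_cases hi : i = i'
    · subst hi
      obtain rfl := hred'.1 rfl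
      refine ⟨j, by omega, z, hz, hzV, n + 1, by omega, ?_⟩
      simp only [← RelIso.mul_apply]
      congr 1
      rw [Nat.cast_add, mul_add, add_comm (auxSgn b * (n : ℤ)), zpow_add G, zpow_neg]
      generalize F ^ ((i : ℤ) + 1) = F'
      simp [mul_assoc]
    · obtain ⟨h1, h2⟩ := hG j (by omega) z hz hzV _ (hsg b' n hn)
      obtain ⟨h3, h4⟩ := hF (j + 1) (by omega) _ h1 (fun h => hUV _ h h2)
        (-((i : ℤ) + 1) + ((i' : ℤ) + 1)) (by
          intro h; apply hi; ext; omega)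
      refine ⟨j + 1 + 1, by omega, _, h3, hUV _ h4, 1, le_rfl, ?_⟩
      rw [zpow_add F (-((i : ℤ) + 1)) ((i' : ℤ) + 1)]
      simp only [RelIso.mul_apply, Nat.cast_one, mul_one]

theorem aux_pp_final (F G : ℝ ≃o ℝ) (S : ℕ → Set ℝ) (U V : Set ℝ) (hd : Disjoint U V) (K : ℕ)
    (hF : ∀ j < K, ∀ x ∈ S j, x ∉ U → ∀ n : ℤ, n ≠ 0 → (F ^ n) x ∈ S (j + 1) ∧ (F ^ n) x ∈ U)
    (hG : ∀ j < K, ∀ x ∈ S j, x ∉ V → ∀ n : ℤ, n ≠ 0 → (G ^ n) x ∈ S (j + 1) ∧ (G ^ n) x ∈ V)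
    (x : ℝ) (hx : x ∈ S 0) (hxU : x ∉ U) {N : ℕ} (w : FreeGroup (Fin N)) (hw : w ≠ 1)
    (hK : 2 * w.toWord.length + 1 ≤ K) :
    FreeGroup.lift (auxGen F G) w ≠ 1 := by
  intro hone
  have hUV : ∀ y, y ∈ U → y ∉ V := fun y h1 h2 => Set.disjoint_left.1 hd h1 h2
  have hne : w.toWord ≠ [] := by
    intro h; exact hw (FreeGroup.toWord_eq_nil_iff.1 h)
  have hmk : FreeGroup.mk w.toWord = w := FreeGroup.mk_toWord
  have hr : FreeGroup.IsReduced w.toWord := FreeGroup.isReduced_toWord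
  obtain ⟨⟨i, b⟩, L, hL⟩ := List.exists_cons_of_ne_nil hne
  rw [hL] at hmk hr hK
  simp only [List.length_cons] at hK
  obtain ⟨j, hj, z, hz, hzV, n, hn, he⟩ :=
    aux_pp F G S U V hd K hF hG x hx hxU L i b hr (by omega)
  have hsg : auxSgn b * n ≠ 0 := by
    cases b <;> simp [auxSgn] <;> omega
  obtain ⟨h1, h2⟩ := hG j (by omega) z hz hzV _ hsg
  obtain ⟨h3, h4⟩ := hF (j + 1) (by omega) _ h1 (fun h => hUV _ h h2) ((i : ℤ) + 1) (by omega)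
  rw [← he, hmk, hone] at h4
  exact hxU h4

theorem aux_move (f : ℝ ≃o ℝ) (s : Set ℝ) (a b δ : ℝ) (N : ℕ)
    (hs : s ⊆ {x | f x = x})
    (hsub : ∀ u, u ∈ Set.Icc a b → f u = u → u ∈ s)
    (hN : ∀ n : ℤ, n ≠ 0 → ∀ x ∈ Set.Icc a b,
      (∀ u ∈ Set.Icc a b, f u = u → δ ≤ |x - u|) →
      ∃ u ∈ Set.Icc a b, f u = u ∧ |((f ^ N) ^ n) x - u| < δ)
    (x c d : ℝ) (hac : a ≤ c) (hdb : d ≤ b) (hc : f c = c) (hd : f d = d)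
    (hx : x ∈ Set.Icc c d) (hxU : x ∉ Metric.thickening δ s) (n : ℤ) (hn : n ≠ 0) :
    ((f ^ N) ^ n) x ∈ Set.Icc c d ∧ ((f ^ N) ^ n) x ∈ Metric.thickening δ s := by
  have hfix : ∀ u, f u = u → ((f ^ N) ^ n) u = u := fun u hu =>
    aux_fix_zpow _ _ (aux_fix_pow f u hu N) n
  refine ⟨⟨?_, ?_⟩, ?_⟩
  · rw [← hfix c hc]; exact ((f ^ N) ^ n).monotone hx.1
  · rw [← hfix d hd]; exact ((f ^ N) ^ n).monotone hx.2
  · obtain ⟨u, hu, hfu, hdist⟩ := hN n hn x ⟨hac.trans hx.1, hx.2.trans hdb⟩ (by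
      intro u hu hfu
      by_contra! hcon
      exact hxU (Metric.mem_thickening_iff.2 ⟨u, hsub u hu hfu, by rwa [Real.dist_eq]⟩))
    exact Metric.mem_thickening_iff.2 ⟨u, hsub u hu hfu, by rwa [Real.dist_eq]⟩

/-- A group satisfies a nontrivial law if for some `n ≥ 1` there is a nontrivial
element `w` of the free group on `n` generators killed by every homomorphism to the group. -/
def SatisfiesLaw (G : Type*) [Group G] : Prop :=
  ∃ n : ℕ, 1 ≤ n ∧ ∃ w : FreeGroup (Fin n), w ≠ 1 ∧ ∀ φ : FreeGroup (Fin n) →* G, φ w = 1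

/-- A fixed point `p` of an orientation-preserving homeomorphism `h` of the line is
topologically transversal: on some punctured `ε`-neighborhood, `h x - x` has one
constant strict sign on the left of `p` and the opposite strict sign on the right
(in particular `p` is isolated among the fixed points of `h`). -/
def IsTransversalFixedPoint (h : ℝ ≃o ℝ) (p : ℝ) : Prop :=
  h p = p ∧ ∃ ε : ℝ, 0 < ε ∧
    (((∀ x ∈ Set.Ioo (p - ε) p, h x < x) ∧ (∀ x ∈ Set.Ioo p (p + ε), x < h x)) ∨
     ((∀ x ∈ Set.Ioo (p - ε) p, x < h x) ∧ (∀ x ∈ Set.Ioo p (p + ε), h x < x)))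

/-- Let `Γ` be a group of orientation-preserving homeomorphisms of the real line
(formalized as order-isomorphisms of `ℝ`). If for every `k ≥ 1` there are `f, g ∈ Γ`
and intertwined reals `p₁ < q₁ < p₂ < q₂ < … < p_{2k+1} < q_{2k+1}` such that `g`
fixes every `pᵢ`, `f` fixes every `qᵢ`, every fixed point of `f` or of `g` in
`[p₁, q_{2k+1}]` is topologically transversal, and `f` and `g` have no common fixed
point in `[p₁, q_{2k+1}]`, then `Γ` satisfies no nontrivial law. -/
theorem no_law_of_intertwined_transversal_fixed_points
    (Γ : Subgroup (ℝ ≃o ℝ))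
    (H : ∀ k : ℕ, 1 ≤ k → ∃ f g : ℝ ≃o ℝ, f ∈ Γ ∧ g ∈ Γ ∧
      ∃ p q : Fin (2 * k + 1) → ℝ,
        (∀ i, p i < q i) ∧
        (∀ i j, i < j → q i < p j) ∧
        (∀ i, g (p i) = p i ∧ f (q i) = q i) ∧
        (∀ x ∈ Set.Icc (p 0) (q (Fin.last (2 * k))),
          f x = x → IsTransversalFixedPoint f x) ∧
        (∀ x ∈ Set.Icc (p 0) (q (Fin.last (2 * k))),
          g x = x → IsTransversalFixedPoint g x) ∧
        (∀ x ∈ Set.Icc (p 0) (q (Fin.last (2 * k))), ¬ (f x = x ∧ g x = x))) :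
    ¬ SatisfiesLaw ↥Γ := by
  rintro ⟨N, -, w, hw, hlaw⟩
  set k := 2 * w.toWord.length + 1 with hk
  obtain ⟨f, g, hf, hg, p, q, hpq, hqp, hfix, -, -, hno⟩ := H k (by omega)
  -- extend to natural indices
  set P : ℕ → ℝ := fun n => p ⟨min n (2 * k), by omega⟩ with hP
  set Q : ℕ → ℝ := fun n => q ⟨min n (2 * k), by omega⟩ with hQ
  have hPQ : ∀ n, P n < Q n := fun n => hpq _
  have hQP : ∀ m n, m < n → n ≤ 2 * k → Q m < P n := by
    intro m n h1 h2
    apply hqp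
    simp only [Fin.mk_lt_mk]
    omega
  have hPm : ∀ m n, m ≤ n → n ≤ 2 * k → P m ≤ P n := by
    intro m n h1 h2
    rcases h1.eq_or_lt with rfl | h
    · exact le_rfl
    · exact (hPQ m).le.trans (hQP m n h h2).le
  have hQm : ∀ m n, m ≤ n → n ≤ 2 * k → Q m ≤ Q n := by
    intro m n h1 h2
    rcases h1.eq_or_lt with rfl | h
    · exact le_rfl
    · exact (hQP m n h h2).le.trans (hPQ n).le
  have hgP : ∀ n, g (P n) = P n := fun n => (hfix _).1
  have hfQ : ∀ n, f (Q n) = Q n := fun n => (hfix _).2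
  have hP0 : p 0 = P 0 := by
    simp only [hP]; congr 1
  have hQl : q (Fin.last (2 * k)) = Q (2 * k) := by
    simp only [hQ]; congr 1; ext; simp
  rw [hP0, hQl] at hno
  set s : Set ℝ := Set.Icc (P 0) (Q (2 * k)) ∩ {x | f x = x} with hs
  set t : Set ℝ := Set.Icc (P 0) (Q (2 * k)) ∩ {x | g x = x} with ht
  have hsc : IsCompact s := isCompact_Icc.inter_right (isClosed_eq f.continuous continuous_id)
  have htc : IsClosed t := isClosed_Icc.inter (isClosed_eq g.continuous continuous_id)
  have hst : Disjoint s t := Set.disjoint_left.2 fun x h1 h2 => hno x h1.1 ⟨h1.2, h2.2⟩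
  obtain ⟨δ, hδ, hdis⟩ := hst.exists_thickenings hsc htc
  obtain ⟨N₁, hN₁⟩ := aux_full f (Q 0) (Q (2 * k)) δ hδ (hfQ _) (hfQ _)
  obtain ⟨N₂, hN₂⟩ := aux_full g (P 0) (P (2 * k)) δ hδ (hgP _) (hgP _)
  have hmain := aux_pp_final (f ^ N₁) (g ^ N₂) (fun j => Set.Icc (P (k - j)) (Q (k + j)))
    (Metric.thickening δ s) (Metric.thickening δ t) hdis k
    (by
      intro j hj x hx hxU n hn
      have h1 := hQP (k - (j + 1)) (k - j) (by omega) (by omega)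
      obtain ⟨h2, h3⟩ := aux_move f s (Q 0) (Q (2 * k)) δ N₁ Set.inter_subset_right
        (fun u hu hfu => ⟨⟨(hPQ 0).le.trans hu.1, hu.2⟩, hfu⟩) hN₁ x
        (Q (k - (j + 1))) (Q (k + j)) (hQm _ _ (by omega) (by omega))
        (hQm _ _ (by omega) (by omega)) (hfQ _) (hfQ _) ⟨h1.le.trans hx.1, hx.2⟩ hxU n hn
      exact ⟨⟨(hPQ _).le.trans h2.1, h2.2.trans (hQm _ _ (by omega) (by omega))⟩, h3⟩)
    (by
      intro j hj x hx hxU n hn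
      have h1 := hQP (k + j) (k + (j + 1)) (by omega) (by omega)
      obtain ⟨h2, h3⟩ := aux_move g t (P 0) (P (2 * k)) δ N₂ Set.inter_subset_right
        (fun u hu hfu => ⟨⟨hu.1, hu.2.trans (hPQ _).le⟩, hfu⟩) hN₂ x
        (P (k - j)) (P (k + (j + 1))) (hPm _ _ (by omega) (by omega))
        (hPm _ _ (by omega) (by omega)) (hgP _) (hgP _) ⟨hx.1, hx.2.trans h1.le⟩ hxU n hn
      exact ⟨⟨(hPm _ _ (by omega) (by omega)).trans h2.1, h2.2.trans (hPQ _).le⟩, h3⟩)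
    (P k) ⟨le_rfl, (hPQ k).le⟩
    (by
      intro h
      refine Set.disjoint_left.1 hdis h (Metric.self_subset_thickening hδ t ?_)
      exact ⟨⟨hPm _ _ (by omega) (by omega),
        (hPQ k).le.trans (hQm _ _ (by omega) (by omega))⟩, hgP k⟩)
    w hw (by omega)
  apply hmain
  set F : Γ := ⟨f, hf⟩ ^ N₁ with hF
  set G : Γ := ⟨g, hg⟩ ^ N₂ with hG
  have h1 := hlaw (FreeGroup.lift (auxGen F G))
  have h2 : FreeGroup.lift (auxGen (f ^ N₁) (g ^ N₂)) =
      Γ.subtype.comp (FreeGroup.lift (auxGen (N := N) F G)) := by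
    ext i : 1
    simp [auxGen, hF, hG]
  rw [h2, MonoidHom.comp_apply, h1, map_one]
end
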